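/- Let K and L be convex bodies in ℝ³, both centrally symmetric about the origin O, with L contained in the interior of K and L strictly convex. Suppose that for every point z on the boundary of K the graze Σ(L,z) is contained in a plane Δ_z, and that K is almost free with respect to L. Then for every x ∈ bd K, the set Ω_x := S(L,x) ∩ S(L,−x) is contained in a plane parallel to the plane Δ_x containing Σ(L,x). -/

import Mathlib

open Metric Set

noncomputable section

/-- The ambient space ℝ³. -/
abbrev E3 := EuclideanSpace ℝ (Fin 3)

/-- The cone generated by `L` with apex `x`:
`C(L,x) = {x + λ (y - x) : y ∈ L, λ ≥ 0}`. -/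
def coneGen (L : Set E3) (x : E3) : Set E3 :=
  {p | ∃ y ∈ L, ∃ l : ℝ, 0 ≤ l ∧ p = x + l • (y - x)}

/-- The support cone `S(L,x)` of `L` from `x`, the boundary of `C(L,x)`. -/
def suppCone (L : Set E3) (x : E3) : Set E3 := frontier (coneGen L x)

/-- The graze `Σ(L,x) = S(L,x) ∩ bd L`. -/
def graze (L : Set E3) (x : E3) : Set E3 := suppCone L x ∩ frontier L

/-- An affine subspace of `ℝ³` is a plane if its direction is 2-dimensional. -/
def IsPlane (P : AffineSubspace ℝ E3) : Prop :=
  Module.finrank ℝ P.direction = 2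

/-- The line through two points. -/
def lineThrough (a b : E3) : Set E3 := ↑(affineSpan ℝ ({a, b} : Set E3))

/-- `K` is almost free with respect to `L` (given the planes `Δ z` containing the
grazes `Σ(L,z)` for `z ∈ bd K`): for every `z ∈ bd K` and every
`w ∈ Π_z ∩ bd K`, where `Π_z` is the plane through the origin parallel to `Δ z`,
the line through `z` and `w` does not meet `L`. -/
def AlmostFree (K L : Set E3) (Δ : E3 → AffineSubspace ℝ E3) : Prop :=
  ∀ z ∈ frontier K, ∀ w ∈ (↑(Δ z).direction : Set E3) ∩ frontier K,
    Disjoint (lineThrough z w) L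

section
/-- linear data -/
structure LinData (k e : ℝ → ℝ) (y1 y2 φ : ℝ × ℝ → ℝ) (K : ℝ) : Prop where
  kcont : Continuous k
  kpos : ∀ a, 0 < k a
  kle : ∀ a, k a ≤ K
  econt : Continuous e
  grad : ∀ g, HasFDerivAt φ
    (y1 g • ContinuousLinearMap.fst ℝ ℝ ℝ + y2 g • ContinuousLinearMap.snd ℝ ℝ ℝ) g
  line : ∀ a g, g.1 * Real.cos a + g.2 * Real.sin a = k a →
    y1 g * Real.cos a + y2 g * Real.sin a = e a
  small : ∀ ε > 0, ∃ R > 0, ∀ g : ℝ × ℝ, R ≤ ‖g‖ → |y1 g| ≤ ε * ‖g‖ ∧ |y2 g| ≤ ε * ‖g‖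

lemma LinData.neg {k e : ℝ → ℝ} {y1 y2 φ : ℝ × ℝ → ℝ} {K : ℝ} (h : LinData k e y1 y2 φ K) :
    LinData k (fun a => - e a) (fun g => - y1 g) (fun g => - y2 g) (fun g => - φ g) K where
  kcont := h.kcont
  kpos := h.kpos
  kle := h.kle
  econt := h.econt.neg
  grad g := by
    refine HasFDerivAt.congr_fderiv (h.grad g).neg ?_
    ext <;> simp
  line a g hg := by have := h.line a g hg; linarith
  small ε hε := by
    obtain ⟨R, hR, H⟩ := h.small ε hε
    exact ⟨R, hR, fun g hg => by simpa using H g hg⟩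

/-- point with coordinates `(κ, s)` in the rotated frame -/
def pt (a κ s : ℝ) : ℝ × ℝ :=
  (κ * Real.cos a - s * Real.sin a, κ * Real.sin a + s * Real.cos a)

lemma pt_dot (a κ s : ℝ) : (pt a κ s).1 * Real.cos a + (pt a κ s).2 * Real.sin a = κ := by
  simp only [pt]; linear_combination κ * Real.sin_sq_add_cos_sq a

lemma pt_dot_add (a κ s δ : ℝ) : (pt a κ s).1 * Real.cos (a + δ) + (pt a κ s).2 * Real.sin (a + δ)
    = κ * Real.cos δ + s * Real.sin δ := by
  simp only [pt, Real.cos_add, Real.sin_add]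
  linear_combination (κ * Real.cos δ + s * Real.sin δ) * Real.sin_sq_add_cos_sq a

lemma pt_norm_le (a κ s : ℝ) : ‖pt a κ s‖ ≤ |κ| + |s| := by
  have h1 := Real.abs_cos_le_one a
  have h2 := Real.abs_sin_le_one a
  rw [Prod.norm_def]
  apply max_le
  · simp only [pt, Real.norm_eq_abs]
    calc _ ≤ |κ * Real.cos a| + |s * Real.sin a| := abs_sub _ _
      _ ≤ _ := by
        rw [abs_mul, abs_mul]
        nlinarith [abs_nonneg κ, abs_nonneg s]
  · simp only [pt, Real.norm_eq_abs]
    calc _ ≤ |κ * Real.sin a| + |s * Real.cos a| := abs_add_le _ _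
      _ ≤ _ := by
        rw [abs_mul, abs_mul]
        nlinarith [abs_nonneg κ, abs_nonneg s]

lemma le_pt_norm (a κ s : ℝ) : |s| / 2 ≤ ‖pt a κ s‖ := by
  have h1 := Real.abs_cos_le_one a
  have h2 := Real.abs_sin_le_one a
  have e : s = -(pt a κ s).1 * Real.sin a + (pt a κ s).2 * Real.cos a := by
    simp only [pt]; linear_combination -s * Real.sin_sq_add_cos_sq a
  have a1 : |(pt a κ s).1| ≤ ‖pt a κ s‖ := norm_fst_le (pt a κ s)
  have a2 : |(pt a κ s).2| ≤ ‖pt a κ s‖ := norm_snd_le (pt a κ s)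
  have : |s| ≤ 2 * ‖pt a κ s‖ := by
    calc |s| = |-(pt a κ s).1 * Real.sin a + (pt a κ s).2 * Real.cos a| := by rw [← e]
      _ ≤ |-(pt a κ s).1 * Real.sin a| + |(pt a κ s).2 * Real.cos a| := abs_add_le _ _
      _ ≤ _ := by
        rw [abs_mul, abs_mul, abs_neg]
        nlinarith [abs_nonneg (pt a κ s).1, abs_nonneg (pt a κ s).2]
  linarith

lemma pt_eq (g : ℝ × ℝ) (a : ℝ) : g = pt a (g.1 * Real.cos a + g.2 * Real.sin a)
    (-g.1 * Real.sin a + g.2 * Real.cos a) := by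
  ext
  · simp only [pt]; linear_combination -g.1 * Real.sin_sq_add_cos_sq a
  · simp only [pt]; linear_combination -g.2 * Real.sin_sq_add_cos_sq a

namespace LinData
variable {k e : ℝ → ℝ} {y1 y2 φ : ℝ × ℝ → ℝ} {K : ℝ}

/-- transversal component -/
lemma line' (h : LinData k e y1 y2 φ K) (a δ κ s : ℝ)
    (hg : κ * Real.cos δ + s * Real.sin δ = k (a + δ)) :
    (y1 (pt a κ s) * Real.cos a + y2 (pt a κ s) * Real.sin a) * Real.cos δ +
    (-y1 (pt a κ s) * Real.sin a + y2 (pt a κ s) * Real.cos a) * Real.sin δ = e (a + δ) := by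
  have := h.line (a + δ) (pt a κ s) (by rw [pt_dot_add, hg])
  rw [← this, Real.cos_add, Real.sin_add]; ring

lemma K_pos (h : LinData k e y1 y2 φ K) : 0 < K := (h.kpos 0).trans_le (h.kle 0)

/-- derivative in the tangential direction -/
lemma deriv_s (h : LinData k e y1 y2 φ K) (a κ s : ℝ) :
    HasDerivAt (fun s => φ (pt a κ s))
      (-y1 (pt a κ s) * Real.sin a + y2 (pt a κ s) * Real.cos a) s := by
  have h1 : HasDerivAt (fun s => pt a κ s) (-Real.sin a, Real.cos a) s := by
    unfold pt
    apply HasDerivAt.prodMk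
    · simpa using ((hasDerivAt_id s).mul_const (Real.sin a)).const_sub (κ * Real.cos a)
    · simpa using ((hasDerivAt_id s).mul_const (Real.cos a)).const_add (κ * Real.sin a)
  refine HasDerivAt.congr_deriv ((h.grad (pt a κ s)).comp_hasDerivAt s h1) ?_
  simp

lemma deriv_κ (h : LinData k e y1 y2 φ K) (a κ s : ℝ) :
    HasDerivAt (fun κ => φ (pt a κ s))
      (y1 (pt a κ s) * Real.cos a + y2 (pt a κ s) * Real.sin a) κ := by
  have h1 : HasDerivAt (fun κ => pt a κ s) (Real.cos a, Real.sin a) κ := by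
    unfold pt
    apply HasDerivAt.prodMk
    · simpa using ((hasDerivAt_id κ).mul_const (Real.cos a)).sub_const (s * Real.sin a)
    · simpa using ((hasDerivAt_id κ).mul_const (Real.sin a)).add_const (s * Real.cos a)
  refine HasDerivAt.congr_deriv ((h.grad (pt a κ s)).comp_hasDerivAt κ h1) ?_
  simp

lemma deriv_a (h : LinData k e y1 y2 φ K) (a s : ℝ) :
    HasDerivAt (fun a => φ (pt a 0 s))
      (-s * (y1 (pt a 0 s) * Real.cos a + y2 (pt a 0 s) * Real.sin a)) a := by
  have h1 : HasDerivAt (fun a => pt a 0 s) (-s * Real.cos a, -s * Real.sin a) a := by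
    unfold pt
    apply HasDerivAt.prodMk
    · simpa using ((Real.hasDerivAt_sin a).const_mul s).const_sub (0 * Real.cos a)
    · simpa using ((Real.hasDerivAt_cos a).const_mul s).const_add (0 * Real.sin a)
  refine HasDerivAt.congr_deriv ((h.grad (pt a 0 s)).comp_hasDerivAt a h1) ?_
  simp; ring

/-- bound of the components of y -/
lemma small' (h : LinData k e y1 y2 φ K) {ε : ℝ} (hε : 0 < ε) :
    ∃ S > 0, ∀ s, S ≤ s → ∀ a κ, |κ| ≤ K →
    |y1 (pt a κ s) * Real.cos a + y2 (pt a κ s) * Real.sin a| ≤ ε * s ∧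
    |-y1 (pt a κ s) * Real.sin a + y2 (pt a κ s) * Real.cos a| ≤ ε * s ∧
    |y1 (pt a κ s)| ≤ ε * s ∧ |y2 (pt a κ s)| ≤ ε * s := by
  have hK := h.K_pos
  obtain ⟨R, hR, H⟩ := h.small (ε / 4) (by positivity)
  refine ⟨2 * R + K, by positivity, fun s hs a κ hκ => ?_⟩
  have hs0 : 0 < s := by linarith
  have hn : R ≤ ‖pt a κ s‖ := by
    have := le_pt_norm a κ s
    rw [abs_of_pos hs0] at this
    linarith
  have hn2 : ‖pt a κ s‖ ≤ 2 * s := by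
    have := pt_norm_le a κ s
    rw [abs_of_pos hs0] at this
    linarith
  obtain ⟨A1, A2⟩ := H _ hn
  have B1 : |y1 (pt a κ s)| ≤ ε * s / 2 := by nlinarith
  have B2 : |y2 (pt a κ s)| ≤ ε * s / 2 := by nlinarith
  have h1 := Real.abs_cos_le_one a
  have h2 := Real.abs_sin_le_one a
  have q1 := abs_nonneg (y1 (pt a κ s))
  have q2 := abs_nonneg (y2 (pt a κ s))
  have hes : 0 < ε * s := by positivity
  refine ⟨?_, ?_, by linarith, by linarith⟩
  · refine (abs_add_le _ _).trans ?_
    rw [abs_mul, abs_mul]; nlinarith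
  · refine (abs_add_le _ _).trans ?_
    rw [abs_mul, abs_mul, abs_neg]; nlinarith

/-- root in a short interval -/
lemma root (h : LinData k e y1 y2 φ K) {η : ℝ} (hη : 0 < η) (hη' : η < 1) :
    ∃ S > 0, ∀ s, S ≤ s → ∀ a κ, κ < k a → |κ| ≤ K → ∃ δ, 0 < δ ∧ δ < η ∧
      κ * Real.cos δ + s * Real.sin δ = k (a + δ) := by
  have hK := h.K_pos
  have hsin : 0 < Real.sin (η/2) := Real.sin_pos_of_pos_of_lt_pi (by positivity) (by linarith [Real.pi_gt_three])
  refine ⟨3 * K / Real.sin (η/2), by positivity, fun s hs a κ hκ hκ' => ?_⟩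
  have hc : ContinuousOn (fun δ => κ * Real.cos δ + s * Real.sin δ - k (a + δ)) (Icc 0 (η/2)) := by
    have := h.kcont
    fun_prop
  have hi := intermediate_value_Icc (by linarith : (0:ℝ) ≤ η/2) hc
  have h0 : (0:ℝ) ∈ Icc (κ * Real.cos 0 + s * Real.sin 0 - k (a + 0))
      (κ * Real.cos (η/2) + s * Real.sin (η/2) - k (a + (η/2))) := by
    constructor
    · simp; linarith
    · have := h.kle (a + η/2)
      have h3 : 3 * K ≤ s * Real.sin (η/2) := by rwa [div_le_iff₀ hsin] at hs
      have h4 : |κ * Real.cos (η/2)| ≤ K := by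
        rw [abs_mul]
        nlinarith [Real.abs_cos_le_one (η/2), abs_nonneg κ]
      have := (abs_le.1 h4).1
      linarith
  obtain ⟨δ, hδ, hd⟩ := hi h0
  refine ⟨δ, lt_of_le_of_ne hδ.1 ?_, by linarith [hδ.2], by simpa [sub_eq_zero] using hd⟩
  rintro rfl
  simp at hd; linarith

end LinData

end

section
namespace LinData
variable {k e : ℝ → ℝ} {y1 y2 φ : ℝ × ℝ → ℝ} {K : ℝ}

lemma on_opp (h : LinData k e y1 y2 φ K) (a s : ℝ) :
    y1 (pt a (-k (a + Real.pi)) s) * Real.cos a + y2 (pt a (-k (a + Real.pi)) s) * Real.sin a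
      = - e (a + Real.pi) := by
  have := h.line' a Real.pi (-k (a + Real.pi)) s (by simp)
  simp at this
  linarith

lemma abs_opp_le (h : LinData k e y1 y2 φ K) (a : ℝ) : |(-k (a + Real.pi))| ≤ K := by
  rw [abs_neg, abs_of_pos (h.kpos _)]; exact h.kle _

lemma opp_lt (h : LinData k e y1 y2 φ K) (a : ℝ) : -k (a + Real.pi) < k a := by
  linarith [h.kpos a, h.kpos (a + Real.pi)]

lemma one_sub_cos_le (δ : ℝ) : 1 - Real.cos δ ≤ δ ^ 2 / 2 := by
  linarith [Real.one_sub_sq_div_two_le_cos (x := δ)]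

lemma odd (h : LinData k e y1 y2 φ K) (a : ℝ) : e (a + Real.pi) = - e a := by
  have hK := h.K_pos
  suffices H : ∀ ε > 0, |e (a + Real.pi) + e a| ≤ ε by
    have : |e (a + Real.pi) + e a| ≤ 0 := le_of_forall_pos_le_add (by simpa using H)
    have := abs_nonpos_iff.1 this
    linarith
  intro ε hε
  obtain ⟨S, hS, H⟩ := h.small' (ε := ε / (6 * K)) (by positivity)
  obtain ⟨η1, hη1, h1⟩ := Metric.continuousAt_iff.1 (h.econt.continuousAt (x := a)) (ε / 3) (by positivity)
  set M := |e (a + Real.pi)| with hM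
  have hM0 : 0 ≤ M := abs_nonneg _
  set η := min (min η1 (1/2)) (ε / (3 * (M + 1))) with hη
  have hηpos : 0 < η := by positivity
  obtain ⟨S', hS', H'⟩ := h.root (η := η) hηpos (by
    have : η ≤ 1/2 := (min_le_left _ _).trans (min_le_right _ _)
    linarith)
  set s := max S S' with hs
  obtain ⟨δ, hδ0, hδ, hroot⟩ := H' s (le_max_right _ _) a _ (h.opp_lt a) (h.abs_opp_le a)
  obtain ⟨-, hZ, -⟩ := H s (le_max_left _ _) a _ (h.abs_opp_le a)
  have hl := h.line' a δ _ s hroot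
  rw [h.on_opp] at hl
  set Z := -y1 (pt a (-k (a + Real.pi)) s) * Real.sin a + y2 (pt a (-k (a + Real.pi)) s) * Real.cos a
  have hspos : 0 < s := hS.trans_le (le_max_left _ _)
  have hδ1 : δ < 1/2 := hδ.trans_le ((min_le_left _ _).trans (min_le_right _ _))
  have hδ2 : δ < η1 := hδ.trans_le ((min_le_left _ _).trans (min_le_left _ _))
  have hδ3 : δ * (3 * (M + 1)) < ε := by
    have := hδ.trans_le (min_le_right _ _)
    rwa [lt_div_iff₀ (by positivity)] at this
  have hsin : 0 < Real.sin δ := Real.sin_pos_of_pos_of_lt_pi hδ0 (by linarith [Real.pi_gt_three])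
  have hss : s * Real.sin δ ≤ 2 * K := by
    have b1 := h.kle (a + δ)
    have b2 := h.kle (a + Real.pi)
    have b3 := h.kpos (a + Real.pi)
    have := Real.cos_le_one δ
    nlinarith
  have hZs : |Z * Real.sin δ| ≤ ε / 3 := by
    rw [abs_mul, abs_of_pos hsin]
    calc |Z| * Real.sin δ ≤ (ε / (6 * K) * s) * Real.sin δ := by gcongr
      _ = ε / (6 * K) * (s * Real.sin δ) := by ring
      _ ≤ ε / (6 * K) * (2 * K) := by gcongr
      _ = ε / 3 := by field_simp; norm_num
  have he : |e (a + δ) - e a| < ε / 3 := by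
    have := @h1 (a + δ) (by simp [Real.dist_eq, abs_of_pos hδ0, hδ2])
    simpa [Real.dist_eq] using this
  have hc : |e (a + Real.pi) * (1 - Real.cos δ)| ≤ ε / 3 := by
    rw [abs_mul, abs_of_nonneg (by linarith [Real.cos_le_one δ] : 0 ≤ 1 - Real.cos δ)]
    have := one_sub_cos_le δ
    have : 1 - Real.cos δ ≤ δ := by nlinarith
    calc M * (1 - Real.cos δ) ≤ M * δ := by gcongr
      _ ≤ ε / 3 := by nlinarith
  rw [abs_le] at *
  rw [abs_lt] at he
  constructor <;> nlinarith [hZs.1, hZs.2, he.1, he.2, hc.1, hc.2]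

/-- reflection -/
lemma refl (h : LinData k e y1 y2 φ K) :
    LinData (fun a => k (Real.pi - a)) (fun a => e (Real.pi - a))
      (fun g => - y1 (-g.1, g.2)) (fun g => y2 (-g.1, g.2)) (fun g => φ (-g.1, g.2)) K where
  kcont := by have := h.kcont; fun_prop
  kpos a := h.kpos _
  kle a := h.kle _
  econt := by have := h.econt; fun_prop
  grad g := by
    have h1 : HasFDerivAt (fun g : ℝ × ℝ => ((-g.1, g.2) : ℝ × ℝ))
      ((-ContinuousLinearMap.fst ℝ ℝ ℝ).prod (ContinuousLinearMap.snd ℝ ℝ ℝ)) g :=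
      (hasFDerivAt_fst.neg).prodMk hasFDerivAt_snd
    refine HasFDerivAt.congr_fderiv ((h.grad (-g.1, g.2)).comp g h1) ?_
    ext <;> simp
  line a g hg := by
    have := h.line (Real.pi - a) (-g.1, g.2) (by simpa [Real.cos_pi_sub, Real.sin_pi_sub] using hg)
    rw [← this]
    simp [Real.cos_pi_sub, Real.sin_pi_sub]
  small ε hε := by
    obtain ⟨R, hR, H⟩ := h.small ε hε
    refine ⟨R, hR, fun g hg => ?_⟩
    have e1 : ‖((-g.1, g.2) : ℝ × ℝ)‖ = ‖g‖ := by simp [Prod.norm_def]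
    have := H (-g.1, g.2) (by rw [e1]; exact hg)
    rw [e1] at this
    simpa using this

/-- shifting to the central line -/
lemma shift (h : LinData k e y1 y2 φ K) {ε : ℝ} (hε : 0 < ε) :
    ∃ S > 0, ∀ s, S ≤ s → ∀ a κ, |κ| ≤ K → |φ (pt a κ s) - φ (pt a 0 s)| ≤ ε * s := by
  have hK := h.K_pos
  obtain ⟨S, hS, H⟩ := h.small' (ε := ε / K) (by positivity)
  refine ⟨S, hS, fun s hs a κ hκ => ?_⟩
  have hs0 : 0 < s := hS.trans_le hs
  have := Convex.norm_image_sub_le_of_norm_hasDerivWithin_le (f := fun κ => φ (pt a κ s))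
    (f' := fun κ => y1 (pt a κ s) * Real.cos a + y2 (pt a κ s) * Real.sin a)
    (s := Icc (-K) K) (C := ε / K * s) (x := 0) (y := κ)
    (fun x hx => (h.deriv_κ a x s).hasDerivWithinAt)
    (fun x hx => (H s hs a x (abs_le.2 hx)).1) (convex_Icc _ _) (by constructor <;> linarith)
    (abs_le.1 hκ)
  rw [Real.norm_eq_abs, Real.norm_eq_abs, sub_zero] at this
  refine this.trans ?_
  calc ε / K * s * |κ| ≤ ε / K * s * K := by gcongr
    _ = ε * s := by field_simp

/-- upper slope bound at an upper touching point -/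
lemma slope_le (h : LinData k e y1 y2 φ K) {χ : ℝ → ℝ} {a d : ℝ} (hχ : HasDerivAt χ d a)
    (hmax : IsLocalMax (fun t => e t - χ t) a) :
    ∀ ε > 0, ∃ S > 0, ∀ s, S ≤ s → φ (pt a 0 s) ≤ (d + ε) * s := by
  intro ε hε
  have hK := h.K_pos
  -- local difference quotient bound
  obtain ⟨η, hη, hη1, hq⟩ : ∃ η > 0, η < 1 ∧ ∀ δ, 0 < δ → δ < η →
      e (a + δ) - Real.cos δ * e a ≤ (d + ε / 4) * Real.sin δ := by
    have l1 : HasDerivAt (fun δ => (d + ε / 4) * Real.sin δ + Real.cos δ * e a - (e a + χ (a + δ) - χ a))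
        (ε / 4) 0 := by
      have a1 := (Real.hasDerivAt_sin 0).const_mul (d + ε / 4)
      have a2 := (Real.hasDerivAt_cos 0).mul_const (e a)
      have a3 : HasDerivAt (fun δ => χ (a + δ)) d 0 := by
        have : HasDerivAt χ d (a + 0) := by simpa using hχ
        simpa using this.comp_const_add a 0
      have a4 := (a1.add a2).sub ((a3.const_add (e a)).sub_const (χ a))
      refine a4.congr_deriv ?_
      simp
    have l2 := l1.isLittleO
    have l3 := (Asymptotics.isLittleO_iff.1 l2) (c := ε / 8) (by positivity)
    have hm : ∀ᶠ δ in nhds (0:ℝ), e (a + δ) - χ (a + δ) ≤ e a - χ a := by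
      have : Filter.Tendsto (fun δ => a + δ) (nhds 0) (nhds a) := by
        have : Continuous (fun δ : ℝ => a + δ) := by fun_prop
        simpa using this.tendsto 0
      exact this.eventually hmax
    obtain ⟨η, hη, H⟩ := Metric.eventually_nhds_iff.1 (l3.and hm)
    refine ⟨min η (1/2), by positivity, by linarith [min_le_right η (1/2)], fun δ h0 h1 => ?_⟩
    have := @H δ (by simp [Real.dist_eq, abs_of_pos h0]; exact h1.trans_le (min_le_left _ _))
    obtain ⟨t1, t2⟩ := this
    simp only [Real.sin_zero, mul_zero, Real.cos_zero, one_mul, add_zero, sub_zero, smul_eq_mul,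
      Real.norm_eq_abs, abs_of_pos h0] at t1
    have := (abs_le.1 t1).1
    nlinarith
  obtain ⟨S1, hS1, H1⟩ := h.root hη hη1
  obtain ⟨S2, hS2, H2⟩ := h.shift (ε := ε / 4) (by positivity)
  set κ := -k (a + Real.pi) with hκ
  set S3 := max S1 S2
  have hder : ∀ s, S3 ≤ s → deriv (fun s => φ (pt a κ s)) s ≤ d + ε / 4 := by
    intro s hs
    rw [(h.deriv_s a κ s).deriv]
    obtain ⟨δ, h0, h1, hr⟩ := H1 s ((le_max_left _ _).trans hs) a κ (h.opp_lt a) (h.abs_opp_le a)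
    have hl := h.line' a δ κ s hr
    rw [h.on_opp, h.odd, neg_neg] at hl
    have hsin : 0 < Real.sin δ := Real.sin_pos_of_pos_of_lt_pi h0 (by linarith [Real.pi_gt_three])
    have := hq δ h0 h1
    by_contra hcon
    push Not at hcon
    nlinarith
  have hmv : ∀ s, S3 ≤ s → φ (pt a κ s) - φ (pt a κ S3) ≤ (d + ε / 4) * (s - S3) := by
    intro s hs
    have hd : Differentiable ℝ (fun s => φ (pt a κ s)) := fun s => (h.deriv_s a κ s).differentiableAt
    refine Convex.image_sub_le_mul_sub_of_deriv_le (convex_Icc S3 s) hd.continuous.continuousOn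
      hd.differentiableOn ?_ S3 (left_mem_Icc.2 hs) s (right_mem_Icc.2 hs) hs
    intro x hx
    rw [interior_Icc] at hx
    exact hder x hx.1.le
  set C := φ (pt a κ S3) - (d + ε / 4) * S3 with hCdef
  refine ⟨max S3 (4 * |C| / ε + 1), by positivity, fun s hs => ?_⟩
  have hs3 := (le_max_left _ _).trans hs
  have hs4 := (le_max_right _ _).trans hs
  have hC : |C| ≤ ε / 4 * s := by
    have : 4 * |C| / ε ≤ s := by linarith
    rw [div_le_iff₀ hε] at this
    linarith
  have a1 := hmv s hs3
  have a2 := (abs_le.1 (H2 s ((le_max_right _ _).trans hs3) a κ (h.abs_opp_le a))).1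
  have a3 := (abs_le.1 hC).2
  have hs0 : 0 < s := by
    have : 0 ≤ 4 * |C| / ε := by positivity
    linarith
  nlinarith [hCdef]

/-- slope limit at an upper touching point -/
lemma slope_max (h : LinData k e y1 y2 φ K) {χ : ℝ → ℝ} {a d : ℝ} (hχ : HasDerivAt χ d a)
    (hmax : IsLocalMax (fun t => e t - χ t) a) :
    ∀ ε > 0, ∃ S > 0, ∀ s, S ≤ s → |φ (pt a 0 s) - d * s| ≤ ε * s := by
  intro ε hε
  obtain ⟨S1, hS1, H1⟩ := h.slope_le hχ hmax ε hε
  have hχ' : HasDerivAt (fun t => χ (-t)) (-d) (-a) := by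
    have : HasDerivAt χ d (-(-a)) := by simpa using hχ
    exact (this.comp (-a) (hasDerivAt_neg (-a))).congr_deriv (by simp)
  have hmax' : IsLocalMax (fun t => - e (Real.pi - t) - χ (-t)) (-a) := by
    have e1 : ∀ t, - e (Real.pi - t) = e (-t) := by
      intro t
      have := h.odd (-t)
      rw [show Real.pi - t = -t + Real.pi by ring, this, neg_neg]
    simp only [e1]
    have : Filter.Tendsto (fun t : ℝ => -t) (nhds (-a)) (nhds a) := by
      simpa using (continuous_neg (G := ℝ)).tendsto (-a)
    have := this.eventually hmax
    simpa [IsLocalMax, IsMaxFilter] using this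
  obtain ⟨S2, hS2, H2⟩ := h.refl.neg.slope_le hχ' hmax' ε hε
  refine ⟨max S1 S2, by positivity, fun s hs => ?_⟩
  have b1 := H1 s ((le_max_left _ _).trans hs)
  have b2 := H2 s ((le_max_right _ _).trans hs)
  have e2 : ((-(pt (-a) 0 s).1, (pt (-a) 0 s).2) : ℝ × ℝ) = pt a 0 s := by
    simp [pt]
  rw [e2] at b2
  rw [abs_le]
  constructor <;> linarith

lemma slope_extr (h : LinData k e y1 y2 φ K) {χ : ℝ → ℝ} {a d : ℝ} (hχ : HasDerivAt χ d a)
    (hext : IsLocalExtr (fun t => e t - χ t) a) :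
    ∀ ε > 0, ∃ S > 0, ∀ s, S ≤ s → |φ (pt a 0 s) - d * s| ≤ ε * s := by
  rcases hext with hmin | hmax
  · intro ε hε
    have hm : IsLocalMax (fun t => - e t - (- χ t)) a := by
      have := hmin.neg
      have e1 : (fun t => - e t - (- χ t)) = fun t => -(e t - χ t) := by funext t; ring
      rw [e1]; exact this
    obtain ⟨S, hS, H⟩ := h.neg.slope_max hχ.neg hm ε hε
    refine ⟨S, hS, fun s hs => ?_⟩
    have := H s hs
    rw [abs_le] at *
    constructor <;> linarith
  · exact h.slope_max hχ hmax

end LinData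

end

section
namespace LinData
variable {k e : ℝ → ℝ} {y1 y2 φ : ℝ × ℝ → ℝ} {K : ℝ}

/-- asymptotic angular variation -/
lemma angular (h : LinData k e y1 y2 φ K) {A B : ℝ} (hAB : A ≤ B) {ε : ℝ} (hε : 0 < ε) :
    ∃ S > 0, ∀ s, S ≤ s → |φ (pt B 0 s) - φ (pt A 0 s) + s * ∫ t in A..B, e t| ≤ ε * s := by
  have hK := h.K_pos
  set D := B - A + 1 with hD
  have hD0 : 0 < D := by linarith
  have huc := (isCompact_Icc (a := A) (b := B + 1)).uniformContinuousOn_of_continuous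
    h.econt.continuousOn
  rw [Metric.uniformContinuousOn_iff] at huc
  obtain ⟨η0, hη0, hu⟩ := huc (ε / (2 * D)) (by positivity)
  set η := min η0 (1/2)
  have hη : 0 < η := by positivity
  have hηh : η ≤ 1/2 := min_le_right _ _
  obtain ⟨S1, hS1, H1⟩ := h.root hη (by linarith)
  obtain ⟨S2, hS2, H2⟩ := h.small' (ε := ε / (4 * D * K)) (by positivity)
  refine ⟨max S1 S2, by positivity, fun s hs => ?_⟩
  have hs1 := (le_max_left _ _).trans hs
  have hs2 := (le_max_right _ _).trans hs
  have hs0 : 0 < s := hS1.trans_le hs1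
  have key : ∀ c ∈ Icc A B, |y1 (pt c 0 s) * Real.cos c + y2 (pt c 0 s) * Real.sin c - e c| ≤ ε / D := by
    intro c hc
    obtain ⟨δ, h0, h1, hr⟩ := H1 s hs1 c 0 (h.kpos c) (by simpa using hK.le)
    obtain ⟨hY, hZ, -, -⟩ := H2 s hs2 c 0 (by simpa using hK.le)
    have hl := h.line' c δ 0 s hr
    set Y := y1 (pt c 0 s) * Real.cos c + y2 (pt c 0 s) * Real.sin c
    set Z := -y1 (pt c 0 s) * Real.sin c + y2 (pt c 0 s) * Real.cos c
    have hsd : s * Real.sin δ ≤ K := by have := h.kle (c + δ); linarith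
    have hsin : 0 < Real.sin δ := Real.sin_pos_of_pos_of_lt_pi h0 (by linarith [Real.pi_gt_three])
    have hcs : 1 - Real.cos δ ≤ Real.sin δ := by
      have q1 := one_sub_cos_le δ
      have q2 := Real.mul_le_sin h0.le (by linarith [Real.pi_gt_three])
      have q3 : 1/2 ≤ 2 / Real.pi := by
        rw [div_le_div_iff₀ (by norm_num) Real.pi_pos]; linarith [Real.pi_le_four]
      nlinarith
    have hcs0 : 0 ≤ 1 - Real.cos δ := by linarith [Real.cos_le_one δ]
    have hE : ε / (4 * D * K) * K = ε / (4 * D) := by field_simp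
    have b1 : |Z * Real.sin δ| ≤ ε / (4 * D) := by
      rw [abs_mul, abs_of_pos hsin, ← hE]
      calc |Z| * Real.sin δ ≤ (ε / (4 * D * K) * s) * Real.sin δ := by gcongr
        _ = ε / (4 * D * K) * (s * Real.sin δ) := by ring
        _ ≤ _ := by gcongr
    have b2 : |Y * (1 - Real.cos δ)| ≤ ε / (4 * D) := by
      rw [abs_mul, abs_of_nonneg hcs0, ← hE]
      calc |Y| * (1 - Real.cos δ) ≤ (ε / (4 * D * K) * s) * Real.sin δ := by gcongr
        _ = ε / (4 * D * K) * (s * Real.sin δ) := by ring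
        _ ≤ _ := by gcongr
    have b3 : |e (c + δ) - e c| < ε / (2 * D) := by
      have := hu (c + δ) ⟨by linarith [hc.1], by linarith [hc.2]⟩ c ⟨hc.1, by linarith [hc.2]⟩
        (by simp [abs_of_pos h0]; exact h1.trans_le (min_le_left _ _))
      simpa [Real.dist_eq] using this
    have e4 : Y - e c = (e (c + δ) - e c) + Y * (1 - Real.cos δ) - Z * Real.sin δ := by
      rw [← hl]; ring
    have e5 : ε / (2 * D) + ε / (4 * D) + ε / (4 * D) = ε / D := by field_simp; norm_num
    rw [e4, ← e5]
    rw [abs_lt] at b3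
    rw [abs_le] at *
    constructor <;> linarith
  have hder : ∀ c ∈ Icc A B, HasDerivWithinAt (fun c => φ (pt c 0 s) + s * ∫ t in A..c, e t)
      (-s * (y1 (pt c 0 s) * Real.cos c + y2 (pt c 0 s) * Real.sin c) + s * e c) (Icc A B) c := by
    intro c hc
    apply HasDerivAt.hasDerivWithinAt
    refine (h.deriv_a c s).add (HasDerivAt.const_mul s ?_)
    exact intervalIntegral.integral_hasDerivAt_right (h.econt.intervalIntegrable _ _)
      h.econt.aestronglyMeasurable.stronglyMeasurableAtFilter h.econt.continuousAt
  have := Convex.norm_image_sub_le_of_norm_hasDerivWithin_le (C := s * (ε / D)) hder (by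
    intro c hc
    rw [Real.norm_eq_abs]
    have : -s * (y1 (pt c 0 s) * Real.cos c + y2 (pt c 0 s) * Real.sin c) + s * e c
      = -s * (y1 (pt c 0 s) * Real.cos c + y2 (pt c 0 s) * Real.sin c - e c) := by ring
    rw [this, abs_mul, abs_neg, abs_of_pos hs0]
    exact mul_le_mul_of_nonneg_left (key c hc) hs0.le) (convex_Icc A B)
    (left_mem_Icc.2 hAB) (right_mem_Icc.2 hAB)
  simp only [intervalIntegral.integral_same, mul_zero, add_zero, Real.norm_eq_abs] at this
  rw [abs_of_nonneg (by linarith : 0 ≤ B - A)] at this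
  calc _ = |φ (pt B 0 s) + s * (∫ t in A..B, e t) - φ (pt A 0 s)| := by congr 1; ring
    _ ≤ _ := this
    _ ≤ s * (ε / D) * D := by gcongr; linarith
    _ = ε * s := by field_simp

/-- `φ` has asymptotic slope `d` in direction `a`. -/
def Slope (φ : ℝ × ℝ → ℝ) (a d : ℝ) : Prop :=
  ∀ ε > 0, ∃ S > 0, ∀ s, S ≤ s → |φ (pt a 0 s) - d * s| ≤ ε * s

lemma Slope.unique {a d d' : ℝ} (h : Slope φ a d) (h' : Slope φ a d') : d = d' := by
  suffices H : ∀ ε > 0, |d - d'| ≤ ε by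
    have : |d - d'| ≤ 0 := le_of_forall_pos_le_add (by simpa using H)
    have := abs_nonpos_iff.1 this
    linarith
  intro ε hε
  obtain ⟨S1, hS1, H1⟩ := h (ε / 2) (by positivity)
  obtain ⟨S2, hS2, H2⟩ := h' (ε / 2) (by positivity)
  set s := max S1 S2
  have hs0 : 0 < s := hS1.trans_le (le_max_left _ _)
  have b1 := H1 s (le_max_left _ _)
  have b2 := H2 s (le_max_right _ _)
  have : |d - d'| * s ≤ ε * s := by
    rw [← abs_of_pos hs0, ← abs_mul, abs_of_pos hs0]
    rw [abs_le] at *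
    constructor <;> nlinarith
  exact le_of_mul_le_mul_right this hs0

lemma slope_move (h : LinData k e y1 y2 φ K) {a d : ℝ} (hs : Slope φ a d) (b : ℝ) :
    Slope φ b (d - ∫ t in a..b, e t) := by
  intro ε hε
  obtain ⟨S1, hS1, H1⟩ := hs (ε / 2) (by positivity)
  rcases le_total a b with hab | hab
  · obtain ⟨S2, hS2, H2⟩ := h.angular hab (ε := ε / 2) (by positivity)
    refine ⟨max S1 S2, by positivity, fun s hs => ?_⟩
    have b1 := H1 s ((le_max_left _ _).trans hs)
    have b2 := H2 s ((le_max_right _ _).trans hs)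
    rw [abs_le] at *
    constructor <;> nlinarith
  · obtain ⟨S2, hS2, H2⟩ := h.angular hab (ε := ε / 2) (by positivity)
    refine ⟨max S1 S2, by positivity, fun s hs => ?_⟩
    have b1 := H1 s ((le_max_left _ _).trans hs)
    have b2 := H2 s ((le_max_right _ _).trans hs)
    rw [intervalIntegral.integral_symm]
    rw [abs_le] at *
    constructor <;> nlinarith

lemma exists_lin (h : LinData k e y1 y2 φ K) :
    ∃ z1 z2 : ℝ, ∀ a, e a = z1 * Real.cos a + z2 * Real.sin a := by
  obtain ⟨a0, -, ha0⟩ := exists_isLocalExtr_Ioo (f := e) (a := 0) (b := 2 * Real.pi)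
    (by positivity) h.econt.continuousOn (by
      have h1 := h.odd 0
      have h2 := h.odd (0 + Real.pi)
      rw [show 0 + Real.pi + Real.pi = 2 * Real.pi by ring] at h2
      linarith)
  have hs0 : Slope φ a0 0 := h.slope_extr (χ := fun _ => 0) (hasDerivAt_const a0 0) (by simpa using ha0)
  set E : ℝ → ℝ := fun a => 0 - ∫ t in a0..a, e t with hE
  have hsl : ∀ a, Slope φ a (E a) := fun a => h.slope_move hs0 a
  have hEd : ∀ a, HasDerivAt E (- e a) a := by
    intro a
    have := (intervalIntegral.integral_hasDerivAt_right (h.econt.intervalIntegrable a0 a)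
      h.econt.aestronglyMeasurable.stronglyMeasurableAtFilter h.econt.continuousAt).const_sub 0
    exact this
  have hEc : Continuous E := continuous_iff_continuousAt.2 fun a => (hEd a).continuousAt
  set I : ℝ → ℝ := fun a => ∫ t in a0..a, E t with hI
  have hId : ∀ a, HasDerivAt I (E a) a := fun a =>
    intervalIntegral.integral_hasDerivAt_right (hEc.intervalIntegrable a0 a)
      hEc.aestronglyMeasurable.stronglyMeasurableAtFilter hEc.continuousAt
  have hIc : Continuous I := continuous_iff_continuousAt.2 fun a => (hId a).continuousAt
  have hconst : ∀ a b, a < b → e a - I a = e b - I b := by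
    intro a b hab
    set m := ((e b - I b) - (e a - I a)) / (b - a) with hm
    have hba : 0 < b - a := by linarith
    have hmm : m * (b - a) = (e b - I b) - (e a - I a) := by rw [hm]; field_simp
    obtain ⟨c, -, hc⟩ := exists_isLocalExtr_Ioo (f := fun t => e t - (I t + m * t)) hab
      (by have := h.econt; fun_prop) (by linarith)
    have hd : HasDerivAt (fun t => I t + m * t) (E c + m) c := by
      exact ((hId c).add ((hasDerivAt_id c).const_mul m)).congr_deriv (by simp)
    have := (Slope.unique (hsl c) (h.slope_extr hd hc))
    have hm0 : m = 0 := by linarith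
    rw [hm0] at hmm
    linarith
  have hee : ∀ a, e a = (e 0 - I 0) + I a := by
    intro a
    rcases lt_trichotomy 0 a with h1 | h1 | h1
    · have := hconst 0 a h1; linarith
    · subst h1; ring
    · have := hconst a 0 h1; linarith
  have hed : ∀ a, HasDerivAt e (E a) a := by
    intro a
    have : e = fun a => (e 0 - I 0) + I a := funext hee
    rw [this]
    exact (hId a).const_add _
  have c1 : ∀ a, e a * Real.cos a - E a * Real.sin a = e 0 * Real.cos 0 - E 0 * Real.sin 0 := by
    intro a
    have hd : ∀ a, HasDerivAt (fun a => e a * Real.cos a - E a * Real.sin a) 0 a := by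
      intro a
      refine (((hed a).mul (Real.hasDerivAt_cos a)).sub ((hEd a).mul (Real.hasDerivAt_sin a))).congr_deriv ?_
      ring
    exact is_const_of_deriv_eq_zero (fun a => (hd a).differentiableAt) (fun a => (hd a).deriv) a 0
  have c2 : ∀ a, e a * Real.sin a + E a * Real.cos a = e 0 * Real.sin 0 + E 0 * Real.cos 0 := by
    intro a
    have hd : ∀ a, HasDerivAt (fun a => e a * Real.sin a + E a * Real.cos a) 0 a := by
      intro a
      refine (((hed a).mul (Real.hasDerivAt_sin a)).add ((hEd a).mul (Real.hasDerivAt_cos a))).congr_deriv ?_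
      ring
    exact is_const_of_deriv_eq_zero (fun a => (hd a).differentiableAt) (fun a => (hd a).deriv) a 0
  refine ⟨e 0, E 0, fun a => ?_⟩
  have h1 := c1 a
  have h2 := c2 a
  simp only [Real.cos_zero, Real.sin_zero, mul_one, mul_zero, sub_zero, zero_add] at h1 h2
  rw [← h1, ← h2]
  linear_combination -e a * Real.sin_sq_add_cos_sq a

end LinData

end

section
/-- planar data of the contact map in a frame -/
structure PD (k : ℝ → ℝ) (p1 p2 ψ : ℝ × ℝ → ℝ) (K : ℝ) : Prop where
  kcont : Continuous k
  kpos : ∀ a, 0 < k a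
  kle : ∀ a, k a ≤ K
  c1 : Continuous p1
  c2 : Continuous p2
  grad : ∀ g, HasFDerivAt ψ
    (p1 g • ContinuousLinearMap.fst ℝ ℝ ℝ + p2 g • ContinuousLinearMap.snd ℝ ℝ ℝ) g
  H2 : ∀ a, ∃ w1 w2 μ : ℝ, (w1 ≠ 0 ∨ w2 ≠ 0) ∧ ∀ g : ℝ × ℝ,
    g.1 * Real.cos a + g.2 * Real.sin a = k a → w1 * p1 g + w2 * p2 g = μ

/-- the exterior region -/
def XX (k : ℝ → ℝ) : Set (ℝ × ℝ) := {g | ∃ a, k a < g.1 * Real.cos a + g.2 * Real.sin a}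

lemma XX_ray {k : ℝ → ℝ} (hk : ∀ a, 0 < k a) {g : ℝ × ℝ} (hg : g ∈ XX k) {t : ℝ} (ht : 1 ≤ t) :
    t • g ∈ XX k := by
  obtain ⟨a, ha⟩ := hg
  refine ⟨a, ?_⟩
  have := hk a
  simp only [Prod.smul_fst, Prod.smul_snd, smul_eq_mul]
  nlinarith

lemma exists_angle (g : ℝ × ℝ) : ∃ a, g.1 = Real.sqrt (g.1^2+g.2^2) * Real.cos a ∧
    g.2 = Real.sqrt (g.1^2+g.2^2) * Real.sin a := by
  set z : ℂ := ⟨g.1, g.2⟩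
  have hz : ‖z‖ = Real.sqrt (g.1^2+g.2^2) := by
    rw [Complex.norm_def, Complex.normSq_apply]; congr 1; simp [z]; ring
  refine ⟨Complex.arg z, ?_, ?_⟩
  · rw [← hz, Complex.norm_mul_cos_arg]
  · rw [← hz, Complex.norm_mul_sin_arg]

lemma norm_le_sqrt (g : ℝ × ℝ) : ‖g‖ ≤ Real.sqrt (g.1^2+g.2^2) := by
  rw [Prod.norm_def]
  apply max_le
  · rw [Real.norm_eq_abs]; exact Real.abs_le_sqrt (by nlinarith [sq_nonneg g.2])
  · rw [Real.norm_eq_abs]; exact Real.abs_le_sqrt (by nlinarith [sq_nonneg g.1])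

lemma mem_XX_of_norm {k : ℝ → ℝ} {K : ℝ} (hk : ∀ a, k a ≤ K) {g : ℝ × ℝ} (hg : K < ‖g‖) :
    g ∈ XX k := by
  obtain ⟨a, h1, h2⟩ := exists_angle g
  refine ⟨a, ?_⟩
  have := norm_le_sqrt g
  set r := Real.sqrt (g.1^2+g.2^2)
  have e : g.1 * Real.cos a + g.2 * Real.sin a = r := by
    rw [h1, h2]; linear_combination r * Real.sin_sq_add_cos_sq a
  rw [e]
  linarith [hk a]

/-- root lemma -/
lemma XX_roots {k : ℝ → ℝ} (hc : Continuous k) (hk : ∀ a, 0 < k a) {g : ℝ × ℝ} {a : ℝ}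
    (ha : k a < g.1 * Real.cos a + g.2 * Real.sin a) :
    ∃ a1 a2, a < a1 ∧ a1 < a + Real.pi ∧ a - Real.pi < a2 ∧ a2 < a ∧
      g.1 * Real.cos a1 + g.2 * Real.sin a1 = k a1 ∧
      g.1 * Real.cos a2 + g.2 * Real.sin a2 = k a2 ∧ Real.sin (a1 - a2) ≠ 0 := by
  have hp := Real.pi_pos
  set F : ℝ → ℝ := fun t => g.1 * Real.cos t + g.2 * Real.sin t - k t with hF
  have hFc : Continuous F := by fun_prop
  have hFa : 0 < F a := by simp only [hF]; linarith
  have hF1 : F (a + Real.pi) < 0 := by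
    simp only [hF, Real.cos_add_pi, Real.sin_add_pi]; linarith [hk a, hk (a + Real.pi)]
  have hF2 : F (a - Real.pi) < 0 := by
    simp only [hF, Real.cos_sub_pi, Real.sin_sub_pi]; linarith [hk a, hk (a - Real.pi)]
  obtain ⟨a1, h1, e1⟩ := intermediate_value_Icc' (by linarith : a ≤ a + Real.pi) hFc.continuousOn
    (show (0:ℝ) ∈ Icc (F (a + Real.pi)) (F a) from ⟨hF1.le, hFa.le⟩)
  obtain ⟨a2, h2, e2⟩ := intermediate_value_Icc (by linarith : a - Real.pi ≤ a) hFc.continuousOn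
    (show (0:ℝ) ∈ Icc (F (a - Real.pi)) (F a) from ⟨hF2.le, hFa.le⟩)
  have n1 : a ≠ a1 := by rintro rfl; linarith
  have n2 : a1 ≠ a + Real.pi := by rintro rfl; linarith
  have n3 : a - Real.pi ≠ a2 := by rintro rfl; linarith
  have n4 : a2 ≠ a := by rintro rfl; linarith
  have l1 := lt_of_le_of_ne h1.1 n1
  have l2 := lt_of_le_of_ne h1.2 n2
  have l3 := lt_of_le_of_ne h2.1 n3
  have l4 := lt_of_le_of_ne h2.2 n4
  simp only [hF] at e1 e2
  refine ⟨a1, a2, l1, l2, l3, l4, by linarith, by linarith, ?_⟩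
  intro hs
  have hd : a1 - a2 = Real.pi := by
    have : Real.sin (a1 - a2 - Real.pi) = 0 := by rw [Real.sin_sub_pi, hs, neg_zero]
    have := (Real.sin_eq_zero_iff_of_lt_of_lt (by linarith) (by linarith)).1 this
    linarith
  have : a1 = a2 + Real.pi := by linarith
  rw [this, Real.cos_add_pi, Real.sin_add_pi] at e1
  linarith [hk a2, hk (a2 + Real.pi)]

/-- solving a planar linear system -/
lemma solve2 {a b x y : ℝ} (hs : Real.sin (a - b) ≠ 0)
    (h1 : x * Real.cos a + y * Real.sin a = 0) (h2 : x * Real.cos b + y * Real.sin b = 0) :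
    x = 0 ∧ y = 0 := by
  rw [Real.sin_sub] at hs
  constructor
  · apply (mul_eq_zero.1 (_ : x * (Real.sin a * Real.cos b - Real.cos a * Real.sin b) = 0)).resolve_right hs
    linear_combination -Real.sin b * h1 + Real.sin a * h2
  · apply (mul_eq_zero.1 (_ : y * (Real.sin a * Real.cos b - Real.cos a * Real.sin b) = 0)).resolve_right hs
    linear_combination Real.cos b * h1 - Real.cos a * h2

/-- Lemma E. -/
theorem PD.lemmaE {k : ℝ → ℝ} {p1 p2 ψ : ℝ × ℝ → ℝ} {K : ℝ} (h : PD k p1 p2 ψ K)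
    (hsm : ∀ ε > 0, ∃ R > 0, ∀ g : ℝ × ℝ, R ≤ ‖g‖ → |p1 g - g.1| ≤ ε * ‖g‖ ∧ |p2 g - g.2| ≤ ε * ‖g‖) :
    ∃ z1 z2, ∀ g ∈ XX k, p1 g = g.1 + z1 ∧ p2 g = g.2 + z2 := by
  set e : ℝ → ℝ := fun a => (p1 (pt a (k a) 0) - (pt a (k a) 0).1) * Real.cos a +
    (p2 (pt a (k a) 0) - (pt a (k a) 0).2) * Real.sin a with he
  have hK : 0 < K := (h.kpos 0).trans_le (h.kle 0)
  have hl : LinData k e (fun g => p1 g - g.1) (fun g => p2 g - g.2)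
      (fun g => ψ g - (g.1^2 + g.2^2)/2) K := by
    refine ⟨h.kcont, h.kpos, h.kle, ?_, ?_, ?_, hsm⟩
    · have a1 := h.kcont
      have a2 := h.c1
      have a3 := h.c2
      have a4 : Continuous fun a => pt a (k a) 0 := by unfold pt; fun_prop
      simp only [he]
      fun_prop
    · intro g
      have d1 : HasFDerivAt (fun g : ℝ × ℝ => g.1) (ContinuousLinearMap.fst ℝ ℝ ℝ) g := hasFDerivAt_fst
      have d2 : HasFDerivAt (fun g : ℝ × ℝ => g.2) (ContinuousLinearMap.snd ℝ ℝ ℝ) g := hasFDerivAt_snd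
      have d3 := (((d1.pow 2).add (d2.pow 2)).const_mul (1/2))
      have d4 := (h.grad g).sub d3
      have e5 : (fun g : ℝ × ℝ => ψ g - (g.1^2 + g.2^2)/2) = fun g => ψ g - 1/2 * (g.1^2 + g.2^2) := by
        funext g; ring
      rw [e5]
      refine HasFDerivAt.congr_fderiv d4 ?_
      ext <;> simp <;> ring
    · intro a g hg
      obtain ⟨w1, w2, μ, hw, H⟩ := h.H2 a
      -- w is parallel to u_a
      have hperp : -w1 * Real.sin a + w2 * Real.cos a = 0 := by
        set v := -w1 * Real.sin a + w2 * Real.cos a with hv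
        set D := |w1| + |w2| with hD
        have hD0 : 0 < D := by
          rcases hw with hw | hw
          · have := abs_pos.2 hw; positivity
          · have := abs_pos.2 hw; positivity
        set C := |μ - k a * (w1 * Real.cos a + w2 * Real.sin a)| with hC
        suffices Hs : ∀ ε > 0, |v| ≤ ε by
          have : |v| ≤ 0 := le_of_forall_pos_le_add (by simpa using Hs)
          exact abs_nonpos_iff.1 this
        intro ε hε
        obtain ⟨R, hR, HR⟩ := hsm (ε / (4 * D)) (by positivity)
        set s := 2 * R + K + 2 * C / ε with hs
        have hC0 : 0 ≤ C := abs_nonneg _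
        have hCe : 0 ≤ 2 * C / ε := by positivity
        have hs0 : 0 < s := by linarith
        set q := pt a (k a) s with hq
        have n1 : R ≤ ‖q‖ := by
          have := le_pt_norm a (k a) s
          rw [abs_of_pos hs0] at this; linarith
        have n2 : ‖q‖ ≤ 2 * s := by
          have := pt_norm_le a (k a) s
          rw [abs_of_pos hs0, abs_of_pos (h.kpos a)] at this; linarith [h.kle a]
        obtain ⟨r1, r2⟩ := HR q n1
        have hH := H q (pt_dot a (k a) s)
        have e1 : w1 * q.1 + w2 * q.2 = k a * (w1 * Real.cos a + w2 * Real.sin a) + s * v := by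
          simp only [hq, pt, hv]; ring
        have e2 : s * v = (μ - k a * (w1 * Real.cos a + w2 * Real.sin a)) - w1 * (p1 q - q.1) - w2 * (p2 q - q.2) := by
          linarith
        have e3 : s * |v| ≤ C + D * (ε / (4 * D) * (2 * s)) := by
          rw [← abs_of_pos hs0, ← abs_mul, abs_of_pos hs0, e2]
          have t1 : |w1 * (p1 q - q.1)| ≤ |w1| * (ε / (4 * D) * (2 * s)) := by
            rw [abs_mul]
            exact mul_le_mul_of_nonneg_left (r1.trans (by gcongr)) (abs_nonneg _)
          have t2 : |w2 * (p2 q - q.2)| ≤ |w2| * (ε / (4 * D) * (2 * s)) := by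
            rw [abs_mul]
            exact mul_le_mul_of_nonneg_left (r2.trans (by gcongr)) (abs_nonneg _)
          refine (abs_sub _ _).trans ?_
          refine (add_le_add_left (abs_sub _ _) _).trans ?_
          rw [hD, add_mul]; linarith
        have e4 : D * (ε / (4 * D) * (2 * s)) = ε / 2 * s := by field_simp; norm_num
        have e5 : C ≤ ε / 2 * s := by
          have : 2 * C / ε ≤ s := by linarith
          rw [div_le_iff₀ hε] at this; linarith
        rw [e4] at e3
        have : s * |v| ≤ s * ε := by linarith
        exact le_of_mul_le_mul_left this hs0
      set κ := w1 * Real.cos a + w2 * Real.sin a with hκ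
      have sc := Real.sin_sq_add_cos_sq a
      have ew1 : w1 = κ * Real.cos a := by
        rw [hκ]; linear_combination -w1 * sc - Real.sin a * hperp
      have ew2 : w2 = κ * Real.sin a := by
        rw [hκ]; linear_combination -w2 * sc + Real.cos a * hperp
      have hκ0 : κ ≠ 0 := by
        intro h0
        rw [h0, zero_mul] at ew1 ew2
        rcases hw with hw | hw
        · exact hw ew1
        · exact hw ew2
      have j1 := H g hg
      have hpd := pt_dot a (k a) 0
      have j2 := H (pt a (k a) 0) hpd
      simp only [he]
      rw [ew1, ew2] at j1 j2
      apply mul_left_cancel₀ hκ0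
      linear_combination j1 - j2 - κ * hg + κ * hpd
  obtain ⟨z1, z2, hz⟩ := hl.exists_lin
  refine ⟨z1, z2, ?_⟩
  rintro g ⟨a, ha⟩
  obtain ⟨a1, a2, -, -, -, -, r1, r2, hs⟩ := XX_roots h.kcont h.kpos ha
  have q1 := hl.line a1 g r1
  have q2 := hl.line a2 g r2
  rw [hz] at q1 q2
  have := solve2 (x := p1 g - g.1 - z1) (y := p2 g - g.2 - z2) hs (by linarith) (by linarith)
  constructor <;> linarith [this.1, this.2]

end

section
/-- integrating the gradient on the exterior region -/
theorem PD.potential {k : ℝ → ℝ} {p1 p2 ψ : ℝ × ℝ → ℝ} {K : ℝ} (h : PD k p1 p2 ψ K)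
    {m11 m12 m22 z1 z2 : ℝ} (hp : ∀ g ∈ XX k, p1 g = m11 * g.1 + m12 * g.2 + z1 ∧
      p2 g = m12 * g.1 + m22 * g.2 + z2) :
    ∃ c0, ∀ g ∈ XX k, ψ g = (m11 * g.1^2 + 2 * m12 * g.1 * g.2 + m22 * g.2^2)/2
      + z1 * g.1 + z2 * g.2 + c0 := by
  have hK : 0 < K := (h.kpos 0).trans_le (h.kle 0)
  set φ : ℝ × ℝ → ℝ := fun g => ψ g - ((m11 * (g.1 * g.1) + 2 * m12 * (g.1 * g.2) + m22 * (g.2 * g.2))/2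
      + z1 * g.1 + z2 * g.2) with hφ
  have hd : ∀ g ∈ XX k, HasFDerivAt φ (0 : ℝ × ℝ →L[ℝ] ℝ) g := by
    intro g hg
    have d1 : HasFDerivAt (fun g : ℝ × ℝ => g.1) (ContinuousLinearMap.fst ℝ ℝ ℝ) g := hasFDerivAt_fst
    have d2 : HasFDerivAt (fun g : ℝ × ℝ => g.2) (ContinuousLinearMap.snd ℝ ℝ ℝ) g := hasFDerivAt_snd
    have d3 := ((((d1.mul d1).const_mul m11).add ((d1.mul d2).const_mul (2 * m12))).add
      ((d2.mul d2).const_mul m22)).mul_const (1/2)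
    have d4 := (h.grad g).sub ((d3.add (d1.const_mul z1)).add (d2.const_mul z2))
    have e5 : φ = fun g => ψ g - (((m11 * (g.1 * g.1) + 2 * m12 * (g.1 * g.2) + m22 * (g.2 * g.2))*(1/2)
      + z1 * g.1) + z2 * g.2) := by
      funext g; simp only [hφ]; ring
    rw [e5]
    refine HasFDerivAt.congr_fderiv d4 ?_
    obtain ⟨q1, q2⟩ := hp g hg
    ext <;> simp [q1, q2] <;> ring
  have hray : ∀ g ∈ XX k, ∀ T : ℝ, 1 ≤ T → φ (T • g) = φ g := by
    intro g hg T hT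
    have hdt : ∀ t ∈ Icc 1 T, HasDerivWithinAt (fun t : ℝ => φ (t • g)) 0 (Icc 1 T) t := by
      intro t ht
      have a1 : HasDerivAt (fun t : ℝ => t • g) g t := by
        simpa using (hasDerivAt_id t).smul_const g
      have := (hd (t • g) (XX_ray h.kpos hg ht.1)).comp_hasDerivAt t a1
      exact (this.congr_deriv (by simp)).hasDerivWithinAt
    have := Convex.norm_image_sub_le_of_norm_hasDerivWithin_le (C := 0) hdt (by simp) (convex_Icc _ _)
      (left_mem_Icc.2 hT) (right_mem_Icc.2 hT)
    simp at this
    linarith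
  set r := 2 * K + 1 with hr
  have hmem : ∀ a, pt a r 0 ∈ XX k := by
    intro a
    refine ⟨a, ?_⟩
    rw [pt_dot]
    linarith [h.kle a]
  have hcirc : ∀ a, φ (pt a r 0) = φ (pt 0 r 0) := by
    intro a
    have hda : ∀ a, HasDerivAt (fun a => φ (pt a r 0)) 0 a := by
      intro a
      have a1 : HasDerivAt (fun a => pt a r 0) (r * (-Real.sin a), r * Real.cos a) a := by
        have : (fun a => pt a r 0) = fun a => (r * Real.cos a, r * Real.sin a) := by
          funext a; simp [pt]
        rw [this]
        exact ((Real.hasDerivAt_cos a).const_mul r).prodMk ((Real.hasDerivAt_sin a).const_mul r)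
      have := (hd (pt a r 0) (hmem a)).comp_hasDerivAt a a1
      exact (this.congr_deriv (by simp))
    exact is_const_of_deriv_eq_zero (fun a => (hda a).differentiableAt) (fun a => (hda a).deriv) a 0
  refine ⟨φ (pt 0 r 0), fun g hg => ?_⟩
  suffices H : φ g = φ (pt 0 r 0) by
    rw [← H]; simp only [hφ]; ring
  obtain ⟨a, h1, h2⟩ := exists_angle g
  set R := Real.sqrt (g.1^2+g.2^2) with hR
  have hR0 : 0 < R := by
    obtain ⟨b, hb⟩ := hg
    rcases (Real.sqrt_nonneg (g.1^2+g.2^2)).lt_or_eq with h3 | h3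
    · exact h3
    · rw [← hR] at h3
      rw [h1, h2, ← h3] at hb
      simp at hb
      linarith [h.kpos b]
  have hgp : g = pt a R 0 := by
    ext
    · simp only [pt]; rw [← h1]; ring
    · simp only [pt]; rw [← h2]; ring
  have hsc : ∀ T x : ℝ, T • pt a x 0 = pt a (T * x) 0 := by
    intro T x; ext <;> simp [pt] <;> ring
  rw [← hcirc a]
  rcases le_total R r with hRr | hRr
  · rw [← hray g hg (r / R) ((one_le_div hR0).2 hRr), hgp, hsc, div_mul_cancel₀ _ hR0.ne']
  · have hr0 : 0 < r := by linarith
    rw [← hray _ (hmem a) (R / r) ((one_le_div hr0).2 hRr), hsc, div_mul_cancel₀ _ hr0.ne', ← hgp]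

/-- extension of a quadratic relation from far away to the exterior region -/
theorem PD.chain {k : ℝ → ℝ} {p1 p2 ψ : ℝ × ℝ → ℝ} {K : ℝ} (h : PD k p1 p2 ψ K)
    {B11 B12 B22 β1 β2 γ R : ℝ}
    (hf1 : ∀ g : ℝ × ℝ, R ≤ ‖g‖ → B11 * p1 g + B12 * p2 g - β1 = g.1)
    (hf2 : ∀ g : ℝ × ℝ, R ≤ ‖g‖ → B12 * p1 g + B22 * p2 g - β2 = g.2)
    (hf3 : ∀ g : ℝ × ℝ, R ≤ ‖g‖ → 2 * (g.1 * p1 g + g.2 * p2 g - ψ g) =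
      B11 * p1 g ^ 2 + 2 * B12 * p1 g * p2 g + B22 * p2 g ^ 2 - 2 * (β1 * p1 g + β2 * p2 g) + γ) :
    ∀ g ∈ XX k, B11 * p1 g + B12 * p2 g - β1 = g.1 ∧ B12 * p1 g + B22 * p2 g - β2 = g.2 ∧
      2 * (g.1 * p1 g + g.2 * p2 g - ψ g) =
      B11 * p1 g ^ 2 + 2 * B12 * p1 g * p2 g + B22 * p2 g ^ 2 - 2 * (β1 * p1 g + β2 * p2 g) + γ := by
  have hK : 0 < K := (h.kpos 0).trans_le (h.kle 0)
  set D := B11 * B22 - B12 ^ 2 with hD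
  set T := |R| + 1 with hT
  have hT0 : 0 < T := by positivity
  have hRT : R ≤ T := by linarith [le_abs_self R]
  have hDne : D ≠ 0 := by
    intro h0
    have n1 : ∀ t, T ≤ t → R ≤ ‖((t, 0) : ℝ × ℝ)‖ := by
      intro t ht
      have : ‖t‖ ≤ ‖((t, 0) : ℝ × ℝ)‖ := norm_fst_le (t, (0:ℝ))
      rw [Real.norm_eq_abs, abs_of_pos (by linarith)] at this; linarith
    have n2 : ∀ t, T ≤ t → R ≤ ‖((0, t) : ℝ × ℝ)‖ := by
      intro t ht
      have : ‖t‖ ≤ ‖((0, t) : ℝ × ℝ)‖ := norm_snd_le ((0:ℝ), t)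
      rw [Real.norm_eq_abs, abs_of_pos (by linarith)] at this; linarith
    have A : ∀ g : ℝ × ℝ, R ≤ ‖g‖ → B22 * (g.1 + β1) = B12 * (g.2 + β2) := by
      intro g hg
      have r1 := hf1 g hg
      have r2 := hf2 g hg
      linear_combination -B22 * r1 + B12 * r2 + p1 g * h0 - p1 g * hD
    have A' : ∀ g : ℝ × ℝ, R ≤ ‖g‖ → B12 * (g.1 + β1) = B11 * (g.2 + β2) := by
      intro g hg
      have r1 := hf1 g hg
      have r2 := hf2 g hg
      linear_combination -B12 * r1 + B11 * r2 - p2 g * h0 + p2 g * hD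
    have x1 := A _ (n1 T le_rfl)
    have x2 := A _ (n1 (2 * T) (by linarith))
    have x3 := A' _ (n1 T le_rfl)
    have x4 := A' _ (n1 (2 * T) (by linarith))
    have x5 := A' _ (n2 T le_rfl)
    have x6 := A' _ (n2 (2 * T) (by linarith))
    simp only at x1 x2 x3 x4 x5 x6
    have b22 : B22 = 0 := by
      have : B22 * T = 0 := by linarith
      exact (mul_eq_zero.1 this).resolve_right hT0.ne'
    have b12 : B12 = 0 := by
      have : B12 * T = 0 := by linarith
      exact (mul_eq_zero.1 this).resolve_right hT0.ne'
    have b11 : B11 = 0 := by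
      have : B11 * T = 0 := by linarith
      exact (mul_eq_zero.1 this).resolve_right hT0.ne'
    have y1 := hf1 _ (n1 T le_rfl)
    have y2 := hf1 _ (n1 (2 * T) (by linarith))
    simp only [b11, b12] at y1 y2
    linarith
  have hline : ∀ a, ∀ g : ℝ × ℝ, g.1 * Real.cos a + g.2 * Real.sin a = k a →
      (B11 * p1 g + B12 * p2 g - β1 - g.1) * Real.cos a +
      (B12 * p1 g + B22 * p2 g - β2 - g.2) * Real.sin a = 0 := by
    intro a g hg
    obtain ⟨w1, w2, μ, hw, H⟩ := h.H2 a
    set ga := pt a (k a) (2 * T)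
    set gb := pt a (k a) (4 * T)
    have na : R ≤ ‖ga‖ := by
      have := le_pt_norm a (k a) (2 * T)
      rw [abs_of_pos (by linarith)] at this; linarith
    have nb : R ≤ ‖gb‖ := by
      have := le_pt_norm a (k a) (4 * T)
      rw [abs_of_pos (by linarith)] at this; linarith
    have la : ga.1 * Real.cos a + ga.2 * Real.sin a = k a := pt_dot _ _ _
    have lb : gb.1 * Real.cos a + gb.2 * Real.sin a = k a := pt_dot _ _ _
    have wa := H ga la
    have wb := H gb lb
    have wg := H g hg
    have e1 : gb.1 - ga.1 = -(2 * T) * Real.sin a := by simp only [ga, gb, pt]; ring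
    have e2 : gb.2 - ga.2 = 2 * T * Real.cos a := by simp only [ga, gb, pt]; ring
    have fa1 := hf1 ga na
    have fa2 := hf2 ga na
    have fb1 := hf1 gb nb
    have fb2 := hf2 gb nb
    -- adj(B) w is parallel to u_a
    set v1 := B22 * w1 - B12 * w2 with hv1
    set v2 := B11 * w2 - B12 * w1 with hv2
    have hperp : -v1 * Real.sin a + v2 * Real.cos a = 0 := by
      have : 2 * T * (-v1 * Real.sin a + v2 * Real.cos a) = 0 := by
        have : v1 * (gb.1 - ga.1) + v2 * (gb.2 - ga.2) = D * ((w1 * p1 gb + w2 * p2 gb) - (w1 * p1 ga + w2 * p2 ga)) := by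
          rw [← fa1, ← fa2, ← fb1, ← fb2, hv1, hv2, hD]; ring
        rw [wa, wb, e1, e2] at this
        linarith
      exact (mul_eq_zero.1 this).resolve_left (by positivity)
    have sc := Real.sin_sq_add_cos_sq a
    set κ := v1 * Real.cos a + v2 * Real.sin a with hκ
    have ev1 : v1 = κ * Real.cos a := by
      rw [hκ]; linear_combination -v1 * sc - Real.sin a * hperp
    have ev2 : v2 = κ * Real.sin a := by
      rw [hκ]; linear_combination -v2 * sc + Real.cos a * hperp
    have dw1 : D * w1 = B11 * v1 + B12 * v2 := by rw [hv1, hv2, hD]; ring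
    have dw2 : D * w2 = B12 * v1 + B22 * v2 := by rw [hv1, hv2, hD]; ring
    have hκ0 : κ ≠ 0 := by
      intro h0
      rw [h0, zero_mul] at ev1 ev2
      rw [ev1, ev2] at dw1 dw2
      simp [hDne] at dw1 dw2
      rcases hw with hw | hw
      · exact hw dw1
      · exact hw dw2
    apply mul_left_cancel₀ hκ0
    have q : κ * ((B11 * p1 g + B12 * p2 g) * Real.cos a + (B12 * p1 g + B22 * p2 g) * Real.sin a)
        = κ * ((B11 * p1 ga + B12 * p2 ga) * Real.cos a + (B12 * p1 ga + B22 * p2 ga) * Real.sin a) := by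
      have i : ∀ x y, κ * ((B11 * x + B12 * y) * Real.cos a + (B12 * x + B22 * y) * Real.sin a)
          = D * (w1 * x + w2 * y) := by
        intro x y
        have : D * (w1 * x + w2 * y) = (D * w1) * x + (D * w2) * y := by ring
        rw [this, dw1, dw2, ev1, ev2]; ring
      rw [i, i, wa, wg]
    linear_combination q - κ * hg + κ * la + κ * Real.cos a * fa1 + κ * Real.sin a * fa2
  have hX : ∀ g ∈ XX k, B11 * p1 g + B12 * p2 g - β1 = g.1 ∧ B12 * p1 g + B22 * p2 g - β2 = g.2 := by
    rintro g ⟨a, ha⟩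
    obtain ⟨a1, a2, -, -, -, -, r1, r2, hs⟩ := XX_roots h.kcont h.kpos ha
    have := solve2 hs (hline a1 g r1) (hline a2 g r2)
    constructor <;> linarith [this.1, this.2]
  have hX' : ∀ g ∈ XX k, p1 g = (B22 / D) * g.1 + (-B12 / D) * g.2 + (B22 * β1 - B12 * β2) / D ∧
      p2 g = (-B12 / D) * g.1 + (B11 / D) * g.2 + (B11 * β2 - B12 * β1) / D := by
    intro g hg
    obtain ⟨r1, r2⟩ := hX g hg
    constructor
    · field_simp
      rw [← r1, ← r2, hD]; ring
    · field_simp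
      rw [← r1, ← r2, hD]; ring
  obtain ⟨c0, hc0⟩ := h.potential hX'
  -- the third relation differs by a constant
  have hJ : ∀ g ∈ XX k, 2 * (g.1 * p1 g + g.2 * p2 g - ψ g) -
      (B11 * p1 g ^ 2 + 2 * B12 * p1 g * p2 g + B22 * p2 g ^ 2 - 2 * (β1 * p1 g + β2 * p2 g))
      = -2 * c0 + (B22 * β1 ^ 2 - 2 * B12 * β1 * β2 + B11 * β2 ^2) / D := by
    intro g hg
    obtain ⟨r1, r2⟩ := hX' g hg
    rw [hc0 g hg, r1, r2]
    field_simp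
    rw [hD]
    ring
  intro g hg
  obtain ⟨r1, r2⟩ := hX g hg
  refine ⟨r1, r2, ?_⟩
  have hfar : pt 0 (2 * K + |R|) 0 ∈ XX k := ⟨0, by rw [pt_dot]; linarith [h.kle 0, abs_nonneg R]⟩
  have hn : R ≤ ‖pt 0 (2 * K + |R|) 0‖ := by
    have : ‖2 * K + |R|‖ ≤ ‖pt 0 (2 * K + |R|) 0‖ := by
      have := norm_fst_le (pt 0 (2 * K + |R|) 0)
      simpa [pt] using this
    rw [Real.norm_eq_abs, abs_of_pos (by positivity)] at this
    linarith [le_abs_self R]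
  have j1 := hJ g hg
  have j2 := hJ _ hfar
  have j3 := hf3 _ hn
  linarith

end

section
lemma abs_sin_sub_le (x y z : ℝ) : |Real.sin (x - z)| ≤ |Real.sin (x - y)| + |Real.sin (y - z)| := by
  have e : x - z = (x - y) + (y - z) := by ring
  rw [e, Real.sin_add]
  refine (abs_add_le _ _).trans ?_
  rw [abs_mul, abs_mul]
  have h1 := Real.abs_cos_le_one (x - y)
  have h2 := Real.abs_cos_le_one (y - z)
  nlinarith [abs_nonneg (Real.sin (x - y)), abs_nonneg (Real.sin (y - z))]

lemma bd_aux {m m' M x y : ℝ} (h1 : |m| ≤ M) (h2 : |m'| ≤ M) (hx : |x| ≤ 1) (hy : |y| ≤ 1) :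
    |m * x - m' * y| ≤ 2 * M := by
  refine (abs_sub _ _).trans ?_
  rw [abs_mul, abs_mul]
  have q1 : |m| * |x| ≤ M * 1 := mul_le_mul h1 hx (abs_nonneg _) ((abs_nonneg _).trans h1)
  have q2 : |m'| * |y| ≤ M * 1 := mul_le_mul h2 hy (abs_nonneg _) ((abs_nonneg _).trans h2)
  linarith

set_option maxHeartbeats 1000000 in
theorem PD.flat_cr {k : ℝ → ℝ} {p1 p2 ψ : ℝ × ℝ → ℝ} {K : ℝ} (h : PD k p1 p2 ψ K)
    (hfl : ∀ c0 > 0, ∀ Kb : ℝ, ∃ R : ℝ, ∀ g : ℝ × ℝ, R ≤ ‖g‖ → c0 * ‖g‖ ≤ |g.1| →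
      Kb * ‖g‖ ≤ |p1 g| + |p2 g|) {θ μ : ℝ → ℝ}
    (hθ : ∀ a, ∀ g : ℝ × ℝ, g.1 * Real.cos a + g.2 * Real.sin a = k a →
      p1 g * Real.cos (θ a) + p2 g * Real.sin (θ a) = μ a) {M : ℝ} (hM0 : 0 < M) (hM : ∀ a, |μ a| ≤ M) :
    ∀ A B, A ≤ B → (∀ a ∈ Icc A B, Real.sin a ≠ 0) → ∀ ε > 0, ∃ δ0 > 0, ∀ δ, 0 < δ → δ < δ0 →
      ∀ a ∈ Icc A B, |Real.sin (θ a - θ (a + Real.pi - δ))| ≤ ε * δ := by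
  have hK : 0 < K := (h.kpos 0).trans_le (h.kle 0)
  intro A B hAB hs ε hε
  obtain ⟨a0, -, ha0⟩ := isCompact_Icc.exists_isMinOn (nonempty_Icc.2 (by linarith [Real.pi_pos] : A - 1 ≤ B + Real.pi))
    h.kcont.continuousOn
  set k0 := k a0 with hk0
  have hk00 : 0 < k0 := h.kpos a0
  obtain ⟨a1, ha1m, ha1⟩ := isCompact_Icc.exists_isMinOn (nonempty_Icc.2 hAB)
    (Real.continuous_sin.abs.continuousOn)
  set σ := |Real.sin a1| with hσ
  have hσ0 : 0 < σ := abs_pos.2 (hs a1 ha1m)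
  obtain ⟨R, hR⟩ := hfl (σ / 4) (by positivity) (8 * M / (k0 * ε))
  -- s large
  set S := 2 * |R| + 4 * K / σ + K with hS
  have hS0 : 0 < S := by positivity
  refine ⟨min 1 (k0 / S), by positivity, fun δ hd0 hd1 a ha => ?_⟩
  have hd11 : δ < 1 := hd1.trans_le (min_le_left _ _)
  have hdS : δ * S < k0 := by
    have := hd1.trans_le (min_le_right _ _)
    rwa [lt_div_iff₀ hS0] at this
  have hsin : 0 < Real.sin δ := Real.sin_pos_of_pos_of_lt_pi hd0 (by linarith [Real.pi_gt_three])
  have hsinle : Real.sin δ ≤ δ := Real.sin_le hd0.le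
  have hcos : 0 < Real.cos δ := Real.cos_pos_of_mem_Ioo ⟨by linarith [Real.pi_gt_three], by linarith [Real.pi_gt_three]⟩
  set b := a + Real.pi - δ with hb
  have hkb : k0 ≤ k b := ha0 (show b ∈ Icc (A - 1) (B + Real.pi) from
    ⟨by linarith [ha.1, Real.pi_gt_three], by linarith [ha.2]⟩)
  set s := (k b + k a * Real.cos δ) / Real.sin δ with hsdef
  have hss : s * Real.sin δ = k b + k a * Real.cos δ := by rw [hsdef]; field_simp
  have hka := h.kpos a
  have hs0 : 0 < s := by
    rw [hsdef]
    have := h.kpos b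
    positivity
  have hsd : k0 ≤ s * δ := by
    calc k0 ≤ k b := hkb
      _ ≤ s * Real.sin δ := by rw [hss]; nlinarith
      _ ≤ s * δ := by gcongr
  have hSs : S ≤ s := by
    by_contra hcon
    push Not at hcon
    nlinarith
  set g := pt a (k a) s with hg
  have ga : g.1 * Real.cos a + g.2 * Real.sin a = k a := pt_dot _ _ _
  have gb : g.1 * Real.cos b + g.2 * Real.sin b = k b := by
    have := pt_dot_add a (k a) s (Real.pi - δ)
    rw [show a + (Real.pi - δ) = b by rw [hb]; ring, Real.cos_pi_sub, Real.sin_pi_sub, ← hg] at this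
    rw [this]; linarith
  have n1 := le_pt_norm a (k a) s
  have n2 := pt_norm_le a (k a) s
  rw [abs_of_pos hs0, ← hg] at n1
  rw [abs_of_pos hs0, abs_of_pos hka, ← hg] at n2
  have hKs : 0 < 4 * K / σ := by positivity
  have hR0 := abs_nonneg R
  have nR : R ≤ ‖g‖ := by
    have := le_abs_self R
    linarith
  have hg1 : σ / 4 * ‖g‖ ≤ |g.1| := by
    have q1 : |s * Real.sin a| ≤ |g.1| + K := by
      have e : s * Real.sin a = k a * Real.cos a - g.1 := by simp only [hg, pt]; ring
      rw [e]
      refine (abs_sub _ _).trans ?_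
      rw [abs_mul, abs_of_pos hka]
      have := Real.abs_cos_le_one a
      nlinarith [h.kle a]
    have q2 : σ ≤ |Real.sin a| := ha1 ha
    rw [abs_mul, abs_of_pos hs0] at q1
    have q3 : 4 * K ≤ s * σ := by
      have : 4 * K / σ ≤ s := by linarith
      rwa [div_le_iff₀ hσ0] at this
    have q4 : ‖g‖ ≤ 2 * s := by linarith [h.kle a]
    nlinarith
  have hp := hR g nR hg1
  have ea := hθ a g ga
  have eb := hθ b g gb
  set C := Real.sin (θ a - θ b) with hC
  have c1 : C * p1 g = μ b * Real.sin (θ a) - μ a * Real.sin (θ b) := by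
    rw [hC, Real.sin_sub, ← ea, ← eb]; ring
  have c2 : C * p2 g = μ a * Real.cos (θ b) - μ b * Real.cos (θ a) := by
    rw [hC, Real.sin_sub, ← ea, ← eb]; ring
  have d1 : |C| * |p1 g| ≤ 2 * M := by
    rw [← abs_mul, c1, abs_sub_comm]; exact bd_aux (hM _) (hM _) (Real.abs_sin_le_one _) (Real.abs_sin_le_one _)
  have d2 : |C| * |p2 g| ≤ 2 * M := by
    rw [← abs_mul, c2]; exact bd_aux (hM _) (hM _) (Real.abs_cos_le_one _) (Real.abs_cos_le_one _)
  have d3 : |C| * (8 * M / (k0 * ε) * (s / 2)) ≤ 4 * M := by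
    calc |C| * (8 * M / (k0 * ε) * (s / 2)) ≤ |C| * (8 * M / (k0 * ε) * ‖g‖) := by gcongr
      _ ≤ |C| * (|p1 g| + |p2 g|) := by gcongr
      _ ≤ 4 * M := by linarith
  have d4 : |C| * s ≤ k0 * ε := by
    have : |C| * (8 * M / (k0 * ε) * (s / 2)) = (|C| * s) * (4 * M) / (k0 * ε) := by
      field_simp; ring
    rw [this, div_le_iff₀ (by positivity)] at d3
    have h4 : 0 < 4 * M := by positivity
    exact le_of_mul_le_mul_right (by linarith) h4
  -- |C| k0 ≤ |C| s δ ≤ k0 ε δ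
  have : |C| * k0 ≤ (ε * δ) * k0 := by
    calc |C| * k0 ≤ |C| * (s * δ) := by gcongr
      _ = (|C| * s) * δ := by ring
      _ ≤ (k0 * ε) * δ := by gcongr
      _ = _ := by ring
  exact le_of_mul_le_mul_right this hk00

lemma abs_sin_comm (x y : ℝ) : |Real.sin (x - y)| = |Real.sin (y - x)| := by
  rw [← abs_neg, ← Real.sin_neg, neg_sub]

set_option maxHeartbeats 1000000 in
theorem flat_par {θ : ℝ → ℝ} (hcr : ∀ A B, A ≤ B → (∀ a ∈ Icc A B, Real.sin a ≠ 0) → ∀ ε > 0, ∃ δ0 > 0, ∀ δ, 0 < δ → δ < δ0 →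
      ∀ a ∈ Icc A B, |Real.sin (θ a - θ (a + Real.pi - δ))| ≤ ε * δ) :
    ∀ A B, A ≤ B → (∀ a ∈ Icc A B, Real.sin a ≠ 0) → Real.sin (θ A - θ B) = 0 := by
  intro A B hAB hs
  suffices Hs : ∀ ε > 0, |Real.sin (θ A - θ B)| ≤ ε by
    have : |Real.sin (θ A - θ B)| ≤ 0 := le_of_forall_pos_le_add (by simpa using Hs)
    exact abs_nonpos_iff.1 this
  intro ε hε
  have hD : 0 < B - A + 1 := by linarith
  obtain ⟨δ0, hδ0, hcr'⟩ := hcr A B hAB hs (ε / (3 * (B - A + 1))) (by positivity)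
  set ε' := ε / (3 * (B - A + 1)) with hε'
  have hε'0 : 0 < ε' := by positivity
  rcases hAB.eq_or_lt with h0 | hlt
  · subst h0; simp [hε.le]
  obtain ⟨n, hn⟩ := exists_nat_gt (2 * (B - A) / δ0)
  have hn0 : (0:ℝ) < n := lt_of_le_of_lt (by have : 0 < B - A := by linarith
                                             positivity) hn
  set δ := (B - A) / n with hδ
  have hδpos : 0 < δ := by have : 0 < B - A := by linarith
                           positivity
  have hδn : δ * n = B - A := by rw [hδ]; field_simp
  have hδ2 : 2 * δ < δ0 := by
    rw [div_lt_iff₀ hδ0] at hn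
    by_contra hcon
    push Not at hcon
    nlinarith
  have step : ∀ i : ℕ, i ≤ n → |Real.sin (θ A - θ (A + i * δ))| ≤ i * (3 * ε' * δ) := by
    intro i
    induction i with
    | zero => intro _; simp
    | succ i ih =>
      intro hi
      have ih' := ih (by omega)
      have hi' : ((i:ℝ) + 1) ≤ n := by exact_mod_cast hi
      have hi0 : (0:ℝ) ≤ i := Nat.cast_nonneg i
      have m1 : A + i * δ ∈ Icc A B := ⟨by nlinarith, by nlinarith⟩
      have m2 : A + (i+1) * δ ∈ Icc A B := ⟨by nlinarith, by nlinarith⟩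
      have u1 := hcr' δ hδpos (by linarith) _ m1
      have u2 := hcr' (2 * δ) (by linarith) hδ2 _ m2
      rw [show A + (i+1) * δ + Real.pi - 2 * δ = A + i * δ + Real.pi - δ by ring] at u2
      have t1 := abs_sin_sub_le (θ (A + i * δ)) (θ (A + i * δ + Real.pi - δ)) (θ (A + (i+1) * δ))
      have t2 := abs_sin_sub_le (θ A) (θ (A + i * δ)) (θ (A + (i+1) * δ))
      rw [abs_sin_comm] at u2
      push_cast
      nlinarith
  have fin := step n le_rfl
  rw [show A + n * δ = B by linarith] at fin
  calc _ ≤ _ := fin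
    _ = 3 * ε' * (B - A) := by rw [← hδn]; ring
    _ ≤ 3 * ε' * (B - A + 1) := by nlinarith
    _ = ε := by rw [hε']; field_simp

lemma sin_ne_of_near (n : ℤ) {x : ℝ} (hx : |x - (n * Real.pi + Real.pi/2)| < Real.pi/2) : Real.sin x ≠ 0 := by
  have e : x = ((x - (n * Real.pi + Real.pi/2)) + Real.pi/2) + n * Real.pi := by ring
  rw [e, Real.sin_add_int_mul_pi, Real.sin_add_pi_div_two]
  have := Real.cos_pos_of_mem_Ioo (abs_lt.1 hx)
  apply mul_ne_zero _ this.ne'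
  exact zpow_ne_zero _ (by norm_num)

lemma sin_near {x : ℝ} (hx : Real.sin x ≠ 0) : ∃ n : ℤ, |x - (n * Real.pi + Real.pi/2)| < Real.pi/2 := by
  have hp := Real.pi_pos
  refine ⟨⌊x / Real.pi⌋, ?_⟩
  have h1 := Int.floor_le (x / Real.pi)
  have h2 := Int.lt_floor_add_one (x / Real.pi)
  rw [le_div_iff₀ hp] at h1
  rw [div_lt_iff₀ hp] at h2
  have h3 : (⌊x / Real.pi⌋ : ℝ) * Real.pi ≠ x := by
    intro h
    apply hx
    rw [← h]
    exact Real.sin_int_mul_pi _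
  have h4 := lt_of_le_of_ne h1 h3
  rw [abs_lt]
  constructor <;> linarith

lemma sin_sub_trans {x y z : ℝ} (h1 : Real.sin (x - y) = 0) (h2 : Real.sin (y - z) = 0) : Real.sin (x - z) = 0 := by
  have := abs_sin_sub_le x y z
  rw [h1, h2, abs_zero, add_zero] at this
  exact abs_nonpos_iff.1 this

lemma sin_sub_symm {x y : ℝ} (h1 : Real.sin (x - y) = 0) : Real.sin (y - x) = 0 := by
  rw [← abs_eq_zero, abs_sin_comm, h1, abs_zero]

lemma lines_cross (k : ℝ → ℝ) {a b : ℝ} (h : Real.sin (b - a) ≠ 0) : ∃ g : ℝ × ℝ,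
    g.1 * Real.cos a + g.2 * Real.sin a = k a ∧ g.1 * Real.cos b + g.2 * Real.sin b = k b := by
  refine ⟨pt a (k a) ((k b - k a * Real.cos (b - a)) / Real.sin (b - a)), pt_dot _ _ _, ?_⟩
  have := pt_dot_add a (k a) ((k b - k a * Real.cos (b - a)) / Real.sin (b - a)) (b - a)
  rw [show a + (b - a) = b by ring] at this
  rw [this]; field_simp; ring

/-- flat case -/
theorem PD.flat {k : ℝ → ℝ} {p1 p2 ψ : ℝ × ℝ → ℝ} {K : ℝ} (h : PD k p1 p2 ψ K)
    (hfl : ∀ c0 > 0, ∀ Kb : ℝ, ∃ R : ℝ, ∀ g : ℝ × ℝ, R ≤ ‖g‖ → c0 * ‖g‖ ≤ |g.1| →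
      Kb * ‖g‖ ≤ |p1 g| + |p2 g|) :
    ∃ θ s μ : ℝ, ∀ τ, ψ (pt θ τ s) = ψ (pt θ 0 s) + τ * μ := by
  have hK : 0 < K := (h.kpos 0).trans_le (h.kle 0)
  have H2' : ∀ a, ∃ θ μ : ℝ, ∀ g : ℝ × ℝ, g.1 * Real.cos a + g.2 * Real.sin a = k a →
      p1 g * Real.cos θ + p2 g * Real.sin θ = μ := by
    intro a
    obtain ⟨w1, w2, μ, hw, H⟩ := h.H2 a
    obtain ⟨θ, h1, h2⟩ := exists_angle (w1, w2)
    simp only at h1 h2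
    set r := Real.sqrt (w1^2 + w2^2) with hr
    have hr0 : r ≠ 0 := by
      intro h0
      rw [h0, zero_mul] at h1 h2
      rcases hw with hw | hw
      · exact hw h1
      · exact hw h2
    refine ⟨θ, μ / r, fun g hg => ?_⟩
    have := H g hg
    rw [h1, h2] at this
    field_simp
    linarith
  choose θ μ hθ using H2'
  -- bound of μ
  obtain ⟨M, hM0, hM⟩ : ∃ M > 0, ∀ a, |μ a| ≤ M := by
    have hc : ContinuousOn (fun g : ℝ × ℝ => |p1 g| + |p2 g|) (closedBall 0 K) := by
      have := h.c1; have := h.c2; fun_prop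
    obtain ⟨M, hM⟩ := (isCompact_closedBall (0 : ℝ × ℝ) K).bddAbove_image hc
    refine ⟨|M| + 1, by positivity, fun a => ?_⟩
    rw [← hθ a (pt a (k a) 0) (pt_dot _ _ _)]
    have hmem : pt a (k a) 0 ∈ closedBall (0 : ℝ × ℝ) K := by
      rw [mem_closedBall_zero_iff]
      have := pt_norm_le a (k a) 0
      rw [abs_of_pos (h.kpos a), abs_zero, add_zero] at this
      exact this.trans (h.kle a)
    have b := hM ⟨_, hmem, rfl⟩
    simp only at b
    refine (abs_add_le _ _).trans ?_
    rw [abs_mul, abs_mul]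
    have c1 := Real.abs_cos_le_one (θ a)
    have c2 := Real.abs_sin_le_one (θ a)
    have := le_abs_self M
    nlinarith [abs_nonneg (p1 (pt a (k a) 0)), abs_nonneg (p2 (pt a (k a) 0))]
  have hcr := h.flat_cr hfl hθ hM0 hM
  have hpar := flat_par hcr
  have hlink : ∀ n : ℤ, Real.sin (θ (n * Real.pi + Real.pi/2) - θ ((n + 1) * Real.pi + Real.pi/2)) = 0 := by
    intro n
    have hp := Real.pi_gt_three
    set a := n * Real.pi + Real.pi/2 with ha
    have hb : (n + 1) * Real.pi + Real.pi/2 = a + Real.pi := by rw [ha]; ring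
    rw [hb]
    suffices Hs : ∀ ε > 0, |Real.sin (θ a - θ (a + Real.pi))| ≤ ε by
      have : |Real.sin (θ a - θ (a + Real.pi))| ≤ 0 := le_of_forall_pos_le_add (by simpa using Hs)
      exact abs_nonpos_iff.1 this
    intro ε hε
    have hs : ∀ x ∈ Icc a a, Real.sin x ≠ 0 := by
      intro x hx
      apply sin_ne_of_near n
      rw [Icc_self, mem_singleton_iff] at hx
      rw [hx, ← ha, sub_self, abs_zero]; linarith
    obtain ⟨δ0, hδ0, H⟩ := hcr a a le_rfl hs ε hε
    set δ := min 1 (δ0/2) with hδ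
    have d0 : 0 < δ := by positivity
    have d1 : δ ≤ 1 := min_le_left _ _
    have d2 : δ < δ0 := (min_le_right _ _).trans_lt (by linarith)
    have u1 := H δ d0 d2 a ⟨le_rfl, le_rfl⟩
    have u2 := hpar (a + Real.pi - δ) (a + Real.pi) (by linarith) (by
      intro x hx
      apply sin_ne_of_near (n + 1)
      push_cast
      rw [hb, abs_lt]
      constructor <;> linarith [hx.1, hx.2])
    have := abs_sin_sub_le (θ a) (θ (a + Real.pi - δ)) (θ (a + Real.pi))
    rw [u2, abs_zero] at this
    nlinarith
  have hall : ∀ n : ℤ, Real.sin (θ (n * Real.pi + Real.pi/2) - θ (Real.pi/2)) = 0 := by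
    intro n
    induction n using Int.induction_on with
    | zero => simp
    | succ n ih =>
      have := hlink n
      push_cast at this ih ⊢
      exact sin_sub_trans (sin_sub_symm this) ih
    | pred n ih =>
      have := hlink (-n - 1)
      push_cast at this ih ⊢
      rw [show -(n:ℝ) - 1 + 1 = -n by ring] at this
      exact sin_sub_trans this ih
  have hgood : ∀ a, Real.sin a ≠ 0 → Real.sin (θ a - θ (Real.pi/2)) = 0 := by
    intro a ha
    obtain ⟨n, hn⟩ := sin_near ha
    refine sin_sub_trans ?_ (hall n)
    have hn' := abs_lt.1 hn
    rcases le_total a (n * Real.pi + Real.pi/2) with hle | hle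
    · apply hpar _ _ hle
      intro x hx
      apply sin_ne_of_near n
      rw [abs_lt]
      constructor <;> linarith [hx.1, hx.2, Real.pi_pos]
    · apply sin_sub_symm
      apply hpar _ _ hle
      intro x hx
      apply sin_ne_of_near n
      rw [abs_lt]
      constructor <;> linarith [hx.1, hx.2, Real.pi_pos]
  set t := θ (Real.pi/2) with ht
  have hm : ∀ a, ∃ m, Real.sin a ≠ 0 → ∀ g : ℝ × ℝ, g.1 * Real.cos a + g.2 * Real.sin a = k a →
      p1 g * Real.cos t + p2 g * Real.sin t = m := by
    intro a
    refine ⟨Real.cos (θ a - t) * μ a, fun ha g hg => ?_⟩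
    have hz := hgood a ha
    have e1 : Real.cos t = Real.cos (θ a - t) * Real.cos (θ a) := by
      have := Real.cos_sub (θ a) (θ a - t)
      rw [sub_sub_cancel, hz] at this
      rw [this]; ring
    have e2 : Real.sin t = Real.cos (θ a - t) * Real.sin (θ a) := by
      have := Real.sin_sub (θ a) (θ a - t)
      rw [sub_sub_cancel, hz] at this
      rw [this]; ring
    rw [← hθ a g hg]
    conv_lhs => rw [e1, e2]
    ring
  choose m hm using hm
  have hcross : ∀ a b, Real.sin a ≠ 0 → Real.sin b ≠ 0 → Real.sin (b - a) ≠ 0 → m a = m b := by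
    intro a b ha hb hab
    obtain ⟨g, h1, h2⟩ := lines_cross k hab
    rw [← hm a ha g h1, ← hm b hb g h2]
  have s2 : Real.sin (Real.pi/2) ≠ 0 := by rw [Real.sin_pi_div_two]; norm_num
  have s4 : Real.sin (Real.pi/4) ≠ 0 := by rw [Real.sin_pi_div_four]; positivity
  have hmeq : ∀ a, Real.sin a ≠ 0 → m a = m (Real.pi/2) := by
    intro a ha
    by_cases hc : Real.sin (Real.pi/2 - a) = 0
    · have : Real.sin (Real.pi/4 - a) ≠ 0 := by
        intro h0
        have := sin_sub_trans hc (sin_sub_symm h0)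
        rw [show Real.pi/2 - Real.pi/4 = Real.pi/4 by ring] at this
        exact s4 this
      rw [hcross a _ ha s4 this, hcross _ _ s4 s2]
      rw [show Real.pi/2 - Real.pi/4 = Real.pi/4 by ring]; exact s4
    · exact hcross a _ ha s2 hc
  have hX : ∀ g ∈ XX k, p1 g * Real.cos t + p2 g * Real.sin t = m (Real.pi/2) := by
    rintro g ⟨a, ha⟩
    obtain ⟨a1, a2, -, -, -, -, r1, r2, hne⟩ := XX_roots h.kcont h.kpos ha
    by_cases h1 : Real.sin a1 = 0
    · have h2 : Real.sin a2 ≠ 0 := by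
        intro h2
        apply hne
        rw [Real.sin_sub, h1, h2]; ring
      rw [← hmeq a2 h2]; exact hm a2 h2 g r2
    · rw [← hmeq a1 h1]; exact hm a1 h1 g r1
  refine ⟨t, 2 * (K + 1), m (Real.pi/2), fun τ => ?_⟩
  have hd : ∀ τ, HasDerivAt (fun τ => ψ (pt t τ (2 * (K + 1))) - τ * m (Real.pi/2)) 0 τ := by
    intro τ
    have h1 : HasDerivAt (fun τ => pt t τ (2 * (K + 1))) (Real.cos t, Real.sin t) τ := by
      unfold pt
      apply HasDerivAt.prodMk
      · simpa using ((hasDerivAt_id τ).mul_const (Real.cos t)).sub_const (2 * (K + 1) * Real.sin t)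
      · simpa using ((hasDerivAt_id τ).mul_const (Real.sin t)).add_const (2 * (K + 1) * Real.cos t)
    have h2 := ((h.grad (pt t τ (2 * (K + 1)))).comp_hasDerivAt τ h1).sub ((hasDerivAt_id τ).mul_const (m (Real.pi/2)))
    refine HasDerivAt.congr_deriv h2 ?_
    have : pt t τ (2 * (K + 1)) ∈ XX k := by
      apply mem_XX_of_norm h.kle
      have := le_pt_norm t τ (2 * (K + 1))
      rw [abs_of_pos (by linarith)] at this
      linarith
    have := hX _ this
    simp
    linarith
  have hc := is_const_of_deriv_eq_zero (fun τ => (hd τ).differentiableAt) (fun τ => (hd τ).deriv) τ 0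
  simp only [zero_mul, sub_zero] at hc
  linarith

end

section
open scoped RealInnerProductSpace Topology
open Filter

lemma continuous_of_closed_graph {X Y : Type*} [TopologicalSpace X] [TopologicalSpace Y] {L : Set Y}
    (hL : IsCompact L) {R : Set (X × Y)} (hR : IsClosed R) {e : X → Y} (heL : ∀ x, e x ∈ L)
    (heR : ∀ x, (x, e x) ∈ R) (hu : ∀ x y, y ∈ L → (x, y) ∈ R → y = e x) : Continuous e := by
  rw [continuous_iff_ultrafilter]
  intro x U hU
  obtain ⟨y, hy, hUy⟩ := hL.ultrafilter_le_nhds (U.map e) (by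
    rw [le_principal_iff]; exact Filter.mem_map.2 (Filter.univ_mem' (fun a => heL a)))
  have h1 : Tendsto (fun a => (a, e a)) U (𝓝 (x, y)) := by
    rw [nhds_prod_eq]
    exact Tendsto.prodMk hU hUy
  have h2 : (x, y) ∈ R := hR.mem_of_tendsto h1 (Filter.univ_mem' (fun a => heR a))
  rw [hu x y hy h2] at hUy
  exact hUy

/-- contact of the body `L` at `e` with outer normal `n` -/
def Contact (L : Set E3) (e n : E3) : Prop := e ∈ L ∧ n ≠ 0 ∧ ∀ q ∈ L, ⟪n, q⟫ ≤ ⟪n, e⟫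

structure Body (L : Set E3) : Prop where
  comp : IsCompact L
  str : StrictConvex ℝ L
  sym : L = -L
  int : (interior L).Nonempty

lemma not_interior_of_max {L : Set E3} {e n : E3} (hn : n ≠ 0) (h : ∀ q ∈ L, ⟪n, q⟫ ≤ ⟪n, e⟫) :
    e ∉ interior L := by
  intro hi
  obtain ⟨r, hr, hb⟩ := Metric.isOpen_iff.1 isOpen_interior e hi
  have hnn : 0 < ‖n‖ := norm_pos_iff.2 hn
  have hm : e + (r / (2 * ‖n‖)) • n ∈ ball e r := by
    rw [mem_ball, dist_eq_norm, add_sub_cancel_left, norm_smul, Real.norm_of_nonneg (by positivity)]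
    have : r / (2 * ‖n‖) * ‖n‖ = r / 2 := by field_simp
    rw [this]; linarith
  have := h _ (interior_subset (hb hm))
  rw [inner_add_right, inner_smul_right, real_inner_self_eq_norm_sq] at this
  have : 0 < r / (2 * ‖n‖) * ‖n‖ ^ 2 := by positivity
  linarith

lemma Contact.unique {L : Set E3} (hL : StrictConvex ℝ L) {e q n : E3} (h : Contact L e n) (hq : q ∈ L)
    (hqe : ⟪n, e⟫ ≤ ⟪n, q⟫) : q = e := by
  have hqe' : ⟪n, q⟫ = ⟪n, e⟫ := le_antisymm (h.2.2 q hq) hqe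
  refine hL.eq hq h.1 (a := 1/2) (b := 1/2) (by norm_num) (by norm_num) (by norm_num) ?_
  apply not_interior_of_max h.2.1
  intro x hx
  rw [inner_add_right, inner_smul_right, inner_smul_right, hqe']
  linarith [h.2.2 x hx]

lemma Contact.pos {L : Set E3} (hL : StrictConvex ℝ L) {e q n : E3} (h : Contact L e n) (hq : q ∈ L)
    (hne : q ≠ e) : ⟪n, q⟫ < ⟪n, e⟫ := by
  by_contra hcon
  push Not at hcon
  exact hne (h.unique hL hq hcon)

structure Frame where
  (c ν b1 b2 d1 d2 : E3)

namespace Frame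
variable (F : Frame)
def x1 (q : E3) : ℝ := ⟪F.d1, q - F.c⟫
def x2 (q : E3) : ℝ := ⟪F.d2, q - F.c⟫
def z (q : E3) : ℝ := ⟪F.ν, F.c - q⟫

structure Ok (L : Set E3) : Prop where
  contact : Contact L F.c F.ν
  nu1 : ⟪F.ν, F.ν⟫ = 1
  d11 : ⟪F.d1, F.b1⟫ = 1
  d12 : ⟪F.d1, F.b2⟫ = 0
  d21 : ⟪F.d2, F.b1⟫ = 0
  d22 : ⟪F.d2, F.b2⟫ = 1
  nb1 : ⟪F.ν, F.b1⟫ = 0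
  nb2 : ⟪F.ν, F.b2⟫ = 0
  d1n : ⟪F.d1, F.ν⟫ = 0
  d2n : ⟪F.d2, F.ν⟫ = 0
  exp : ∀ v, v = ⟪F.d1, v⟫ • F.b1 + ⟪F.d2, v⟫ • F.b2 + ⟪F.ν, v⟫ • F.ν

variable {F} {L : Set E3}

lemma Ok.z_pos (h : F.Ok L) (hL : StrictConvex ℝ L) {q : E3} (hq : q ∈ L) (hne : q ≠ F.c) : 0 < F.z q := by
  have := h.contact.pos hL hq hne
  rw [z, inner_sub_right]; linarith

lemma Ok.z_nonneg (h : F.Ok L) {q : E3} (hq : q ∈ L) : 0 ≤ F.z q := by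
  have := h.contact.2.2 q hq
  rw [z, inner_sub_right]; linarith

lemma z_c : F.z F.c = 0 := by simp [z]
lemma x1_c : F.x1 F.c = 0 := by simp [x1]
lemma x2_c : F.x2 F.c = 0 := by simp [x2]

lemma cont_x1 : Continuous F.x1 := by unfold x1; fun_prop
lemma cont_x2 : Continuous F.x2 := by unfold x2; fun_prop
lemma cont_z : Continuous F.z := by unfold z; fun_prop

/-- defining relation of the contact point -/
def Rel (F : Frame) (L : Set E3) (g : ℝ × ℝ) (e : E3) : Prop :=
  ∀ q ∈ L, (g.1 * F.x1 q + g.2 * F.x2 q - 1) * F.z e ≤ (g.1 * F.x1 e + g.2 * F.x2 e - 1) * F.z q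

lemma exists_ne (hb : Body L) (c : E3) : ∃ q ∈ L, q ≠ c := by
  by_contra hcon
  push Not at hcon
  obtain ⟨x, hx⟩ := hb.int
  obtain ⟨r, hr, hbb⟩ := Metric.isOpen_iff.1 isOpen_interior x hx
  obtain ⟨v, hv⟩ := _root_.exists_ne (0 : E3)
  have hvv : 0 < ‖v‖ := norm_pos_iff.2 hv
  have hm : x + (r / (2 * ‖v‖)) • v ∈ ball x r := by
    rw [mem_ball, dist_eq_norm, add_sub_cancel_left, norm_smul, Real.norm_of_nonneg (by positivity)]
    have : r / (2 * ‖v‖) * ‖v‖ = r / 2 := by field_simp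
    rw [this]; linarith
  have e1 := hcon _ (interior_subset (hbb hm))
  rw [← hcon _ (interior_subset hx), add_eq_left] at e1
  have : r / (2 * ‖v‖) ≠ 0 := by positivity
  exact (smul_ne_zero this hv) e1

lemma Ok.rel_ne (h : F.Ok L) (hb : Body L) {g : ℝ × ℝ} {e : E3} (hr : F.Rel L g e) : e ≠ F.c := by
  rintro rfl
  obtain ⟨q, hq, hne⟩ := exists_ne hb F.c
  have := hr q hq
  have hz := h.z_pos hb.str hq hne
  rw [z_c, x1_c, x2_c] at this
  linarith

lemma Ok.exists_rel (h : F.Ok L) (hb : Body L) (g : ℝ × ℝ) : ∃ e ∈ L, F.Rel L g e := by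
  obtain ⟨q0, hq0, hne⟩ := exists_ne hb F.c
  have hz0 := h.z_pos hb.str hq0 hne
  set N : E3 → ℝ := fun q => g.1 * F.x1 q + g.2 * F.x2 q - 1 with hN
  have hNc : Continuous N := by
    have := F.cont_x1; have := F.cont_x2; fun_prop
  have hzc := F.cont_z
  set t0 := N q0 / F.z q0
  have hcl : IsCompact (L ∩ {q | t0 * F.z q ≤ N q}) :=
    hb.comp.inter_right (isClosed_le (by fun_prop) hNc)
  have hzne : ∀ q ∈ L ∩ {q | t0 * F.z q ≤ N q}, 0 < F.z q := by
    rintro q ⟨hq, hq2⟩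
    apply h.z_pos hb.str hq
    rintro rfl
    simp only [mem_ofPred_eq, hN, z_c, x1_c, x2_c] at hq2
    linarith
  obtain ⟨e, he, hmax⟩ := hcl.exists_isMaxOn ⟨q0, hq0, by
      show t0 * F.z q0 ≤ N q0
      rw [div_mul_cancel₀ _ hz0.ne']⟩
    (f := fun q => N q / F.z q) (hNc.continuousOn.div hzc.continuousOn (fun q hq => (hzne q hq).ne'))
  refine ⟨e, he.1, fun q hq => ?_⟩
  have hze := hzne e he
  change N q * F.z e ≤ N e * F.z q
  by_cases hqc : q = F.c
  · subst hqc
    simp only [hN, z_c, x1_c, x2_c]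
    simp only [hN] at *
    linarith
  have hzq := h.z_pos hb.str hq hqc
  by_cases hin : t0 * F.z q ≤ N q
  · have := hmax ⟨hq, hin⟩
    simp only [mem_ofPred_eq] at this
    rwa [div_le_div_iff₀ hzq hze] at this
  · push Not at hin
    have h2 : t0 * F.z e ≤ N e := he.2
    nlinarith

/-- the normal vector -/
def nor (F : Frame) (g : ℝ × ℝ) (t : ℝ) : E3 := g.1 • F.d1 + g.2 • F.d2 + t • F.ν

lemma nor_inner (g : ℝ × ℝ) (t : ℝ) (q : E3) :
    ⟪F.nor g t, q - F.c⟫ = g.1 * F.x1 q + g.2 * F.x2 q - t * F.z q := by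
  simp only [nor, x1, x2, z, inner_add_left, real_inner_smul_left, inner_sub_right]
  ring

lemma Ok.rel_contact (h : F.Ok L) (hb : Body L) {g : ℝ × ℝ} {e : E3} (he : e ∈ L) (hr : F.Rel L g e) :
    Contact L e (F.nor g ((g.1 * F.x1 e + g.2 * F.x2 e - 1) / F.z e)) ∧
    ⟪F.nor g ((g.1 * F.x1 e + g.2 * F.x2 e - 1) / F.z e), e - F.c⟫ = 1 := by
  have hz := h.z_pos hb.str he (h.rel_ne hb hr)
  have h1 : ⟪F.nor g ((g.1 * F.x1 e + g.2 * F.x2 e - 1) / F.z e), e - F.c⟫ = 1 := by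
    rw [nor_inner]; field_simp; ring
  refine ⟨⟨he, ?_, fun q hq => ?_⟩, h1⟩
  · intro h0
    rw [h0, inner_zero_left] at h1
    norm_num at h1
  · have h2 : ⟪F.nor g ((g.1 * F.x1 e + g.2 * F.x2 e - 1) / F.z e), q - F.c⟫ ≤ 1 := by
      rw [nor_inner]
      have := hr q hq
      rw [div_mul_eq_mul_div, sub_le_iff_le_add, ← sub_le_iff_le_add', le_div_iff₀ hz]
      linarith
    rw [inner_sub_right] at h1 h2
    linarith

lemma Ok.rel_unique (h : F.Ok L) (hb : Body L) {g : ℝ × ℝ} {e e' : E3} (he : e ∈ L) (hr : F.Rel L g e)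
    (he' : e' ∈ L) (hr' : F.Rel L g e') : e' = e := by
  obtain ⟨hc, h1⟩ := h.rel_contact hb he hr
  apply hc.unique hb.str he'
  have hz := h.z_pos hb.str he (h.rel_ne hb hr)
  suffices 1 ≤ ⟪F.nor g ((g.1 * F.x1 e + g.2 * F.x2 e - 1) / F.z e), e' - F.c⟫ by
    rw [inner_sub_right] at h1 this
    linarith
  rw [nor_inner, div_mul_eq_mul_div, le_sub_iff_add_le, ← le_sub_iff_add_le', div_le_iff₀ hz]
  have := hr' e he
  linarith

end Frame

/-- contact map -/
structure CM (F : Frame) (L : Set E3) (e : ℝ × ℝ → E3) : Prop where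
  mem : ∀ g, e g ∈ L
  rel : ∀ g, F.Rel L g (e g)
  cont : Continuous e

lemma Frame.Ok.exists_CM {F : Frame} {L : Set E3} (h : F.Ok L) (hb : Body L) : ∃ e, CM F L e := by
  choose e he hr using h.exists_rel hb
  refine ⟨e, he, hr, ?_⟩
  refine continuous_of_closed_graph hb.comp (R := {x : (ℝ × ℝ) × E3 | F.Rel L x.1 x.2}) ?_ he hr ?_
  · have : {x : (ℝ × ℝ) × E3 | F.Rel L x.1 x.2} = ⋂ q ∈ L, {x : (ℝ × ℝ) × E3 |
        (x.1.1 * F.x1 q + x.1.2 * F.x2 q - 1) * F.z x.2 ≤ (x.1.1 * F.x1 x.2 + x.1.2 * F.x2 x.2 - 1) * F.z q} := by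
      ext x; simp [Frame.Rel]
    rw [this]
    refine isClosed_biInter fun q _ => isClosed_le ?_ ?_
    · have := F.cont_z; fun_prop
    · have := F.cont_x1; have := F.cont_x2; fun_prop
  · intro g y hy hr'
    exact h.rel_unique hb (he g) (hr g) hy hr'

namespace CM
def P1 (F : Frame) (e : ℝ × ℝ → E3) (g : ℝ × ℝ) : ℝ := F.x1 (e g) / F.z (e g)
def P2 (F : Frame) (e : ℝ × ℝ → E3) (g : ℝ × ℝ) : ℝ := F.x2 (e g) / F.z (e g)
def Ψ (F : Frame) (e : ℝ × ℝ → E3) (g : ℝ × ℝ) : ℝ := (g.1 * F.x1 (e g) + g.2 * F.x2 (e g) - 1) / F.z (e g)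

variable {F : Frame} {L : Set E3} {e : ℝ × ℝ → E3}

lemma zpos (m : CM F L e) (h : F.Ok L) (hb : Body L) (g : ℝ × ℝ) : 0 < F.z (e g) :=
  h.z_pos hb.str (m.mem g) (h.rel_ne hb (m.rel g))

lemma contact (m : CM F L e) (h : F.Ok L) (hb : Body L) (g : ℝ × ℝ) :
    Contact L (e g) (F.nor g (Ψ F e g)) := (h.rel_contact hb (m.mem g) (m.rel g)).1

lemma inner_one (m : CM F L e) (h : F.Ok L) (hb : Body L) (g : ℝ × ℝ) :
    ⟪F.nor g (Ψ F e g), e g - F.c⟫ = 1 := (h.rel_contact hb (m.mem g) (m.rel g)).2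

lemma ineq (m : CM F L e) (h : F.Ok L) (hb : Body L) (g : ℝ × ℝ) {q : E3} (hq : q ∈ L) :
    g.1 * F.x1 q + g.2 * F.x2 q - Ψ F e g * F.z q ≤ 1 := by
  rw [← Frame.nor_inner, ← m.inner_one h hb g, inner_sub_right, inner_sub_right]
  linarith [(m.contact h hb g).2.2 q hq]

lemma eq_of_contact (m : CM F L e) (h : F.Ok L) (hb : Body L) {q n : E3} (hc : Contact L q n)
    (h1 : ⟪n, q - F.c⟫ = 1) : q = e (⟪n, F.b1⟫, ⟪n, F.b2⟫) ∧
      n = F.nor (⟪n, F.b1⟫, ⟪n, F.b2⟫) (Ψ F e (⟪n, F.b1⟫, ⟪n, F.b2⟫)) := by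
  set g : ℝ × ℝ := (⟪n, F.b1⟫, ⟪n, F.b2⟫) with hg
  have hn : n = F.nor g ⟪n, F.ν⟫ := by
    apply ext_inner_right ℝ
    intro v
    conv_lhs => rw [h.exp v]
    simp only [Frame.nor, inner_add_left, inner_add_right, real_inner_smul_left, real_inner_smul_right, hg]
    ring
  have hne : q ≠ F.c := by
    rintro rfl
    simp at h1
  have hz := h.z_pos hb.str hc.1 hne
  have e1 : ∀ v, ⟪n, v - F.c⟫ = g.1 * F.x1 v + g.2 * F.x2 v - ⟪n, F.ν⟫ * F.z v := by
    intro v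
    conv_lhs => rw [hn]
    rw [Frame.nor_inner]
  have e2 := e1 q
  have hr : F.Rel L g q := by
    intro v hv
    have h2 := hc.2.2 v hv
    have h3 : ⟪n, v - F.c⟫ ≤ 1 := by rw [← h1, inner_sub_right, inner_sub_right]; linarith
    rw [e1] at h3
    have hzv := h.z_nonneg hv
    nlinarith
  have hq := h.rel_unique hb (m.mem g) (m.rel g) hc.1 hr
  refine ⟨hq, ?_⟩
  have : Ψ F e g = ⟪n, F.ν⟫ := by
    rw [Ψ, ← hq, div_eq_iff hz.ne']; linarith
  rw [this]; exact hn

lemma cP1 (m : CM F L e) (h : F.Ok L) (hb : Body L) : Continuous (P1 F e) :=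
  (F.cont_x1.comp m.cont).div (F.cont_z.comp m.cont) (fun g => (m.zpos h hb g).ne')
lemma cP2 (m : CM F L e) (h : F.Ok L) (hb : Body L) : Continuous (P2 F e) :=
  (F.cont_x2.comp m.cont).div (F.cont_z.comp m.cont) (fun g => (m.zpos h hb g).ne')

lemma convex (m : CM F L e) (h : F.Ok L) (hb : Body L) (g g' : ℝ × ℝ) :
    Ψ F e g + P1 F e g * (g'.1 - g.1) + P2 F e g * (g'.2 - g.2) ≤ Ψ F e g' := by
  have h1 := m.ineq h hb g' (m.mem g)
  have hz := m.zpos h hb g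
  have : Ψ F e g + P1 F e g * (g'.1 - g.1) + P2 F e g * (g'.2 - g.2) =
     (g'.1 * F.x1 (e g) + g'.2 * F.x2 (e g) - 1) / F.z (e g) := by
    rw [Ψ, P1, P2]; field_simp; ring
  rw [this, div_le_iff₀ hz]
  linarith

lemma grad (m : CM F L e) (h : F.Ok L) (hb : Body L) (g : ℝ × ℝ) : HasFDerivAt (Ψ F e)
    (P1 F e g • ContinuousLinearMap.fst ℝ ℝ ℝ + P2 F e g • ContinuousLinearMap.snd ℝ ℝ ℝ) g := by
  rw [hasFDerivAt_iff_isLittleO_nhds_zero, Asymptotics.isLittleO_iff]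
  intro ε hε
  have c1 := Metric.continuous_iff.1 (m.cP1 h hb) g (ε/2) (by positivity)
  have c2 := Metric.continuous_iff.1 (m.cP2 h hb) g (ε/2) (by positivity)
  obtain ⟨r1, hr1, H1⟩ := c1
  obtain ⟨r2, hr2, H2⟩ := c2
  filter_upwards [Metric.ball_mem_nhds (0 : ℝ × ℝ) (lt_min hr1 hr2)] with v hv
  rw [mem_ball_zero_iff] at hv
  have k1 := H1 (g + v) (by rw [dist_eq_norm, add_sub_cancel_left]; exact hv.trans_le (min_le_left _ _))
  have k2 := H2 (g + v) (by rw [dist_eq_norm, add_sub_cancel_left]; exact hv.trans_le (min_le_right _ _))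
  rw [Real.dist_eq] at k1 k2
  have a1 := m.convex h hb g (g + v)
  have a2 := m.convex h hb (g + v) g
  simp only [Prod.fst_add, Prod.snd_add, add_sub_cancel_left] at a1 a2
  have v1 : |v.1| ≤ ‖v‖ := norm_fst_le v
  have v2 : |v.2| ≤ ‖v‖ := norm_snd_le v
  simp only [ContinuousLinearMap.add_apply, ContinuousLinearMap.smul_apply, ContinuousLinearMap.coe_fst',
    ContinuousLinearMap.coe_snd', smul_eq_mul]
  rw [Real.norm_eq_abs, abs_of_nonneg (by linarith)]
  have b1 : (P1 F e (g + v) - P1 F e g) * v.1 ≤ ε/2 * ‖v‖ := by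
    calc _ ≤ |(P1 F e (g + v) - P1 F e g) * v.1| := le_abs_self _
      _ = |P1 F e (g + v) - P1 F e g| * |v.1| := abs_mul _ _
      _ ≤ _ := mul_le_mul k1.le v1 (abs_nonneg _) (by positivity)
  have b2 : (P2 F e (g + v) - P2 F e g) * v.2 ≤ ε/2 * ‖v‖ := by
    calc _ ≤ |(P2 F e (g + v) - P2 F e g) * v.2| := le_abs_self _
      _ = |P2 F e (g + v) - P2 F e g| * |v.2| := abs_mul _ _
      _ ≤ _ := mul_le_mul k2.le v2 (abs_nonneg _) (by positivity)
  linarith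

end CM

end

section
open scoped RealInnerProductSpace Topology
open Filter

lemma Contact.graze {L : Set E3} {e n x : E3} (h : Contact L e n) (hx : ⟪n, x⟫ = ⟪n, e⟫) : e ∈ graze L x := by
  have h1 : e ∈ coneGen L x := ⟨e, h.1, 1, zero_le_one, by simp⟩
  refine ⟨⟨subset_closure h1, ?_⟩, subset_closure h.1, not_interior_of_max h.2.1 h.2.2⟩
  apply not_interior_of_max h.2.1
  rintro p ⟨y, hy, l, hl, rfl⟩
  rw [inner_add_right, inner_smul_right, inner_sub_right, hx]
  nlinarith [h.2.2 y hy]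

structure Setup (K L : Set E3) (Δ : E3 → AffineSubspace ℝ E3) : Prop where
  body : Body L
  kcomp : IsCompact K
  kconv : Convex ℝ K
  sub : L ⊆ interior K
  hΔ : ∀ z ∈ frontier K, IsPlane (Δ z) ∧ graze L z ⊆ (Δ z : Set E3)

/-- unit contact gap -/
lemma Body.gap {L : Set E3} (hb : Body L) {ε : ℝ} (hε : 0 < ε) : ∃ m0 > 0, ∀ c ∈ L, ∀ q n, Contact L q n →
    ε ≤ ‖q - c‖ → m0 * ‖n‖ ≤ ⟪n, q - c⟫ := by
  set S : Set (E3 × E3 × E3) := (L ×ˢ L ×ˢ sphere 0 1) ∩ ({x | ε ≤ ‖x.2.1 - x.1‖} ∩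
    ⋂ v ∈ L, {x | ⟪x.2.2, v⟫ ≤ ⟪x.2.2, x.2.1⟫}) with hS
  have hSc : IsCompact S := by
    apply (hb.comp.prod (hb.comp.prod (isCompact_sphere 0 1))).inter_right
    apply (isClosed_le (by fun_prop) (by fun_prop)).inter
    exact isClosed_biInter fun v _ => isClosed_le (by fun_prop) (by fun_prop)
  have hSm : ∀ c ∈ L, ∀ q n, Contact L q n → ε ≤ ‖q - c‖ → (c, q, ‖n‖⁻¹ • n) ∈ S := by
    intro c hc q n h hq
    have hn : 0 < ‖n‖ := norm_pos_iff.2 h.2.1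
    refine ⟨⟨hc, h.1, ?_⟩, hq, ?_⟩
    · rw [mem_sphere_zero_iff_norm, norm_smul, norm_inv, norm_norm, inv_mul_cancel₀ hn.ne']
    · rw [mem_iInter₂]
      intro v hv
      show ⟪‖n‖⁻¹ • n, v⟫ ≤ ⟪‖n‖⁻¹ • n, q⟫
      rw [real_inner_smul_left, real_inner_smul_left]
      exact mul_le_mul_of_nonneg_left (h.2.2 v hv) (by positivity)
  rcases S.eq_empty_or_nonempty with h0 | hne
  · refine ⟨1, one_pos, fun c hc q n h hq => ?_⟩
    have := hSm c hc q n h hq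
    rw [h0] at this
    exact this.elim
  obtain ⟨x, hx, hmin⟩ := hSc.exists_isMinOn hne (f := fun x : E3 × E3 × E3 => ⟪x.2.2, x.2.1 - x.1⟫)
    (by fun_prop)
  refine ⟨⟪x.2.2, x.2.1 - x.1⟫, ?_, fun c hc q n h hq => ?_⟩
  · obtain ⟨⟨h1, h2, h3⟩, h4, h5⟩ := hx
    rw [mem_iInter₂] at h5
    have hn : x.2.2 ≠ 0 := by
      intro h; rw [h] at h3; simp at h3
    have hc : Contact L x.2.1 x.2.2 := ⟨h2, hn, h5⟩
    have := hc.pos hb.str h1 (by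
      intro h; change ε ≤ ‖x.2.1 - x.1‖ at h4
      rw [h, sub_self, norm_zero] at h4; linarith)
    rw [inner_sub_right]; linarith
  · have := hmin (hSm c hc q n h hq)
    change _ ≤ ⟪‖n‖⁻¹ • n, q - c⟫ at this
    rw [real_inner_smul_left, inv_mul_eq_div, le_div_iff₀ (norm_pos_iff.2 h.2.1)] at this
    exact this

namespace CM
variable {F : Frame} {L : Set E3} {e : ℝ × ℝ → E3}

lemma nor_b1 (h : F.Ok L) (g : ℝ × ℝ) (t : ℝ) : ⟪F.nor g t, F.b1⟫ = g.1 := by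
  simp only [Frame.nor, inner_add_left, real_inner_smul_left, h.d11, h.d21, h.nb1]; ring
lemma nor_b2 (h : F.Ok L) (g : ℝ × ℝ) (t : ℝ) : ⟪F.nor g t, F.b2⟫ = g.2 := by
  simp only [Frame.nor, inner_add_left, real_inner_smul_left, h.d12, h.d22, h.nb2]; ring
lemma nor_nu (h : F.Ok L) (g : ℝ × ℝ) (t : ℝ) : ⟪F.nor g t, F.ν⟫ = t := by
  simp only [Frame.nor, inner_add_left, real_inner_smul_left, h.d1n, h.d2n, h.nu1]; ring

lemma nor_norm (h : F.Ok L) (g : ℝ × ℝ) (t : ℝ) : ‖g‖ ≤ ‖F.nor g t‖ * (‖F.b1‖ + ‖F.b2‖) := by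
  rw [Prod.norm_def]
  have h1 := abs_real_inner_le_norm (F.nor g t) F.b1
  have h2 := abs_real_inner_le_norm (F.nor g t) F.b2
  rw [nor_b1 h] at h1
  rw [nor_b2 h] at h2
  have := norm_nonneg (F.nor g t)
  have := norm_nonneg F.b1
  have := norm_nonneg F.b2
  apply max_le
  · rw [Real.norm_eq_abs]; nlinarith
  · rw [Real.norm_eq_abs]; nlinarith

lemma decay (m : CM F L e) (h : F.Ok L) (hb : Body L) {ε : ℝ} (hε : 0 < ε) :
    ∃ R > 0, ∀ g, R ≤ ‖g‖ → ‖e g - F.c‖ < ε := by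
  obtain ⟨m0, hm0, H⟩ := hb.gap hε
  refine ⟨(‖F.b1‖ + ‖F.b2‖) / m0 + 1, by positivity, fun g hg => ?_⟩
  by_contra hcon
  push Not at hcon
  have h1 := H F.c h.contact.1 _ _ (m.contact h hb g) hcon
  rw [m.inner_one h hb g] at h1
  have h2 := nor_norm h g (Ψ F e g)
  have h3 : ‖F.nor g (Ψ F e g)‖ ≤ 1 / m0 := by rw [le_div_iff₀ hm0]; linarith
  have h4 : ‖F.nor g (Ψ F e g)‖ * (‖F.b1‖ + ‖F.b2‖) ≤ 1 / m0 * (‖F.b1‖ + ‖F.b2‖) := by gcongr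
  have h5 : 1 / m0 * (‖F.b1‖ + ‖F.b2‖) = (‖F.b1‖ + ‖F.b2‖) / m0 := by ring
  linarith

end CM

namespace Frame
variable {F : Frame} {L : Set E3}
def u (F : Frame) (a : ℝ) : E3 := Real.cos a • F.b1 + Real.sin a • F.b2
def Kc (F : Frame) (K : Set E3) : Set E3 := {v | F.c + v ∈ K}
def k (F : Frame) (K : Set E3) (a : ℝ) : ℝ := gauge (F.Kc K) (F.u a)

lemma nor_u (h : F.Ok L) (g : ℝ × ℝ) (t a : ℝ) : ⟪F.nor g t, F.u a⟫ = g.1 * Real.cos a + g.2 * Real.sin a := by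
  rw [u, inner_add_right, inner_smul_right, inner_smul_right, CM.nor_b1 h, CM.nor_b2 h]; ring

lemma u_ne (h : F.Ok L) (a : ℝ) : F.u a ≠ 0 := by
  intro h0
  have h1 : ⟪F.d1, F.u a⟫ = Real.cos a := by
    simp only [u, inner_add_right, inner_smul_right, h.d11, h.d12]; ring
  have h2 : ⟪F.d2, F.u a⟫ = Real.sin a := by
    simp only [u, inner_add_right, inner_smul_right, h.d21, h.d22]; ring
  rw [h0, inner_zero_right] at h1 h2
  have := Real.sin_sq_add_cos_sq a
  rw [← h1, ← h2] at this
  norm_num at this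

lemma Kc_eq (K : Set E3) : F.Kc K = (Homeomorph.addLeft F.c) ⁻¹' K := rfl

lemma Kc_convex {K : Set E3} (hK : Convex ℝ K) : Convex ℝ (F.Kc K) := by
  intro x hx y hy a b ha hb hab
  have := hK hx hy ha hb hab
  show F.c + (a • x + b • y) ∈ K
  convert this using 1
  rw [smul_add, smul_add, add_add_add_comm, ← add_smul, hab, one_smul]

lemma Kc_nhds {K : Set E3} (hc : F.c ∈ interior K) : F.Kc K ∈ 𝓝 0 := by
  rw [← mem_interior_iff_mem_nhds, Kc_eq, ← Homeomorph.preimage_interior]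
  simpa using hc

lemma Kc_bdd {K : Set E3} (hK : IsCompact K) : Bornology.IsVonNBounded ℝ (F.Kc K) := by
  have : IsCompact (F.Kc K) := by
    rw [Kc_eq, Homeomorph.isCompact_preimage]; exact hK
  exact this.isVonNBounded ℝ

end Frame

lemma CM.toPD {K L : Set E3} {Δ : E3 → AffineSubspace ℝ E3} (hs : Setup K L Δ) {F : Frame} (h : F.Ok L)
    {e : ℝ × ℝ → E3} (m : CM F L e) : ∃ Km, PD (F.k K) (CM.P1 F e) (CM.P2 F e) (CM.Ψ F e) Km := by
  have hb := hs.body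
  have hc : F.c ∈ interior K := hs.sub h.contact.1
  have hn := F.Kc_nhds hc
  have hkpos : ∀ a, 0 < F.k K a := fun a =>
    (gauge_pos (absorbent_nhds_zero hn) (Frame.Kc_bdd hs.kcomp)).2 (Frame.u_ne h a)
  obtain ⟨r, hr, hball⟩ := Metric.mem_nhds_iff.1 hn
  refine ⟨(‖F.b1‖ + ‖F.b2‖) / r, ?_, hkpos, ?_, m.cP1 h hb, m.cP2 h hb, m.grad h hb, ?_⟩
  · have := continuous_gauge (Frame.Kc_convex hs.kconv) hn
    unfold Frame.k Frame.u
    fun_prop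
  · intro a
    rw [le_div_iff₀ hr, mul_comm]
    refine (mul_gauge_le_norm hball).trans ?_
    rw [Frame.u]
    refine (norm_add_le _ _).trans ?_
    rw [norm_smul, norm_smul]
    have := Real.abs_cos_le_one a
    have := Real.abs_sin_le_one a
    rw [Real.norm_eq_abs, Real.norm_eq_abs]
    nlinarith [norm_nonneg F.b1, norm_nonneg F.b2]
  · intro a
    set x := F.c + (F.k K a)⁻¹ • F.u a with hx
    have hxK : x ∈ frontier K := by
      have h1 : gauge (F.Kc K) ((F.k K a)⁻¹ • F.u a) = 1 := by
        rw [gauge_smul_of_nonneg (inv_nonneg.2 (hkpos a).le), smul_eq_mul]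
        exact inv_mul_cancel₀ (hkpos a).ne'
      rw [gauge_eq_one_iff_mem_frontier (Frame.Kc_convex hs.kconv) hn, Frame.Kc_eq, ← Homeomorph.preimage_frontier] at h1
      exact h1
    obtain ⟨hpl, hgr⟩ := hs.hΔ x hxK
    have hcg : F.c ∈ (Δ x : Set E3) := by
      apply hgr
      apply h.contact.graze
      rw [hx, inner_add_right, inner_smul_right, Frame.u, inner_add_right, inner_smul_right, inner_smul_right,
        h.nb1, h.nb2]; ring
    have heg : ∀ g : ℝ × ℝ, g.1 * Real.cos a + g.2 * Real.sin a = F.k K a → e g ∈ (Δ x : Set E3) := by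
      intro g hg
      apply hgr
      apply (m.contact h hb g).graze
      have h1 := m.inner_one h hb g
      rw [inner_sub_right] at h1
      rw [hx, inner_add_right, inner_smul_right, Frame.nor_u h, hg, inv_mul_cancel₀ (hkpos a).ne']
      linarith
    obtain ⟨w, hw, hw0⟩ : ∃ w ∈ (Δ x).directionᗮ, w ≠ 0 := by
      apply Submodule.exists_mem_ne_zero_of_ne_bot
      intro hbot
      have := Submodule.finrank_add_finrank_orthogonal (Δ x).direction
      rw [hbot, finrank_bot, hpl] at this
      simp at this
    have hwe : ∀ g : ℝ × ℝ, g.1 * Real.cos a + g.2 * Real.sin a = F.k K a → ⟪w, e g - F.c⟫ = 0 := by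
      intro g hg
      rw [Submodule.mem_orthogonal'] at hw
      exact hw _ (AffineSubspace.vsub_mem_direction (heg g hg) hcg)
    have key : ∀ v, ⟪w, v - F.c⟫ = F.x1 v * ⟪w, F.b1⟫ + F.x2 v * ⟪w, F.b2⟫ - F.z v * ⟪w, F.ν⟫ := by
      intro v
      conv_lhs => rw [h.exp (v - F.c)]
      simp only [inner_add_right, inner_smul_right, Frame.x1, Frame.x2, Frame.z, inner_sub_right]
      ring
    refine ⟨⟪w, F.b1⟫, ⟪w, F.b2⟫, ⟪w, F.ν⟫, ?_, fun g hg => ?_⟩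
    · by_contra hcon
      push Not at hcon
      have h1 := hwe _ (pt_dot a (F.k K a) 0)
      rw [key, hcon.1, hcon.2, mul_zero, mul_zero, add_zero, zero_sub, neg_eq_zero] at h1
      rcases mul_eq_zero.1 h1 with h2 | h2
      · exact (m.zpos h hb _).ne' h2
      · apply hw0
        apply ext_inner_right ℝ
        intro v
        conv_lhs => rw [h.exp v]
        simp only [inner_add_right, inner_smul_right, hcon.1, hcon.2, h2, inner_zero_left]
        ring
    · have h1 := hwe g hg
      have hz := m.zpos h hb g
      rw [key] at h1
      rw [CM.P1, CM.P2]
      field_simp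
      linarith

end

section
open scoped RealInnerProductSpace Topology
open Filter

lemma Body.zero_mem {L : Set E3} (hb : Body L) : (0 : E3) ∈ interior L := by
  obtain ⟨x, hx⟩ := hb.int
  have hx' : -x ∈ interior L := by
    rw [hb.sym]
    have h1 : interior (-L) = (Homeomorph.neg E3) ⁻¹' interior L := ((Homeomorph.neg E3).preimage_interior L).symm
    rw [h1]
    simpa using hx
  have := hb.str.convex.interior hx hx' (a := 1/2) (b := 1/2) (by norm_num) (by norm_num) (by norm_num)
  simpa using this

lemma exists_support {L : Set E3} (hconv : Convex ℝ L) (hintr : (interior L).Nonempty) {e : E3}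
    (he : e ∉ interior L) : ∃ n : E3, n ≠ 0 ∧ ∀ q ∈ L, ⟪n, q⟫ ≤ ⟪n, e⟫ := by
  obtain ⟨f, hf⟩ := geometric_hahn_banach_open_point hconv.interior isOpen_interior he
  set n := (InnerProductSpace.toDual ℝ E3).symm f with hn
  have hnf : ∀ v, ⟪n, v⟫ = f v := fun v => by rw [hn, InnerProductSpace.toDual_symm_apply]
  refine ⟨n, ?_, fun q hq => ?_⟩
  · intro h0
    obtain ⟨x, hx⟩ := hintr
    have := hf x hx
    rw [← hnf, ← hnf, h0] at this
    simp at this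
  · have hcl : q ∈ closure (interior L) := by
      rw [hconv.closure_interior_eq_closure_of_nonempty_interior hintr]; exact subset_closure hq
    rw [hnf, hnf]
    have hsub : closure (interior L) ⊆ {x | f x ≤ f e} :=
      closure_minimal (fun x hx => (hf x hx).le) (isClosed_le (by fun_prop) (by fun_prop))
    exact hsub hcl

lemma Body.exists_contact {L : Set E3} (hb : Body L) {e : E3} (he : e ∈ frontier L) : ∃ n, Contact L e n := by
  obtain ⟨n, h0, h⟩ := exists_support hb.str.convex hb.int he.2
  exact ⟨n, hb.comp.isClosed.frontier_subset he, h0, h⟩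

/-- nearest point projection -/
def Pr (L : Set E3) (π : E3 → E3) : Prop := ∀ z, π z ∈ L ∧ ∀ q ∈ L, ⟪z - π z, q - π z⟫ ≤ 0

lemma Body.exists_Pr {L : Set E3} (hb : Body L) : ∃ π, Pr L π := by
  have := exists_norm_eq_iInf_of_complete_convex (hb.int.mono interior_subset) hb.comp.isComplete hb.str.convex
  choose π h1 h2 using this
  exact ⟨π, fun z => ⟨h1 z, (norm_eq_iInf_iff_real_inner_le_zero hb.str.convex (h1 z)).1 (h2 z)⟩⟩

namespace Pr
variable {L : Set E3} {π : E3 → E3}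

lemma firm (h : Pr L π) (z z' : E3) : ‖π z' - π z‖ ^ 2 ≤ ⟪π z' - π z, z' - z⟫ := by
  have h1 := (h z).2 _ (h z').1
  have h2 := (h z').2 _ (h z).1
  rw [← real_inner_self_eq_norm_sq]
  simp only [inner_sub_left, inner_sub_right] at *
  have e1 := real_inner_comm (π z) (π z')
  have e2 := real_inner_comm (π z) z'
  have e3 := real_inner_comm (π z) z
  have e4 := real_inner_comm (π z') z'
  have e5 := real_inner_comm (π z') z
  linarith

lemma lip (h : Pr L π) (z z' : E3) : ‖π z' - π z‖ ≤ ‖z' - z‖ := by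
  have h1 := h.firm z z'
  have h2 := real_inner_le_norm (π z' - π z) (z' - z)
  by_contra hcon
  push Not at hcon
  nlinarith [norm_nonneg (z' - z), norm_nonneg (π z' - π z)]

lemma lipschitz (h : Pr L π) : LipschitzWith 1 π :=
  LipschitzWith.of_dist_le_mul fun x y => by
    rw [dist_eq_norm, dist_eq_norm, NNReal.coe_one, one_mul]; exact h.lip y x

lemma eq_of (h : Pr L π) {z e : E3} (he : e ∈ L) (hle : ∀ q ∈ L, ⟪z - e, q - e⟫ ≤ 0) : π z = e := by
  have h1 := (h z).2 e he
  have h2 := hle _ (h z).1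
  have : ‖π z - e‖ ^ 2 ≤ 0 := by
    rw [← real_inner_self_eq_norm_sq]
    simp only [inner_sub_left, inner_sub_right] at *
    have e1 := real_inner_comm (π z) e
    linarith
  have h3 : ‖π z - e‖ = 0 := by nlinarith [norm_nonneg (π z - e)]
  exact sub_eq_zero.1 (norm_eq_zero.1 h3)

lemma contact_eq (h : Pr L π) {e n : E3} (hc : Contact L e n) {t : ℝ} (ht : 0 ≤ t) : π (e + t • n) = e := by
  apply h.eq_of hc.1
  intro q hq
  rw [add_sub_cancel_left, real_inner_smul_left, inner_sub_right]
  have := hc.2.2 q hq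
  nlinarith

lemma contact (h : Pr L π) {z : E3} (hz : z ∉ L) : Contact L (π z) (z - π z) := by
  refine ⟨(h z).1, ?_, fun q hq => ?_⟩
  · intro h0
    apply hz
    rw [sub_eq_zero.1 h0]; exact (h z).1
  · have := (h z).2 q hq
    rw [inner_sub_right] at this
    linarith

def Θ (π : E3 → E3) (z : E3) : ℝ := ⟪z, π z⟫ - ‖π z‖ ^ 2 / 2

lemma Θ_le (h : Pr L π) (z z' : E3) : Θ π z + ⟪π z, z' - z⟫ ≤ Θ π z' := by
  have h1 := (h z').2 _ (h z).1
  unfold Θ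
  have e0 : ‖π z - π z'‖ ^ 2 ≥ 0 := by positivity
  rw [← real_inner_self_eq_norm_sq] at *
  rw [← real_inner_self_eq_norm_sq] at *
  simp only [inner_sub_left, inner_sub_right] at *
  have e1 := real_inner_comm (π z) (π z')
  have e2 := real_inner_comm (π z) z'
  have e3 := real_inner_comm (π z) z
  have e4 := real_inner_comm (π z') z'
  have e5 := real_inner_comm (π z') z
  linarith

lemma Θ_grad (h : Pr L π) (z : E3) : HasFDerivAt (Θ π) (innerSL ℝ (π z)) z := by
  rw [hasFDerivAt_iff_isLittleO_nhds_zero, Asymptotics.isLittleO_iff]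
  intro ε hε
  filter_upwards [Metric.ball_mem_nhds (0 : E3) hε] with v hv
  rw [mem_ball_zero_iff] at hv
  have a1 := h.Θ_le z (z + v)
  have a2 := h.Θ_le (z + v) z
  rw [add_sub_cancel_left] at a1
  rw [show z - (z + v) = -v by abel, inner_neg_right] at a2
  have a3 := h.lip z (z + v)
  rw [add_sub_cancel_left] at a3
  have a4 := real_inner_le_norm (π (z + v) - π z) v
  rw [innerSL_apply_apply, Real.norm_eq_abs, abs_of_nonneg (by linarith)]
  rw [inner_sub_left] at a4
  nlinarith [norm_nonneg v]

lemma sym (h : Pr L π) {z : E3} {M : E3 →L[ℝ] E3} (hM : HasFDerivAt π M z) (v w : E3) :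
    ⟪M v, w⟫ = ⟪v, M w⟫ := by
  have h1 : HasFDerivAt (fun y => innerSL ℝ (π y)) ((innerSL ℝ).comp M : E3 →L[ℝ] E3 →L[ℝ] ℝ) z :=
    ((innerSL ℝ : E3 →L[ℝ] E3 →L[ℝ] ℝ).hasFDerivAt).comp z hM
  have := second_derivative_symmetric (𝕜 := ℝ) (fun y => h.Θ_grad y) h1 v w
  simp only [ContinuousLinearMap.comp_apply, innerSL_apply_apply] at this
  rw [this, real_inner_comm]

lemma M_N (h : Pr L π) {z : E3} (hz : z ∉ L) {M : E3 →L[ℝ] E3} (hM : HasFDerivAt π M z) : M (z - π z) = 0 := by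
  have h1 : HasDerivAt (fun t : ℝ => z + t • (z - π z)) (z - π z) 0 := by
    simpa using ((hasDerivAt_id (0:ℝ)).smul_const (z - π z)).const_add z
  have hM' : HasFDerivAt π M (z + (0:ℝ) • (z - π z)) := by simpa using hM
  have h2 := hM'.comp_hasDerivAt (0:ℝ) h1
  have h3 : (π ∘ fun t : ℝ => z + t • (z - π z)) =ᶠ[𝓝 0] fun _ => π z := by
    filter_upwards [Ioo_mem_nhds (show (-1:ℝ) < 0 by norm_num) (show (0:ℝ) < 1 by norm_num)] with t ht
    have := h.contact_eq (h.contact hz) (t := 1 + t) (by linarith [ht.1])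
    rw [add_smul, one_smul] at this
    simp only [Function.comp]
    have e : z + t • (z - π z) = π z + (z - π z + t • (z - π z)) := by abel
    rw [e]; exact this
  have h4 : HasDerivAt (fun _ : ℝ => π z) (M (z - π z)) 0 := h2.congr_of_eventuallyEq h3.symm
  exact h4.unique (hasDerivAt_const _ _)

lemma M_firm (h : Pr L π) {z : E3} {M : E3 →L[ℝ] E3} (hM : HasFDerivAt π M z) (v : E3) :
    ‖M v‖ ^ 2 ≤ ⟪M v, v⟫ := by
  have h1 : HasDerivAt (fun t : ℝ => z + t • v) v 0 := by
    simpa using ((hasDerivAt_id (0:ℝ)).smul_const v).const_add z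
  have hM' : HasFDerivAt π M (z + (0:ℝ) • v) := by simpa using hM
  have h2 := hM'.comp_hasDerivAt (0:ℝ) h1
  rw [hasDerivAt_iff_tendsto_slope_zero] at h2
  simp only [Function.comp, zero_add, zero_smul, add_zero] at h2
  have h3 : Tendsto (fun t : ℝ => ‖t⁻¹ • (π (z + t • v) - π z)‖ ^ 2) (𝓝[≠] 0) (𝓝 (‖M v‖ ^ 2)) := (h2.norm).pow 2
  have h4 : Tendsto (fun t : ℝ => ⟪t⁻¹ • (π (z + t • v) - π z), v⟫) (𝓝[≠] 0) (𝓝 ⟪M v, v⟫) := h2.inner tendsto_const_nhds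
  refine le_of_tendsto_of_tendsto h3 h4 ?_
  filter_upwards [self_mem_nhdsWithin] with t ht
  have ht0 : t ≠ 0 := ht
  have := h.firm z (z + t • v)
  rw [add_sub_cancel_left, inner_smul_right] at this
  rw [norm_smul, mul_pow, real_inner_smul_left, norm_inv, inv_pow, Real.norm_eq_abs, sq_abs]
  have h5 : 0 < t ^ 2 := by positivity
  rw [inv_mul_le_iff₀ h5]
  calc _ ≤ _ := this
    _ = _ := by field_simp

end Pr

end

section
open scoped RealInnerProductSpace Topology NNReal MeasureTheory
open Filter MeasureTheory

namespace Pr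
variable {L : Set E3} {π : E3 → E3}

def Ξ (π : E3 → E3) (z : E3) : E3 := ‖z - π z‖ • π z

lemma Ξ_deriv {z : E3} (hz : z - π z ≠ 0) {M : E3 →L[ℝ] E3} (hM : HasFDerivAt π M z) :
    ∃ D : E3 →L[ℝ] E3, HasFDerivAt (Ξ π) D z ∧ ∀ v, ⟪z - π z, v⟫ = 0 → M v = 0 → D v = 0 := by
  have h1 : HasFDerivAt (fun y => y - π y) (ContinuousLinearMap.id ℝ E3 - M) z := (hasFDerivAt_id z).sub hM
  have h2 := h1.norm_sq
  have h3 := (h2.sqrt (pow_ne_zero 2 (norm_ne_zero_iff.2 hz))).congr_of_eventuallyEq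
    (f₁ := fun y => ‖y - π y‖) (Eventually.of_forall fun y => (Real.sqrt_sq (norm_nonneg _)).symm)
  refine ⟨_, h3.smul hM, fun v hv hMv => ?_⟩
  rw [inner_sub_left] at hv
  simp [hMv, hv]

theorem exists_base (hb : Body L) (h : Pr L π) : ∃ z, z ∉ L ∧ ∃ M : E3 →L[ℝ] E3, HasFDerivAt π M z ∧
    ∀ v, ⟪z - π z, v⟫ = 0 → M v = 0 → v = 0 := by
  by_contra hcon
  push Not at hcon
  set μ : Measure E3 := μH[Module.finrank ℝ E3] with hμ
  have hae : ∀ᵐ x ∂μ, DifferentiableAt ℝ π x := h.lipschitz.ae_differentiableAt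
  obtain ⟨R, hR⟩ := hb.comp.isBounded.exists_norm_le
  have hR0 : 0 ≤ R := (norm_nonneg _).trans (hR _ (h 0).1)
  set A : Set E3 := {z | ‖z - π z‖ ≤ 1} with hA
  have hlip : LipschitzOnWith (Real.toNNReal (1 + 2 * R)) (Ξ π) A := by
    apply LipschitzOnWith.of_dist_le_mul
    intro x hx y hy
    rw [Real.coe_toNNReal _ (by linarith), dist_eq_norm, dist_eq_norm]
    have e : Ξ π x - Ξ π y = ‖x - π x‖ • (π x - π y) + (‖x - π x‖ - ‖y - π y‖) • π y := by
      unfold Ξ; rw [smul_sub, sub_smul]; abel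
    rw [e]
    have l := h.lip y x
    have n1 : |‖x - π x‖ - ‖y - π y‖| ≤ 2 * ‖x - y‖ := by
      refine (abs_norm_sub_norm_le _ _).trans ?_
      rw [show x - π x - (y - π y) = (x - y) - (π x - π y) by abel]
      refine (norm_sub_le _ _).trans ?_
      linarith
    refine (norm_add_le _ _).trans ?_
    rw [norm_smul, norm_smul, norm_norm, Real.norm_eq_abs]
    have hx' : ‖x - π x‖ ≤ 1 := hx
    have hq := hR _ (h y).1
    have t1 : ‖x - π x‖ * ‖π x - π y‖ ≤ 1 * ‖x - y‖ := mul_le_mul hx' l (norm_nonneg _) zero_le_one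
    have t2 : |‖x - π x‖ - ‖y - π y‖| * ‖π y‖ ≤ (2 * ‖x - y‖) * R :=
      mul_le_mul n1 hq (norm_nonneg _) (by positivity)
    linarith
  set N : Set E3 := {z | z ∈ A ∧ ¬ DifferentiableAt ℝ π z} with hN
  set G : Set E3 := {z | z ∉ L ∧ DifferentiableAt ℝ π z} with hG
  have hN0 : μ N = 0 := measure_mono_null (fun z hz => hz.2) (ae_iff.1 hae)
  have hN1 : μ (Ξ π '' N) = 0 := by
    have := (hlip.mono (fun z hz => hz.1 : N ⊆ A)).hausdorffMeasure_image_le (d := Module.finrank ℝ E3) (by positivity)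
    have h0 : (μH[Module.finrank ℝ E3] : Measure E3) N = 0 := hN0
    rw [h0, mul_zero] at this
    exact le_antisymm this zero_le
  have hG1 : μ (Ξ π '' G) = 0 := by
    have hd : ∀ z ∈ G, ∃ D : E3 →L[ℝ] E3, HasFDerivAt (Ξ π) D z ∧ D.det = 0 := by
      rintro z ⟨hz, hdz⟩
      obtain ⟨M, hM⟩ := hdz
      have hz0 := (h.contact hz).2.1
      obtain ⟨D, hD, hD2⟩ := Ξ_deriv hz0 hM
      obtain ⟨v, hv1, hv2, hv3⟩ := hcon z hz M hM
      refine ⟨D, hD, ?_⟩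
      by_contra hdet
      apply hv3
      have hinj := LinearMap.ker_eq_bot.1 ((LinearMap.isUnit_iff_ker_eq_bot _).1 ((LinearMap.isUnit_iff_isUnit_det _).2 (isUnit_iff_ne_zero.2 hdet)))
      apply hinj
      show D v = D 0
      rw [hD2 v hv1 hv2, map_zero]
    choose! D hD hD0 using hd
    exact addHaar_image_eq_zero_of_det_fderivWithin_eq_zero μ (fun x hx => (hD x hx).hasFDerivWithinAt) hD0
  have hsub : interior L \ {0} ⊆ Ξ π '' N ∪ Ξ π '' G := by
    rintro w ⟨hw, hw0⟩
    have hw0 : w ≠ 0 := hw0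
    have hnh : L ∈ 𝓝 (0 : E3) := mem_interior_iff_mem_nhds.1 hb.zero_mem
    have hbd : Bornology.IsVonNBounded ℝ L := hb.comp.isVonNBounded ℝ
    have ht : 0 < gauge L w := (gauge_pos (absorbent_nhds_zero hnh) hbd).2 hw0
    set t := gauge L w with htd
    have ht1 : t < 1 := (gauge_lt_one_iff_mem_interior hb.str.convex hnh).2 hw
    have hc : t⁻¹ • w ∈ frontier L := by
      rw [← gauge_eq_one_iff_mem_frontier hb.str.convex hnh, gauge_smul_of_nonneg (inv_nonneg.2 ht.le), smul_eq_mul]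
      exact inv_mul_cancel₀ ht.ne'
    obtain ⟨n, hn⟩ := hb.exists_contact hc
    have hnn : 0 < ‖n‖ := norm_pos_iff.2 hn.2.1
    set z := t⁻¹ • w + (t / ‖n‖) • n with hz
    have hpz : π z = t⁻¹ • w := h.contact_eq hn (by positivity)
    have hzz : z - π z = (t / ‖n‖) • n := by rw [hpz, hz, add_sub_cancel_left]
    have hnorm : ‖z - π z‖ = t := by
      rw [hzz, norm_smul, Real.norm_of_nonneg (by positivity)]; field_simp
    have hzL : z ∉ L := by
      intro hL
      have := hn.2.2 z hL
      rw [hz, inner_add_right, inner_smul_right _ n, real_inner_self_eq_norm_sq] at this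
      have : 0 < t / ‖n‖ * ‖n‖ ^ 2 := by positivity
      linarith
    have hΞ : Ξ π z = w := by
      rw [Ξ, hnorm, hpz, smul_smul, mul_inv_cancel₀ ht.ne', one_smul]
    by_cases hdz : DifferentiableAt ℝ π z
    · right; exact ⟨z, ⟨hzL, hdz⟩, hΞ⟩
    · left; exact ⟨z, ⟨by show ‖z - π z‖ ≤ 1; rw [hnorm]; exact ht1.le, hdz⟩, hΞ⟩
  have h0 : μ (interior L \ {0}) = 0 := measure_mono_null hsub (measure_union_null hN1 hG1)
  have hopen : IsOpen (interior L \ {0}) := isOpen_interior.sdiff isClosed_singleton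
  have hemp := (hopen.measure_eq_zero_iff μ).1 h0
  obtain ⟨q, hq, hq0⟩ : ∃ q ∈ interior L, q ≠ 0 := by
    by_contra hc
    push Not at hc
    have h1 : interior L = {0} := Subset.antisymm (fun x hx => hc x hx) (by rintro _ rfl; exact hb.zero_mem)
    have h2 : IsOpen ({0} : Set E3) := h1 ▸ isOpen_interior
    exact not_isOpen_singleton (0 : E3) h2
  have : q ∈ interior L \ {0} := ⟨hq, hq0⟩
  rw [hemp] at this
  exact this

end Pr

end

section
open scoped RealInnerProductSpace Topology
open Filter

/-- eigenbasis data at a base point -/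
structure EB (L : Set E3) (π : E3 → E3) (z c ν e1 e2 : E3) (d m1 m2 : ℝ) (M : E3 →L[ℝ] E3) : Prop where
  zL : z ∉ L
  hM : HasFDerivAt π M z
  hd : 0 < d
  hz : z - c = d • ν
  hc : π z = c
  ct : Contact L c ν
  nn : ⟪ν, ν⟫ = 1
  e11 : ⟪e1, e1⟫ = 1
  e12 : ⟪e1, e2⟫ = 0
  e21 : ⟪e2, e1⟫ = 0
  e22 : ⟪e2, e2⟫ = 1
  ne1 : ⟪ν, e1⟫ = 0
  ne2 : ⟪ν, e2⟫ = 0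
  e1n : ⟪e1, ν⟫ = 0
  e2n : ⟪e2, ν⟫ = 0
  exp : ∀ v, v = ⟪e1, v⟫ • e1 + ⟪e2, v⟫ • e2 + ⟪ν, v⟫ • ν
  M1 : M e1 = m1 • e1
  M2 : M e2 = m2 • e2
  Mn : M ν = 0
  m1p : 0 < m1
  m2p : 0 < m2
  m1l : m1 ≤ 1
  m2l : m2 ≤ 1

theorem Pr.exists_EB {L : Set E3} {π : E3 → E3} (hb : Body L) (h : Pr L π) :
    ∃ z c ν e1 e2 d m1 m2 M, EB L π z c ν e1 e2 d m1 m2 M := by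
  obtain ⟨z, hz, M, hM, hnd⟩ := h.exists_base hb
  have hN := h.contact hz
  set N := z - π z with hNd
  have hd : 0 < ‖N‖ := norm_pos_iff.2 hN.2.1
  set ν : E3 := ‖N‖⁻¹ • N with hν
  have hNν : N = ‖N‖ • ν := by rw [hν, smul_smul, mul_inv_cancel₀ hd.ne', one_smul]
  have hν1 : ‖ν‖ = 1 := by rw [hν, norm_smul, norm_inv, norm_norm, inv_mul_cancel₀ hd.ne']
  have hν0 : ν ≠ 0 := by intro h0; rw [h0, norm_zero] at hν1; norm_num at hν1
  have hMν : M ν = 0 := by rw [hν, map_smul, h.M_N hz hM, smul_zero]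
  have hsym : ((M : E3 →L[ℝ] E3) : E3 →ₗ[ℝ] E3).IsSymmetric := fun v w => h.sym hM v w
  have hinv : ∀ v ∈ (ℝ ∙ ν)ᗮ, ((M : E3 →L[ℝ] E3) : E3 →ₗ[ℝ] E3) v ∈ (ℝ ∙ ν)ᗮ := by
    intro v hv
    rw [Submodule.mem_orthogonal_singleton_iff_inner_right] at *
    show ⟪ν, M v⟫ = 0
    rw [← h.sym hM, hMν, inner_zero_left]
  have hrs := hsym.restrict_invariant hinv
  have : Fact (Module.finrank ℝ E3 = 2 + 1) := ⟨by simp⟩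
  have hfr : Module.finrank ℝ (ℝ ∙ ν)ᗮ = 2 := Submodule.finrank_orthogonal_span_singleton hν0
  set b := hrs.eigenvectorBasis hfr with hbd
  have ho : ∀ i, ⟪ν, (b i : E3)⟫ = 0 := fun i =>
    Submodule.mem_orthogonal_singleton_iff_inner_right.1 (b i).2
  have hbo : ∀ i j, ⟪(b i : E3), (b j : E3)⟫ = if i = j then 1 else 0 := fun i j => by
    have := orthonormal_iff_ite.1 b.orthonormal i j
    rwa [Submodule.coe_inner] at this
  have hMe : ∀ i, M (b i) = hrs.eigenvalues hfr i • (b i : E3) := fun i => by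
    exact congrArg Subtype.val (hrs.apply_eigenvectorBasis hfr i)
  have hpos : ∀ i, 0 < hrs.eigenvalues hfr i ∧ hrs.eigenvalues hfr i ≤ 1 := by
    intro i
    set m := hrs.eigenvalues hfr i with hm
    have h1 := h.M_firm hM (b i)
    rw [hMe, norm_smul, mul_pow, real_inner_smul_left, ← real_inner_self_eq_norm_sq (b i : E3), hbo, if_pos rfl,
      Real.norm_eq_abs, sq_abs] at h1
    have h2 : m ≠ 0 := by
      intro h0
      have : (b i : E3) = 0 := hnd _ (by rw [hNν, real_inner_smul_left, ho, mul_zero]) (by rw [hMe, ← hm, h0, zero_smul])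
      have h3 := hbo i i
      rw [this] at h3
      simp at h3
    have h4 : 0 ≤ m := by nlinarith
    have h5 : 0 < m := lt_of_le_of_ne h4 h2.symm
    exact ⟨h5, by nlinarith⟩
  refine ⟨z, π z, ν, b 0, b 1, ‖N‖, hrs.eigenvalues hfr 0, hrs.eigenvalues hfr 1, M, ?_⟩
  have hct : Contact L (π z) ν := by
    refine ⟨hN.1, hν0, fun q hq => ?_⟩
    rw [hν, real_inner_smul_left, real_inner_smul_left]
    exact mul_le_mul_of_nonneg_left (hN.2.2 q hq) (inv_nonneg.2 hd.le)
  constructor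
  · exact hz
  · exact hM
  · exact hd
  · exact hNν
  · rfl
  · exact hct
  · rw [real_inner_self_eq_norm_sq, hν1, one_pow]
  · simpa using hbo 0 0
  · simpa using hbo 0 1
  · simpa using hbo 1 0
  · simpa using hbo 1 1
  · exact ho 0
  · exact ho 1
  · rw [real_inner_comm]; exact ho 0
  · rw [real_inner_comm]; exact ho 1
  · intro v
    have hw : v - ⟪ν, v⟫ • ν ∈ (ℝ ∙ ν)ᗮ := by
      rw [Submodule.mem_orthogonal_singleton_iff_inner_right, inner_sub_right, inner_smul_right,
        real_inner_self_eq_norm_sq, hν1]; ring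
    have := congrArg Subtype.val (b.sum_repr' ⟨_, hw⟩)
    simp only [Fin.sum_univ_two, Submodule.coe_add, Submodule.coe_smul, Submodule.coe_inner] at this
    have hk : ∀ i, ⟪(b i : E3), v - ⟪ν, v⟫ • ν⟫ = ⟪(b i : E3), v⟫ := fun i => by
      have := ho i
      rw [real_inner_comm] at this
      rw [inner_sub_right, real_inner_smul_right (b i : E3) ν, this]; ring
    rw [hk, hk] at this
    conv_lhs => rw [← sub_add_cancel v (⟪ν, v⟫ • ν), ← this]
  · exact hMe 0
  · exact hMe 1
  · exact hMν
  · exact (hpos 0).1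
  · exact (hpos 1).1
  · exact (hpos 0).2
  · exact (hpos 1).2

namespace Pr
variable {L : Set E3} {π : E3 → E3}

lemma Θ_taylor (h : Pr L π) {z : E3} {M : E3 →L[ℝ] E3} (hM : HasFDerivAt π M z) {ε : ℝ} (hε : 0 < ε) :
    ∃ δ > 0, ∀ v : E3, ‖v‖ < δ → ‖π (z + v) - π z - M v‖ ≤ ε * ‖v‖ ∧
      |Θ π (z + v) - Θ π z - ⟪π z, v⟫ - ⟪M v, v⟫ / 2| ≤ ε * ‖v‖ ^ 2 := by
  have h1 := hasFDerivAt_iff_isLittleO_nhds_zero.1 hM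
  rw [Asymptotics.isLittleO_iff] at h1
  obtain ⟨δ, hδ, H⟩ := Metric.eventually_nhds_iff.1 (h1 hε)
  refine ⟨δ, hδ, fun v hv => ⟨H (by simpa using hv), ?_⟩⟩
  set f : E3 → ℝ := fun w => Θ π (z + w) - Θ π z - ⟪π z, w⟫ - ⟪M w, w⟫ / 2 with hf
  have hd : ∀ w, HasFDerivAt f (innerSL ℝ (π (z + w) - π z - M w)) w := by
    intro w
    have a1 : HasFDerivAt (fun w => Θ π (z + w)) (innerSL ℝ (π (z + w))) w := by
      have := (h.Θ_grad (z + w)).comp w ((hasFDerivAt_id w).const_add z)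
      exact this
    have a2 : HasFDerivAt (fun w : E3 => ⟪π z, w⟫) (innerSL ℝ (π z)) w := (innerSL ℝ (π z)).hasFDerivAt
    have a3 := (M.hasFDerivAt (x := w)).inner ℝ (hasFDerivAt_id w)
    have a4 := ((a1.sub_const (Θ π z)).sub a2).sub (a3.const_mul (1/2 : ℝ))
    refine (a4.congr_fderiv ?_).congr_of_eventuallyEq (Eventually.of_forall fun w => ?_)
    · ext y
      simp [inner_sub_left]
      rw [h.sym hM y w, real_inner_comm (M w) y]
      ring
    · simp [hf]; ring
  have key := (convex_closedBall (0 : E3) ‖v‖).norm_image_sub_le_of_norm_hasFDerivWithin_le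
    (f := f) (C := ε * ‖v‖) (fun w _ => (hd w).hasFDerivWithinAt) (fun w hw => ?_)
    (mem_closedBall_self (norm_nonneg v)) (by simp : v ∈ closedBall (0 : E3) ‖v‖)
  · have h0 : f 0 = 0 := by simp [hf]
    rw [h0, sub_zero, sub_zero, Real.norm_eq_abs] at key
    calc _ = |f v| := rfl
      _ ≤ _ := key
      _ = _ := by ring
  · rw [innerSL_apply_norm]
    have hw' : ‖w‖ ≤ ‖v‖ := by simpa using hw
    refine (H (by simpa using lt_of_le_of_lt hw' hv)).trans ?_
    gcongr

lemma Θ_id (z v : E3) : Θ π (z + v) - Θ π z - ⟪π z, v⟫ =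
    ⟪z - π z, π (z + v) - π z⟫ + ⟪v, π (z + v) - π z⟫ - ⟪π (z + v) - π z, π (z + v) - π z⟫ / 2 := by
  unfold Θ
  rw [← real_inner_self_eq_norm_sq, ← real_inner_self_eq_norm_sq]
  simp only [inner_sub_left, inner_sub_right, inner_add_left]
  rw [real_inner_comm (π z) (π (z + v)), real_inner_comm (π z) v]
  ring
end Pr

namespace EB
variable {L : Set E3} {π : E3 → E3} {z c ν e1 e2 : E3} {d m1 m2 : ℝ} {M : E3 →L[ℝ] E3}

lemma inner_exp (h : EB L π z c ν e1 e2 d m1 m2 M) (v w : E3) :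
    ⟪v, w⟫ = ⟪e1, v⟫ * ⟪e1, w⟫ + ⟪e2, v⟫ * ⟪e2, w⟫ + ⟪ν, v⟫ * ⟪ν, w⟫ := by
  conv_lhs => rw [h.exp v]
  simp only [inner_add_left, real_inner_smul_left]

lemma Mv (h : EB L π z c ν e1 e2 d m1 m2 M) (v : E3) : M v = (m1 * ⟪e1, v⟫) • e1 + (m2 * ⟪e2, v⟫) • e2 := by
  conv_lhs => rw [h.exp v]
  simp only [map_add, map_smul, h.M1, h.M2, h.Mn, smul_zero, add_zero, smul_smul, mul_comm]

lemma swap (h : EB L π z c ν e1 e2 d m1 m2 M) : EB L π z c ν e2 e1 d m2 m1 M where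
  zL := h.zL
  hM := h.hM
  hd := h.hd
  hz := h.hz
  hc := h.hc
  ct := h.ct
  nn := h.nn
  e11 := h.e22
  e12 := h.e21
  e21 := h.e12
  e22 := h.e11
  ne1 := h.ne2
  ne2 := h.ne1
  e1n := h.e2n
  e2n := h.e1n
  exp v := by rw [add_comm (⟪e2, v⟫ • e2)]; exact h.exp v
  M1 := h.M2
  M2 := h.M1
  Mn := h.Mn
  m1p := h.m2p
  m2p := h.m1p
  m1l := h.m2l
  m2l := h.m1l

lemma n1 (h : EB L π z c ν e1 e2 d m1 m2 M) (v : E3) : |⟪e1, v⟫| ≤ ‖v‖ := by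
  have := abs_real_inner_le_norm e1 v
  have h1 : ‖e1‖ = 1 := by
    have := h.e11
    rw [real_inner_self_eq_norm_sq] at this
    nlinarith [norm_nonneg e1]
  rwa [h1, one_mul] at this

lemma n2 (h : EB L π z c ν e1 e2 d m1 m2 M) (v : E3) : |⟪e2, v⟫| ≤ ‖v‖ := h.swap.n1 v

set_option maxHeartbeats 1000000 in
lemma taylor (h : EB L π z c ν e1 e2 d m1 m2 M) (hp : Pr L π) {ε : ℝ} (hε : 0 < ε) :
    ∃ δ > 0, ∀ v : E3, ‖v‖ < δ → |⟪e1, π (z + v) - c⟫ - m1 * ⟪e1, v⟫| ≤ ε * ‖v‖ ∧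
      |⟪e2, π (z + v) - c⟫ - m2 * ⟪e2, v⟫| ≤ ε * ‖v‖ ∧
      |d * ⟪ν, c - π (z + v)⟫ - (m1 * (1 - m1) * ⟪e1, v⟫ ^ 2 + m2 * (1 - m2) * ⟪e2, v⟫ ^ 2) / 2| ≤ ε * ‖v‖ ^ 2 ∧
      |⟪z + v - π (z + v), π (z + v) - c⟫ -
        (m1 * (1 - m1) * ⟪e1, v⟫ ^ 2 + m2 * (1 - m2) * ⟪e2, v⟫ ^ 2) / 2| ≤ ε * ‖v‖ ^ 2 := by
  set η := min (ε / 8) 1 with hη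
  have hη0 : 0 < η := by positivity
  have hη1 : η ≤ 1 := min_le_right _ _
  have hη8 : η ≤ ε / 8 := min_le_left _ _
  obtain ⟨δ, hδ, H⟩ := hp.Θ_taylor h.hM hη0
  refine ⟨δ, hδ, fun v hv => ?_⟩
  obtain ⟨H1, H2⟩ := H v hv
  rw [Pr.Θ_id] at H2
  rw [h.hc] at H1 H2
  rw [h.hz] at H2
  set w := π (z + v) - c with hw
  set r := w - M v with hr
  have hwr : w = M v + r := by rw [hr]; abel
  have hv0 := norm_nonneg v
  have hr1 := (h.n1 r).trans H1
  have hr2 := (h.n2 r).trans H1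
  have k1 : ⟪e1, w⟫ = m1 * ⟪e1, v⟫ + ⟪e1, r⟫ := by
    rw [hwr, h.Mv]
    simp only [inner_add_right, inner_smul_right, h.e11, h.e12]; ring
  have k2 : ⟪e2, w⟫ = m2 * ⟪e2, v⟫ + ⟪e2, r⟫ := by
    rw [hwr, h.Mv]
    simp only [inner_add_right, inner_smul_right, h.e21, h.e22]; ring
  have hMn : ‖M v‖ ≤ ‖v‖ := by
    have a := hp.M_firm h.hM v
    have b := real_inner_le_norm (M v) v
    by_contra hcon
    push Not at hcon
    nlinarith [norm_nonneg (M v)]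
  -- error terms
  have E1 : |⟪v, r⟫| ≤ η * ‖v‖ ^ 2 := by
    refine (abs_real_inner_le_norm v r).trans ?_
    nlinarith
  have E2 : |⟪M v, r⟫| ≤ η * ‖v‖ ^ 2 := by
    refine (abs_real_inner_le_norm _ r).trans ?_
    calc _ ≤ ‖v‖ * (η * ‖v‖) := mul_le_mul hMn H1 (norm_nonneg _) hv0
      _ = _ := by ring
  have E3' : |⟪r, r⟫| ≤ η * ‖v‖ ^ 2 := by
    refine (abs_real_inner_le_norm r r).trans ?_
    calc _ ≤ (η * ‖v‖) * (η * ‖v‖) := mul_le_mul H1 H1 (norm_nonneg _) (by positivity)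
      _ = η * (η * ‖v‖ ^ 2) := by ring
      _ ≤ 1 * (η * ‖v‖ ^ 2) := by gcongr
      _ = _ := by ring
  have kMv : ⟪M v, v⟫ = m1 * ⟪e1, v⟫ ^ 2 + m2 * ⟪e2, v⟫ ^ 2 := by
    rw [h.Mv]; simp only [inner_add_left, real_inner_smul_left]; ring
  have kMM : ⟪M v, M v⟫ = m1 ^ 2 * ⟪e1, v⟫ ^ 2 + m2 ^ 2 * ⟪e2, v⟫ ^ 2 := by
    rw [h.Mv]; simp only [inner_add_left, inner_add_right, real_inner_smul_left, real_inner_smul_right, h.e11, h.e12, h.e21, h.e22]; ring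
  have j1 : ⟪v, w⟫ = ⟪M v, v⟫ + ⟪v, r⟫ := by rw [hwr, inner_add_right, real_inner_comm]
  have j2 : ⟪w, w⟫ = ⟪M v, M v⟫ + 2 * ⟪M v, r⟫ + ⟪r, r⟫ := by
    rw [hwr]; simp only [inner_add_left, inner_add_right]; rw [real_inner_comm (M v) r]; ring
  have j3 : ⟪d • ν, w⟫ = - (d * ⟪ν, c - π (z + v)⟫) := by
    rw [real_inner_smul_left, hw, ← neg_sub (π (z + v)) c, inner_neg_right]; ring
  have j4 : ⟪z + v - π (z + v), w⟫ = ⟪d • ν, w⟫ + ⟪v, w⟫ - ⟪w, w⟫ := by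
    rw [← h.hz, ← inner_add_left, ← inner_sub_left]
    congr 1; rw [hw]; abel
  have hε8 : η * ‖v‖ ^ 2 ≤ ε / 8 * ‖v‖ ^ 2 := by gcongr
  have hε8' : η * ‖v‖ ≤ ε / 8 * ‖v‖ := by gcongr
  have hεv : 0 ≤ ε * ‖v‖ ^ 2 := by positivity
  have hεv' : 0 ≤ ε * ‖v‖ := by positivity
  rw [j1, j2, j3, kMM, kMv] at H2
  rw [abs_le] at E1 E2 E3' H2 hr1 hr2
  rw [k1, k2, j4, j1, j2, j3, kMM, kMv]
  refine ⟨?_, ?_, ?_, ?_⟩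
  · rw [abs_le]; constructor <;> linarith
  · rw [abs_le]; constructor <;> linarith
  · rw [abs_le]; constructor <;> linarith
  · rw [abs_le]; constructor <;> linarith
end EB

end

section
open scoped RealInnerProductSpace Topology
open Filter

namespace EB
variable {L : Set E3} {π : E3 → E3} {z c ν e1 e2 : E3} {d m1 m2 : ℝ} {M : E3 →L[ℝ] E3}

/-- scaled frame -/
def fr (c ν e1 e2 : E3) (s1 s2 : ℝ) : Frame := ⟨c, ν, s1 • e1, s2 • e2, s1⁻¹ • e1, s2⁻¹ • e2⟩

lemma fr_ok (h : EB L π z c ν e1 e2 d m1 m2 M) {s1 s2 : ℝ} (h1 : s1 ≠ 0) (h2 : s2 ≠ 0) :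
    (fr c ν e1 e2 s1 s2).Ok L where
  contact := h.ct
  nu1 := h.nn
  d11 := by
    simp only [fr, real_inner_smul_left, real_inner_smul_right, h.e11]; field_simp
  d12 := by simp [fr, real_inner_smul_left, real_inner_smul_right, h.e12]
  d21 := by simp [fr, real_inner_smul_left, real_inner_smul_right, h.e21]
  d22 := by
    simp only [fr, real_inner_smul_left, real_inner_smul_right, h.e22]; field_simp
  nb1 := by simp [fr, real_inner_smul_right, h.ne1]
  nb2 := by simp [fr, real_inner_smul_right, h.ne2]
  d1n := by simp [fr, real_inner_smul_left, h.e1n]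
  d2n := by simp [fr, real_inner_smul_left, h.e2n]
  exp v := by
    have a1 : (⟪s1⁻¹ • e1, v⟫ * s1) = ⟪e1, v⟫ := by rw [real_inner_smul_left]; field_simp
    have a2 : (⟪s2⁻¹ • e2, v⟫ * s2) = ⟪e2, v⟫ := by rw [real_inner_smul_left]; field_simp
    show v = ⟪s1⁻¹ • e1, v⟫ • s1 • e1 + ⟪s2⁻¹ • e2, v⟫ • s2 • e2 + ⟪ν, v⟫ • ν
    rw [smul_smul, smul_smul, a1, a2]
    exact h.exp v

set_option maxHeartbeats 1000000 in
lemma m1_ne {K : Set E3} {Δ : E3 → AffineSubspace ℝ E3} (hs : Setup K L Δ) (hp : Pr L π)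
    (h : EB L π z c ν e1 e2 d m1 m2 M) : m1 ≠ 1 := by
  intro hm1
  have hb := hs.body
  set F := fr c ν e1 e2 1 1 with hF
  have hok : F.Ok L := h.fr_ok one_ne_zero one_ne_zero
  obtain ⟨e, m⟩ := hok.exists_CM hb
  obtain ⟨Km, hPD⟩ := CM.toPD hs hok m
  have hx1 : ∀ q, F.x1 q = ⟪e1, q - c⟫ := fun q => by simp [Frame.x1, hF, fr]
  have hx2 : ∀ q, F.x2 q = ⟪e2, q - c⟫ := fun q => by simp [Frame.x2, hF, fr]
  have hzz : ∀ q, F.z q = ⟪ν, c - q⟫ := fun q => by simp [Frame.z, hF, fr]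
  have hd := h.hd
  obtain ⟨θ, s, μ, Hf⟩ := hPD.flat (by
    intro c0 hc0 Kb
    set K' := max Kb 1 with hK'
    have hK1 : 0 < K' := lt_of_lt_of_le one_pos (le_max_right _ _)
    set ε := min (c0 / 8) (d * c0 ^ 2 / (8 * K')) with hε
    have hε0 : 0 < ε := by positivity
    have hεa : ε ≤ c0 / 8 := min_le_left _ _
    have hεb : ε * (8 * K') ≤ d * c0 ^ 2 := by
      have : ε ≤ d * c0 ^ 2 / (8 * K') := min_le_right _ _
      rwa [le_div_iff₀ (by positivity)] at this
    obtain ⟨δ, hδ, HT⟩ := h.taylor hp hε0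
    refine ⟨4 / (c0 * δ) + 1, fun g hg hg1 => ?_⟩
    have hgp : 0 < ‖g‖ := lt_of_lt_of_le (by positivity) hg
    set t := 4 / (c0 * ‖g‖) with ht
    have ht0 : 0 < t := by positivity
    have htδ : t < δ := by
      rw [ht, div_lt_iff₀ (by positivity)]
      have : 4 / (c0 * δ) < ‖g‖ := by linarith
      rw [div_lt_iff₀ (by positivity)] at this
      linarith
    have hgt : ‖g‖ * t * c0 = 4 := by rw [ht]; field_simp
    obtain ⟨σ, hσ1, hσ2⟩ : ∃ σ : ℝ, |σ| = 1 ∧ g.1 * σ = |g.1| := by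
      rcases abs_cases g.1 with ⟨a, _⟩ | ⟨a, _⟩
      · exact ⟨1, by simp, by rw [a]; ring⟩
      · exact ⟨-1, by simp, by rw [a]; ring⟩
    have he1 : ‖e1‖ = 1 := by
      have := h.e11
      rw [real_inner_self_eq_norm_sq] at this
      nlinarith [norm_nonneg e1]
    have hvn : ‖(σ * t) • e1‖ = t := by
      rw [norm_smul, he1, Real.norm_eq_abs, abs_mul, hσ1, abs_of_pos ht0]; ring
    obtain ⟨T1, T2, T3, -⟩ := HT ((σ * t) • e1) (by rw [hvn]; exact htδ)
    set q := π (z + (σ * t) • e1) with hq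
    have hqL : q ∈ L := (hp _).1
    rw [hvn, real_inner_smul_right, h.e11, ← hx1, hm1] at T1
    rw [hvn, real_inner_smul_right, h.e21, ← hx2] at T2
    rw [hvn, real_inner_smul_right, real_inner_smul_right, h.e11, h.e21, ← hzz, hm1] at T3
    have hi := m.ineq hok hb g hqL
    have hz0 := hok.z_nonneg hqL
    have hg1n : |g.1| ≤ ‖g‖ := by rw [← Real.norm_eq_abs]; exact norm_fst_le g
    have hg2n : |g.2| ≤ ‖g‖ := by rw [← Real.norm_eq_abs]; exact norm_snd_le g
    have i1 : g.1 * F.x1 q ≥ |g.1| * t - ‖g‖ * (ε * t) := by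
      have : g.1 * F.x1 q = g.1 * σ * t + g.1 * (F.x1 q - 1 * (σ * t * 1)) := by ring
      rw [this, hσ2]
      have a := neg_abs_le (g.1 * (F.x1 q - 1 * (σ * t * 1)))
      have b : |g.1 * (F.x1 q - 1 * (σ * t * 1))| ≤ ‖g‖ * (ε * t) := by
        rw [abs_mul]; exact mul_le_mul hg1n T1 (abs_nonneg _) hgp.le
      linarith
    have i2 : g.2 * F.x2 q ≥ - (‖g‖ * (ε * t)) := by
      have a := neg_abs_le (g.2 * F.x2 q)
      have T2' : |F.x2 q| ≤ ε * t := by simpa using T2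
      have b : |g.2 * F.x2 q| ≤ ‖g‖ * (ε * t) := by
        rw [abs_mul]; exact mul_le_mul hg2n T2' (abs_nonneg _) hgp.le
      linarith
    have i3 : |g.1| * t ≥ 4 := by
      have : c0 * ‖g‖ * t ≤ |g.1| * t := by gcongr
      linarith
    have i4 : ‖g‖ * (ε * t) ≤ 1 / 2 := by
      have : ‖g‖ * (ε * t) ≤ ‖g‖ * (c0 / 8 * t) := by gcongr
      linarith
    have i5 : 2 ≤ CM.Ψ F e g * F.z q := by linarith
    have T3' : d * F.z q ≤ ε * t ^ 2 := by
      have := (abs_le.1 T3).2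
      linarith
    -- Ψ bound
    have hze := m.zpos hok hb g
    set S := |CM.P1 F e g| + |CM.P2 F e g| with hS
    have hΨ : CM.Ψ F e g ≤ ‖g‖ * S := by
      have a : CM.Ψ F e g = g.1 * CM.P1 F e g + g.2 * CM.P2 F e g - 1 / F.z (e g) := by
        rw [CM.Ψ, CM.P1, CM.P2]; ring
      have b : 0 < 1 / F.z (e g) := by positivity
      have c1 : g.1 * CM.P1 F e g ≤ ‖g‖ * |CM.P1 F e g| := by
        refine (le_abs_self _).trans ?_
        rw [abs_mul]; gcongr
      have c2 : g.2 * CM.P2 F e g ≤ ‖g‖ * |CM.P2 F e g| := by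
        refine (le_abs_self _).trans ?_
        rw [abs_mul]; gcongr
      rw [a, hS]; linarith
    have hS0 : 0 ≤ S := by positivity
    have i6 : 2 * d ≤ ‖g‖ * S * (ε * t ^ 2) := by
      calc 2 * d ≤ CM.Ψ F e g * F.z q * d := by gcongr
        _ ≤ ‖g‖ * S * F.z q * d := by gcongr
        _ = ‖g‖ * S * (d * F.z q) := by ring
        _ ≤ _ := by gcongr
    have i7 : 2 * d * c0 ^ 2 * ‖g‖ ≤ 16 * (S * ε) := by
      calc 2 * d * c0 ^ 2 * ‖g‖ = 2 * d * (c0 ^ 2 * ‖g‖) := by ring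
        _ ≤ ‖g‖ * S * (ε * t ^ 2) * (c0 ^ 2 * ‖g‖) := by gcongr
        _ = (‖g‖ * t * c0) ^ 2 * (S * ε) := by ring
        _ = _ := by rw [hgt]; ring
    have i8 : 2 * (ε * (8 * K')) * ‖g‖ ≤ 16 * (S * ε) := by
      refine le_trans ?_ i7
      calc 2 * (ε * (8 * K')) * ‖g‖ ≤ 2 * (d * c0 ^ 2) * ‖g‖ := by gcongr
        _ = _ := by ring
    have i9 : K' * ‖g‖ ≤ S := by
      have : ε * (K' * ‖g‖) ≤ ε * S := by linarith
      exact le_of_mul_le_mul_left this hε0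
    refine le_trans ?_ i9
    gcongr
    exact le_max_left _ _)
  -- affine along a full line
  have key : ∀ q ∈ L, Real.cos θ * F.x1 q + Real.sin θ * F.x2 q - μ * F.z q = 0 := by
    intro q hq
    set A := Real.cos θ * F.x1 q + Real.sin θ * F.x2 q - μ * F.z q with hA
    set B := - s * Real.sin θ * F.x1 q + s * Real.cos θ * F.x2 q - CM.Ψ F e (pt θ 0 s) * F.z q with hB
    have hle : ∀ τ : ℝ, τ * A + B ≤ 1 := by
      intro τ
      have := m.ineq hok hb (pt θ τ s) hq
      rw [Hf] at this
      simp only [pt] at this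
      rw [hA, hB]
      simp only [pt]
      linarith
    by_contra hne
    have := hle ((2 - B) / A)
    rw [div_mul_cancel₀ _ hne] at this
    linarith
  set w : E3 := Real.cos θ • e1 + Real.sin θ • e2 + μ • ν with hw
  have hwq : ∀ q ∈ L, ⟪w, q⟫ = ⟪w, c⟫ := by
    intro q hq
    have := key q hq
    rw [hx1, hx2, hzz] at this
    simp only [hw, inner_add_left, real_inner_smul_left]
    simp only [inner_sub_right] at this
    linarith
  have hw0 : w ≠ 0 := by
    intro h0
    have a1 : ⟪e1, w⟫ = Real.cos θ := by
      simp only [hw, inner_add_right, real_inner_smul_right, h.e11, h.e12, h.e1n]; ring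
    have a2 : ⟪e2, w⟫ = Real.sin θ := by
      simp only [hw, inner_add_right, real_inner_smul_right, h.e21, h.e22, h.e2n]; ring
    rw [h0, inner_zero_right] at a1 a2
    have := Real.sin_sq_add_cos_sq θ
    rw [← a1, ← a2] at this
    norm_num at this
  obtain ⟨q0, hq0⟩ := hb.int
  exact not_interior_of_max hw0 (fun q hq => by rw [hwq q hq, hwq q0 (interior_subset hq0)]) hq0

end EB

end

section
open scoped RealInnerProductSpace Topology
open Filter

namespace EB
variable {L : Set E3} {π : E3 → E3} {z c ν e1 e2 : E3} {d m1 m2 : ℝ} {M : E3 →L[ℝ] E3}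

lemma normal_unique (h : EB L π z c ν e1 e2 d m1 m2 M) (hp : Pr L π) (hb : Body L) {n : E3}
    (hn : Contact L c n) (hn1 : ‖n‖ = 1) : n = ν := by
  have hpath : ∀ s : ℝ, 0 ≤ s → s ≤ d → π (z + s • (n - ν)) = c := by
    intro s hs0 hs1
    apply hp.eq_of h.ct.1
    intro q hq
    have : z + s • (n - ν) - c = (d - s) • ν + s • n := by
      rw [add_sub_right_comm, h.hz, smul_sub, sub_smul]; abel
    rw [this, inner_add_left, real_inner_smul_left, real_inner_smul_left, inner_sub_right, inner_sub_right]
    have a1 := h.ct.2.2 q hq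
    have a2 := hn.2.2 q hq
    nlinarith
  have hMv : M (n - ν) = 0 := by
    by_contra hne
    have hpos : 0 < ‖M (n - ν)‖ := norm_pos_iff.2 hne
    have hv0 : 0 < ‖n - ν‖ := by
      apply norm_pos_iff.2
      intro h0; rw [h0, map_zero] at hne; exact hne rfl
    obtain ⟨δ, hδ, H⟩ := hp.Θ_taylor h.hM (ε := ‖M (n - ν)‖ / (2 * ‖n - ν‖)) (by positivity)
    set s := min d (δ / (2 * ‖n - ν‖)) with hs
    have hd := h.hd
    have hs0 : 0 < s := by positivity
    have hsn : s * ‖n - ν‖ < δ := by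
      have : s ≤ δ / (2 * ‖n - ν‖) := min_le_right _ _
      rw [le_div_iff₀ (by positivity)] at this
      nlinarith
    have H1 := (H (s • (n - ν)) (by rw [norm_smul, Real.norm_of_nonneg hs0.le]; exact hsn)).1
    rw [hpath s hs0.le (min_le_left _ _), h.hc, sub_self, zero_sub, norm_neg, map_smul, norm_smul, norm_smul,
      Real.norm_of_nonneg hs0.le] at H1
    have : ‖M (n - ν)‖ / (2 * ‖n - ν‖) * (s * ‖n - ν‖) = s * ‖M (n - ν)‖ / 2 := by field_simp
    rw [this] at H1
    nlinarith
  have hMn : M n = 0 := by rw [map_sub, h.Mn, sub_zero] at hMv; exact hMv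
  rw [h.Mv] at hMn
  have a1 : ⟪e1, n⟫ = 0 := by
    have := congrArg (fun v => ⟪e1, v⟫) hMn
    simp only [inner_add_right, real_inner_smul_right, h.e11, h.e12, inner_zero_right, mul_one, mul_zero, add_zero] at this
    exact (mul_eq_zero.1 this).resolve_left h.m1p.ne'
  have a2 : ⟪e2, n⟫ = 0 := by
    have := congrArg (fun v => ⟪e2, v⟫) hMn
    simp only [inner_add_right, real_inner_smul_right, h.e21, h.e22, inner_zero_right, mul_one, mul_zero, zero_add] at this
    exact (mul_eq_zero.1 this).resolve_left h.m2p.ne'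
  have hexp := h.exp n
  rw [a1, a2, zero_smul, zero_smul, zero_add, zero_add] at hexp
  set a := ⟪ν, n⟫ with ha
  obtain ⟨q, hq, hqc⟩ := Frame.exists_ne hb c
  have p1 := h.ct.pos hb.str hq hqc
  have p2 := hn.pos hb.str hq hqc
  rw [hexp, real_inner_smul_left, real_inner_smul_left] at p2
  have ha0 : 0 < a := by
    by_contra hcon
    push Not at hcon
    nlinarith
  have hν1 : ‖ν‖ = 1 := by
    have := h.nn
    rw [real_inner_self_eq_norm_sq] at this
    nlinarith [norm_nonneg ν]
  have : a = 1 := by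
    rw [hexp, norm_smul, hν1, Real.norm_of_nonneg ha0.le, mul_one] at hn1; exact hn1
  rw [hexp, this, one_smul]

lemma normal_cont (h : EB L π z c ν e1 e2 d m1 m2 M) (hp : Pr L π) (hb : Body L) {ε : ℝ} (hε : 0 < ε) :
    ∃ δ > 0, ∀ e n, Contact L e n → ‖n‖ = 1 → ‖e - c‖ < δ → ‖n - ν‖ < ε := by
  set S : Set (E3 × E3) := (L ×ˢ sphere 0 1) ∩ ({x | ε ≤ ‖x.2 - ν‖} ∩
    ⋂ v ∈ L, {x | ⟪x.2, v⟫ ≤ ⟪x.2, x.1⟫}) with hS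
  have hSc : IsCompact S := by
    apply (hb.comp.prod (isCompact_sphere 0 1)).inter_right
    apply (isClosed_le (by fun_prop) (by fun_prop)).inter
    exact isClosed_biInter fun v _ => isClosed_le (by fun_prop) (by fun_prop)
  have hSm : ∀ e n, Contact L e n → ‖n‖ = 1 → ε ≤ ‖n - ν‖ → (e, n) ∈ S := by
    intro e n hc hn hq
    refine ⟨⟨hc.1, by simpa using hn⟩, hq, ?_⟩
    rw [mem_iInter₂]
    intro v hv
    exact hc.2.2 v hv
  rcases S.eq_empty_or_nonempty with h0 | hne
  · refine ⟨1, one_pos, fun e n hc hn _ => ?_⟩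
    by_contra hcon
    push Not at hcon
    have := hSm e n hc hn hcon
    rw [h0] at this
    exact this.elim
  obtain ⟨x, hx, hmin⟩ := hSc.exists_isMinOn hne (f := fun x : E3 × E3 => ‖x.1 - c‖) (by fun_prop)
  refine ⟨‖x.1 - c‖, ?_, fun e n hc hn hlt => ?_⟩
  · obtain ⟨⟨h2, h3⟩, h4, h5⟩ := hx
    rw [mem_iInter₂] at h5
    have h3' : ‖x.2‖ = 1 := by simpa using h3
    have hn : x.2 ≠ 0 := by
      intro h; rw [h] at h3'; simp at h3'
    have hc : Contact L x.1 x.2 := ⟨h2, hn, h5⟩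
    apply norm_pos_iff.2
    intro h0
    rw [sub_eq_zero.1 h0] at hc
    have := h.normal_unique hp hb hc h3'
    change ε ≤ ‖x.2 - ν‖ at h4
    rw [this, sub_self, norm_zero] at h4
    linarith
  · by_contra hcon
    push Not at hcon
    have := hmin (hSm e n hc hn hcon)
    change _ ≤ ‖e - c‖ at this
    linarith
end EB

/-- elementary asymptotic estimate -/
lemma asym_one {A B κ H ε k1 C s h g p : ℝ} (hH : 0 < H) (hε : 0 < ε) (hk1 : 0 < k1) (hεk : ε ≤ k1 / 2)
    (hA : |A - κ| ≤ ε * H ^ 2) (hB : |B - κ| ≤ ε * H ^ 2) (hκ : k1 * H ^ 2 ≤ κ) (hC : 0 ≤ C)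
    (hs : 0 ≤ s) (hh : |h| ≤ H) (hg : |A * g - s * h| ≤ ε * C * H) (hp : |B * p - s * h| ≤ ε * C * H) :
    |p - g| * H ≤ ε * (4 * C / k1 + 8 * s / k1 ^ 2) := by
  rw [abs_le] at hA hB
  have hH2 : 0 < H ^ 2 := by positivity
  have hA1 : k1 / 2 * H ^ 2 ≤ A := by nlinarith
  have hB1 : k1 / 2 * H ^ 2 ≤ B := by nlinarith
  have hA0 : 0 < A := lt_of_lt_of_le (by positivity) hA1
  have hB0 : 0 < B := lt_of_lt_of_le (by positivity) hB1
  have e : p - g = (B * p - s * h) / B - (A * g - s * h) / A + s * h * ((A - B) / (A * B)) := by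
    field_simp; ring
  have b1 : |(B * p - s * h) / B| ≤ ε * C * H / (k1 / 2 * H ^ 2) := by
    rw [abs_div, abs_of_pos hB0]; gcongr
  have b2 : |(A * g - s * h) / A| ≤ ε * C * H / (k1 / 2 * H ^ 2) := by
    rw [abs_div, abs_of_pos hA0]; gcongr
  have b3 : |s * h * ((A - B) / (A * B))| ≤ s * H * (2 * (ε * H ^ 2) / ((k1 / 2 * H ^ 2) * (k1 / 2 * H ^ 2))) := by
    rw [abs_mul, abs_mul, abs_div, abs_of_nonneg hs, abs_of_pos (mul_pos hA0 hB0)]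
    have : |A - B| ≤ 2 * (ε * H ^ 2) := by rw [abs_le]; constructor <;> linarith
    gcongr
  have : |p - g| ≤ ε * C * H / (k1 / 2 * H ^ 2) + ε * C * H / (k1 / 2 * H ^ 2) +
      s * H * (2 * (ε * H ^ 2) / ((k1 / 2 * H ^ 2) * (k1 / 2 * H ^ 2))) := by
    rw [e]
    refine (abs_add_le _ _).trans ?_
    have := abs_sub ((B * p - s * h) / B) ((A * g - s * h) / A)
    linarith
  calc |p - g| * H ≤ _ * H := mul_le_mul_of_nonneg_right this hH.le
    _ = _ := by field_simp; ring

lemma asym_low {A κ H ε k2 C s h g : ℝ} (hH : 0 < H) (hε : 0 < ε) (hε1 : ε ≤ 1) (hk2 : 0 ≤ k2)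
    (hA0 : 0 < A) (hA : |A - κ| ≤ ε * H ^ 2) (hκ : κ ≤ k2 * H ^ 2)
    (hs : 0 < s) (hεs : ε * C ≤ s / 4) (hh : H / 2 ≤ |h|) (hg : |A * g - s * h| ≤ ε * C * H) :
    s / (4 * (k2 + 1)) ≤ |g| * H := by
  rw [abs_le] at hA
  have a1 : A ≤ (k2 + 1) * H ^ 2 := by nlinarith [sq_nonneg H]
  have a2 : s * |h| - ε * C * H ≤ A * |g| := by
    have := abs_sub_abs_le_abs_sub (s * h) (A * g)
    rw [abs_sub_comm, abs_mul, abs_mul, abs_of_pos hs, abs_of_pos hA0] at this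
    linarith
  have a3 : s * H / 4 ≤ A * |g| := by nlinarith
  have a4 : A * |g| ≤ (k2 + 1) * H ^ 2 * |g| := by gcongr
  rw [div_le_iff₀ (by positivity)]
  have a5 : s * H ≤ (|g| * H * (4 * (k2 + 1))) * H := by linarith
  exact le_of_mul_le_mul_right a5 hH

end

section
open scoped RealInnerProductSpace Topology
open Filter

namespace EB
variable {L : Set E3} {π : E3 → E3} {z c ν e1 e2 : E3} {d m1 m2 : ℝ} {M : E3 →L[ℝ] E3}

lemma nsq (h : EB L π z c ν e1 e2 d m1 m2 M) (v : E3) :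
    ‖v‖ ^ 2 = ⟪e1, v⟫ ^ 2 + ⟪e2, v⟫ ^ 2 + ⟪ν, v⟫ ^ 2 := by
  rw [← real_inner_self_eq_norm_sq, h.inner_exp]; ring

/-- the displacement is almost tangential -/
lemma tang (h : EB L π z c ν e1 e2 d m1 m2 M) (hp : Pr L π) {v : E3} {κ ε : ℝ} (hε1 : ε ≤ 1)
    (hn : ‖z + v - π (z + v)‖ = d) (hκ : κ ≤ ‖v‖ ^ 2) (hct : 0 ≤ ⟪ν, c - π (z + v)⟫)
    (hB : |d * ⟪ν, c - π (z + v)⟫ - κ| ≤ ε * ‖v‖ ^ 2) (hv : ‖v‖ ≤ d / 8) :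
    3 / 4 * ‖v‖ ^ 2 ≤ ⟪e1, v⟫ ^ 2 + ⟪e2, v⟫ ^ 2 := by
  have hd := h.hd
  set w := v - (π (z + v) - c) with hw
  have h1 : z + v - π (z + v) = d • ν + w := by rw [← h.hz, hw]; abel
  rw [h1] at hn
  have h2 : 2 * d * ⟪ν, w⟫ + ‖w‖ ^ 2 = 0 := by
    have : ‖d • ν + w‖ ^ 2 = d ^ 2 := by rw [hn]
    rw [← real_inner_self_eq_norm_sq] at this
    simp only [inner_add_left, inner_add_right, real_inner_smul_left, real_inner_smul_right, h.nn] at this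
    rw [real_inner_comm ν w, real_inner_self_eq_norm_sq w] at this
    linarith
  have hl := hp.lip z (z + v)
  rw [h.hc, add_sub_cancel_left] at hl
  have hwn : ‖w‖ ≤ 2 * ‖v‖ := by
    have := norm_sub_le v (π (z + v) - c)
    rw [hw]; linarith
  have hwν : ⟪ν, w⟫ = ⟪ν, v⟫ + ⟪ν, c - π (z + v)⟫ := by
    rw [← inner_add_right, hw]; congr 1; abel
  have hB2 := (abs_le.1 hB).2
  have hv0 := norm_nonneg v
  have hw2 : ‖w‖ ^ 2 ≤ 4 * ‖v‖ ^ 2 := by nlinarith [norm_nonneg w]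
  have hεv : ε * ‖v‖ ^ 2 ≤ 1 * ‖v‖ ^ 2 := by gcongr
  have hνv : d * ⟪ν, v⟫ = - ‖w‖ ^ 2 / 2 - d * ⟪ν, c - π (z + v)⟫ := by
    rw [hwν] at h2; linarith
  have hup : |d * ⟪ν, v⟫| ≤ 4 * ‖v‖ ^ 2 := by
    rw [abs_le, hνv]
    have : 0 ≤ d * ⟪ν, c - π (z + v)⟫ := by positivity
    have hwq := sq_nonneg ‖w‖
    have hvq := sq_nonneg ‖v‖
    constructor <;> linarith
  have h3 : |⟪ν, v⟫| ≤ ‖v‖ / 2 := by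
    rw [abs_mul, abs_of_pos hd] at hup
    have : d * |⟪ν, v⟫| ≤ d * (‖v‖ / 2) := by nlinarith
    exact le_of_mul_le_mul_left this hd
  have h4 : ⟪ν, v⟫ ^ 2 ≤ (‖v‖ / 2) ^ 2 := by
    rw [← sq_abs]; gcongr
  have := h.nsq v
  linarith

set_option maxHeartbeats 2000000 in
lemma hsm (h : EB L π z c ν e1 e2 d m1 m2 M) (hp : Pr L π) (hb : Body L) (hm1 : m1 < 1) (hm2 : m2 < 1)
    {s1 s2 : ℝ} (hs1 : 0 < s1) (hs2 : 0 < s2) (hl1 : s1 ^ 2 * (1 - m1) = d * m1) (hl2 : s2 ^ 2 * (1 - m2) = d * m2)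
    {e : ℝ × ℝ → E3} (m : CM (fr c ν e1 e2 s1 s2) L e) :
    ∀ ε > 0, ∃ R > 0, ∀ g : ℝ × ℝ, R ≤ ‖g‖ → |CM.P1 (fr c ν e1 e2 s1 s2) e g - g.1| ≤ ε * ‖g‖ ∧
      |CM.P2 (fr c ν e1 e2 s1 s2) e g - g.2| ≤ ε * ‖g‖ := by
  intro εt hεt
  set F := fr c ν e1 e2 s1 s2 with hF
  have hok : F.Ok L := h.fr_ok hs1.ne' hs2.ne'
  have hd := h.hd
  set k0 := min (m1 * (1 - m1)) (m2 * (1 - m2)) with hk0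
  have q1 : 0 < m1 * (1 - m1) := mul_pos h.m1p (by linarith)
  have q2 : 0 < m2 * (1 - m2) := mul_pos h.m2p (by linarith)
  have hk00 : 0 < k0 := lt_min q1 q2
  set k1 := 3 / 8 * k0 with hk1
  have hk10 : 0 < k1 := by positivity
  set C := s1 + s2 + d / s1 + d / s2 with hC
  have hC0 : 0 < C := by positivity
  set t1 := s1 * (1 - m1) with ht1
  set t2 := s2 * (1 - m2) with ht2
  have ht10 : 0 < t1 := mul_pos hs1 (by linarith)
  have ht20 : 0 < t2 := mul_pos hs2 (by linarith)
  set t0 := min t1 t2 with ht0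
  have ht00 : 0 < t0 := lt_min ht10 ht20
  set D := 4 * C / k1 + 8 * (t1 + t2) / k1 ^ 2 with hD
  have hD0 : 0 < D := by positivity
  set ε := min (min 1 (k1 / 2)) (min (t0 / (4 * C)) (εt * t0 / (8 * D))) with hε
  have hε0 : 0 < ε := by positivity
  have hε1 : ε ≤ 1 := (min_le_left _ _).trans (min_le_left _ _)
  have hεk : ε ≤ k1 / 2 := (min_le_left _ _).trans (min_le_right _ _)
  have hεC : ε * C ≤ t0 / 4 := by
    have : ε ≤ t0 / (4 * C) := (min_le_right _ _).trans (min_le_left _ _)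
    rw [le_div_iff₀ (by positivity)] at this
    linarith
  have hεD : ε * D ≤ εt * (t0 / 8) := by
    have : ε ≤ εt * t0 / (8 * D) := (min_le_right _ _).trans (min_le_right _ _)
    rw [le_div_iff₀ (by positivity)] at this
    linarith
  obtain ⟨δ, hδ, HT⟩ := h.taylor hp hε0
  set δ' := min δ (d / 8) with hδ'
  have hδ'0 : 0 < δ' := by positivity
  obtain ⟨δ2, hδ2, HN⟩ := h.normal_cont hp hb (ε := δ' / (2 * d)) (by positivity)
  obtain ⟨R, hR, HR⟩ := m.decay hok hb (ε := min (δ' / 2) δ2) (by positivity)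
  refine ⟨R, hR, fun g hg => ?_⟩
  have hec := HR g hg
  have hct := m.contact hok hb g
  have hone := m.inner_one hok hb g
  have hzp := m.zpos hok hb g
  set n := F.nor g (CM.Ψ F e g) with hn
  have hN0 : 0 < ‖n‖ := norm_pos_iff.2 hct.2.1
  set nh := ‖n‖⁻¹ • n with hnh
  have hnh1 : ‖nh‖ = 1 := by rw [hnh, norm_smul, norm_inv, norm_norm, inv_mul_cancel₀ hN0.ne']
  have hcth : Contact L (e g) nh := by
    refine ⟨hct.1, ?_, fun q hq => ?_⟩
    · intro h0; rw [h0, norm_zero] at hnh1; norm_num at hnh1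
    · rw [hnh, real_inner_smul_left, real_inner_smul_left]
      exact mul_le_mul_of_nonneg_left (hct.2.2 q hq) (by positivity)
  have hnν := HN _ _ hcth hnh1 (lt_of_lt_of_le hec (min_le_right _ _))
  have hec1 : ‖e g - c‖ < δ' / 2 := lt_of_lt_of_le hec (min_le_left _ _)
  set v := (e g - c) + d • (nh - ν) with hv
  have hzv : z + v = e g + d • nh := by
    have : z = c + d • ν := by rw [← h.hz]; abel
    rw [this, hv, smul_sub]; abel
  have hπ : π (z + v) = e g := by rw [hzv]; exact hp.contact_eq hcth hd.le
  have hvδ : ‖v‖ < δ' := by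
    have a1 := norm_add_le (e g - c) (d • (nh - ν))
    rw [norm_smul, Real.norm_of_nonneg hd.le] at a1
    have a2 : d * ‖nh - ν‖ < d * (δ' / (2 * d)) := by gcongr
    have a3 : d * (δ' / (2 * d)) = δ' / 2 := by field_simp
    rw [hv]; linarith
  have hvd : ‖v‖ ≤ d / 8 := hvδ.le.trans (min_le_right _ _)
  obtain ⟨T1, T2, T3, T4⟩ := HT v (lt_of_lt_of_le hvδ (min_le_left _ _))
  rw [hπ] at T1 T2 T3 T4
  set v1 := ⟪e1, v⟫ with hv1
  set v2 := ⟪e2, v⟫ with hv2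
  set κ := (m1 * (1 - m1) * v1 ^ 2 + m2 * (1 - m2) * v2 ^ 2) / 2 with hκ
  set H := ‖v‖ with hH
  have hH0 : 0 < H := by
    apply norm_pos_iff.2
    intro h0
    rw [h0, add_zero, h.hc] at hπ
    rw [← hπ] at hzp
    have : F.z c = 0 := by simp [Frame.z, hF, fr]
    linarith
  have hnsq := h.nsq v
  have hκ2 : κ ≤ 1 * H ^ 2 := by
    have b1 : m1 * (1 - m1) ≤ 1 := mul_le_one₀ h.m1l (by linarith) (by linarith [h.m1p])
    have b2 : m2 * (1 - m2) ≤ 1 := mul_le_one₀ h.m2l (by linarith) (by linarith [h.m2p])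
    have b3 : m1 * (1 - m1) * v1 ^ 2 ≤ 1 * v1 ^ 2 := by gcongr
    have b4 : m2 * (1 - m2) * v2 ^ 2 ≤ 1 * v2 ^ 2 := by gcongr
    have b5 := sq_nonneg ⟪ν, v⟫
    have b6 := sq_nonneg v1
    have b7 := sq_nonneg v2
    rw [hκ]; linarith
  have hze : F.z (e g) = ⟪ν, c - e g⟫ := rfl
  have htan := h.tang hp (v := v) (κ := κ) hε1 (by rw [hπ, hzv, add_sub_cancel_left, norm_smul, hnh1, Real.norm_of_nonneg hd.le, mul_one])
    (by linarith) (by rw [hπ, ← hze]; exact hzp.le) (by rw [hπ]; exact T3) hvd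
  have hκ1 : k1 * H ^ 2 ≤ κ := by
    have b3 : k0 * v1 ^ 2 ≤ m1 * (1 - m1) * v1 ^ 2 := by gcongr; exact min_le_left _ _
    have b4 : k0 * v2 ^ 2 ≤ m2 * (1 - m2) * v2 ^ 2 := by gcongr; exact min_le_right _ _
    have b5 : k0 * (3 / 4 * H ^ 2) ≤ k0 * (v1 ^ 2 + v2 ^ 2) := by gcongr
    rw [hκ, hk1]; linarith
  set A := ⟪z + v - e g, e g - c⟫ with hA
  set B := d * ⟪ν, c - e g⟫ with hB
  have hzve : z + v - e g = (d / ‖n‖) • n := by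
    rw [hzv, add_sub_cancel_left, hnh, smul_smul, div_eq_mul_inv]
  have hAe : A = d / ‖n‖ := by
    have hone' : ⟪n, e g - c⟫ = 1 := hone
    rw [hA, hzve, real_inner_smul_left, hone', mul_one]
  have hA0 : 0 < A := by rw [hAe]; positivity
  -- g in terms of v
  have hzc1 : ⟪e1, z + v - e g⟫ = v1 - ⟪e1, e g - c⟫ := by
    have : z + v - e g = d • ν + v - (e g - c) := by rw [← h.hz]; abel
    rw [this, inner_sub_right, inner_add_right, real_inner_smul_right, h.e1n]; ring
  have hzc2 : ⟪e2, z + v - e g⟫ = v2 - ⟪e2, e g - c⟫ := by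
    have : z + v - e g = d • ν + v - (e g - c) := by rw [← h.hz]; abel
    rw [this, inner_sub_right, inner_add_right, real_inner_smul_right, h.e2n]; ring
  have hg1 : A * g.1 = s1 * (v1 - ⟪e1, e g - c⟫) := by
    have a := CM.nor_b1 hok g (CM.Ψ F e g)
    rw [← hn] at a
    have a' : ⟪n, s1 • e1⟫ = g.1 := a
    rw [← hzc1, hzve, real_inner_smul_right, hAe, ← a', real_inner_smul_right, real_inner_comm e1 n]; ring
  have hg2 : A * g.2 = s2 * (v2 - ⟪e2, e g - c⟫) := by
    have a := CM.nor_b2 hok g (CM.Ψ F e g)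
    rw [← hn] at a
    have a' : ⟪n, s2 • e2⟫ = g.2 := a
    rw [← hzc2, hzve, real_inner_smul_right, hAe, ← a', real_inner_smul_right, real_inner_comm e2 n]; ring
  have hp1 : B * CM.P1 F e g = d / s1 * ⟪e1, e g - c⟫ := by
    have a : F.x1 (e g) = s1⁻¹ * ⟪e1, e g - c⟫ := by
      show ⟪s1⁻¹ • e1, e g - c⟫ = _
      rw [real_inner_smul_left]
    rw [CM.P1, hB, ← hze, a]; field_simp
  have hp2 : B * CM.P2 F e g = d / s2 * ⟪e2, e g - c⟫ := by
    have a : F.x2 (e g) = s2⁻¹ * ⟪e2, e g - c⟫ := by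
      show ⟪s2⁻¹ • e2, e g - c⟫ = _
      rw [real_inner_smul_left]
    rw [CM.P2, hB, ← hze, a]; field_simp
  have ds1 : 0 < d / s1 := by positivity
  have ds2 : 0 < d / s2 := by positivity
  have hεH : 0 < ε * H := by positivity
  have G1 : |A * g.1 - t1 * v1| ≤ ε * C * H := by
    have : A * g.1 - t1 * v1 = - s1 * (⟪e1, e g - c⟫ - m1 * v1) := by rw [hg1, ht1]; ring
    rw [this, abs_mul, abs_neg, abs_of_pos hs1]
    calc s1 * _ ≤ s1 * (ε * H) := by gcongr
      _ ≤ C * (ε * H) := by gcongr; rw [hC]; linarith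
      _ = _ := by ring
  have G2 : |A * g.2 - t2 * v2| ≤ ε * C * H := by
    have : A * g.2 - t2 * v2 = - s2 * (⟪e2, e g - c⟫ - m2 * v2) := by rw [hg2, ht2]; ring
    rw [this, abs_mul, abs_neg, abs_of_pos hs2]
    calc s2 * _ ≤ s2 * (ε * H) := by gcongr
      _ ≤ C * (ε * H) := by gcongr; rw [hC]; linarith
      _ = _ := by ring
  have tt1 : t1 = d / s1 * m1 := by rw [ht1]; field_simp; linarith
  have tt2 : t2 = d / s2 * m2 := by rw [ht2]; field_simp; linarith
  have Q1 : |B * CM.P1 F e g - t1 * v1| ≤ ε * C * H := by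
    have : B * CM.P1 F e g - t1 * v1 = d / s1 * (⟪e1, e g - c⟫ - m1 * v1) := by rw [hp1, tt1]; ring
    rw [this, abs_mul, abs_of_pos ds1]
    calc d / s1 * _ ≤ d / s1 * (ε * H) := by gcongr
      _ ≤ C * (ε * H) := by gcongr; rw [hC]; linarith
      _ = _ := by ring
  have Q2 : |B * CM.P2 F e g - t2 * v2| ≤ ε * C * H := by
    have : B * CM.P2 F e g - t2 * v2 = d / s2 * (⟪e2, e g - c⟫ - m2 * v2) := by rw [hp2, tt2]; ring
    rw [this, abs_mul, abs_of_pos ds2]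
    calc d / s2 * _ ≤ d / s2 * (ε * H) := by gcongr
      _ ≤ C * (ε * H) := by gcongr; rw [hC]; linarith
      _ = _ := by ring
  have hv1n : |v1| ≤ H := h.n1 v
  have hv2n : |v2| ≤ H := h.n2 v
  have R1 := asym_one hH0 hε0 hk10 hεk T4 T3 hκ1 hC0.le ht10.le hv1n G1 Q1
  have R2 := asym_one hH0 hε0 hk10 hεk T4 T3 hκ1 hC0.le ht20.le hv2n G2 Q2
  have hD1 : 4 * C / k1 + 8 * t1 / k1 ^ 2 ≤ D := by rw [hD]; gcongr; linarith
  have hD2 : 4 * C / k1 + 8 * t2 / k1 ^ 2 ≤ D := by rw [hD]; gcongr; linarith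
  have hlow : t0 / 8 ≤ ‖g‖ * H := by
    have hor : H / 2 ≤ |v1| ∨ H / 2 ≤ |v2| := by
      by_contra hcon
      push Not at hcon
      obtain ⟨c1, c2⟩ := hcon
      have b1 : v1 ^ 2 ≤ (H / 2) ^ 2 := by rw [← sq_abs]; gcongr
      have b2 : v2 ^ 2 ≤ (H / 2) ^ 2 := by rw [← sq_abs]; gcongr
      have : 0 < H ^ 2 := by positivity
      linarith
    rcases hor with hor | hor
    · have a := asym_low hH0 hε0 hε1 zero_le_one hA0 T4 hκ2 ht10 (hεC.trans (by gcongr; exact min_le_left _ _)) hor G1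
      have b : |g.1| ≤ ‖g‖ := by rw [← Real.norm_eq_abs]; exact norm_fst_le g
      calc t0 / 8 ≤ t1 / 8 := by gcongr; exact min_le_left _ _
        _ = t1 / (4 * (1 + 1)) := by norm_num
        _ ≤ _ := a
        _ ≤ _ := by gcongr
    · have a := asym_low hH0 hε0 hε1 zero_le_one hA0 T4 hκ2 ht20 (hεC.trans (by gcongr; exact min_le_right _ _)) hor G2
      have b : |g.2| ≤ ‖g‖ := by rw [← Real.norm_eq_abs]; exact norm_snd_le g
      calc t0 / 8 ≤ t2 / 8 := by gcongr; exact min_le_right _ _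
        _ = t2 / (4 * (1 + 1)) := by norm_num
        _ ≤ _ := a
        _ ≤ _ := by gcongr
  have fin : εt * (t0 / 8) ≤ εt * ‖g‖ * H := by
    rw [mul_assoc]; gcongr
  constructor
  · refine le_of_mul_le_mul_right ?_ hH0
    calc _ ≤ _ := R1
      _ ≤ ε * D := by gcongr
      _ ≤ _ := hεD
      _ ≤ _ := fin
  · refine le_of_mul_le_mul_right ?_ hH0
    calc _ ≤ _ := R2
      _ ≤ ε * D := by gcongr
      _ ≤ _ := hεD
      _ ≤ _ := fin
end EB

end

section
open scoped RealInnerProductSpace Topology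
open Filter

/-- a quadric -/
structure Quad where
  B : E3 →ₗ[ℝ] E3 →ₗ[ℝ] ℝ
  l : E3 →ₗ[ℝ] ℝ
  κ : ℝ
  sym : ∀ v w, B v w = B w v

namespace Quad
def q (Q : Quad) (e v : E3) : ℝ := Q.B e v + Q.l e + Q.l v + Q.κ

def Hold (Q : Quad) (e n : E3) : Prop := ∃ t : ℝ, ∀ v, ⟪n, v - e⟫ = t * Q.q e v

def shift (Q : Quad) (c : E3) : Quad := ⟨Q.B, Q.l - Q.B c, Q.κ + Q.B c c - 2 * Q.l c, Q.sym⟩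

lemma shift_q (Q : Quad) (c e v : E3) : (Q.shift c).q e v = Q.q (e - c) (v - c) := by
  simp only [shift, q, map_sub, LinearMap.sub_apply]
  rw [Q.sym e c]; ring

lemma Hold.smul {Q : Quad} {e n : E3} (h : Q.Hold e n) (t : ℝ) : Q.Hold e (t • n) := by
  obtain ⟨s, hs⟩ := h
  exact ⟨t * s, fun v => by rw [real_inner_smul_left, hs]; ring⟩

lemma Hold.ne {Q : Quad} {e n : E3} (hn : n ≠ 0) {t : ℝ} (h : ∀ v, ⟪n, v - e⟫ = t * Q.q e v) : t ≠ 0 := by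
  rintro rfl
  have := h (e + n)
  rw [add_sub_cancel_left, zero_mul] at this
  exact hn (inner_self_eq_zero.1 this)

lemma Hold.self {Q : Quad} {e n : E3} (hn : n ≠ 0) (h : Q.Hold e n) : Q.q e e = 0 := by
  obtain ⟨t, ht⟩ := h
  have h0 := Hold.ne hn ht
  have := ht e
  rw [sub_self, inner_zero_right] at this
  exact (mul_eq_zero.1 this.symm).resolve_left h0
end Quad

/-- the linear functional given by inner product -/
def il (n : E3) : E3 →ₗ[ℝ] ℝ := (innerSL ℝ n : E3 →L[ℝ] ℝ)
lemma il_apply (n v : E3) : il n v = ⟪n, v⟫ := rfl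

/-- product of functionals -/
def pl (f g : E3 →ₗ[ℝ] ℝ) : E3 →ₗ[ℝ] E3 →ₗ[ℝ] ℝ := f.smulRight g
lemma pl_apply (f g : E3 →ₗ[ℝ] ℝ) (v w : E3) : pl f g v w = f v * g w := rfl

section
variable {K L : Set E3} {Δ : E3 → AffineSubspace ℝ E3}

theorem Setup.base (hs : Setup K L Δ) : ∃ F : Frame, F.Ok L ∧ ∃ e, CM F L e ∧ ∃ Q : Quad,
    ∀ g ∈ XX (F.k K), Q.Hold (e g) (F.nor g (CM.Ψ F e g)) := by
  have hb := hs.body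
  obtain ⟨π, hp⟩ := hb.exists_Pr
  obtain ⟨z, c, ν, e1, e2, d, m1, m2, M, h⟩ := hp.exists_EB hb
  have hm1 : m1 < 1 := lt_of_le_of_ne h.m1l (h.m1_ne hs hp)
  have hm2 : m2 < 1 := lt_of_le_of_ne h.m2l (h.swap.m1_ne hs hp)
  have hd := h.hd
  have p1 := h.m1p
  have p2 := h.m2p
  have q1 : 0 < 1 - m1 := by linarith
  have q2 : 0 < 1 - m2 := by linarith
  set s1 := Real.sqrt (d * m1 / (1 - m1)) with hs1
  set s2 := Real.sqrt (d * m2 / (1 - m2)) with hs2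
  have hs10 : 0 < s1 := Real.sqrt_pos.2 (by positivity)
  have hs20 : 0 < s2 := Real.sqrt_pos.2 (by positivity)
  have hl1 : s1 ^ 2 * (1 - m1) = d * m1 := by rw [hs1, Real.sq_sqrt (by positivity)]; field_simp
  have hl2 : s2 ^ 2 * (1 - m2) = d * m2 := by rw [hs2, Real.sq_sqrt (by positivity)]; field_simp
  set F := EB.fr c ν e1 e2 s1 s2 with hF
  have hok : F.Ok L := h.fr_ok hs10.ne' hs20.ne'
  obtain ⟨e, m⟩ := hok.exists_CM hb
  obtain ⟨Km, hPD⟩ := CM.toPD hs hok m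
  obtain ⟨z1, z2, hz⟩ := hPD.lemmaE (h.hsm hp hb hm1 hm2 hs10 hs20 hl1 hl2 m)
  obtain ⟨c0, hc0⟩ := hPD.potential (m11 := 1) (m12 := 0) (m22 := 1) (z1 := z1) (z2 := z2) (by
    intro g hg
    obtain ⟨a1, a2⟩ := hz g hg
    exact ⟨by rw [a1]; ring, by rw [a2]; ring⟩)
  set c1 := c0 - (z1 ^ 2 + z2 ^ 2) / 2 with hc1
  let f1 := il F.d1
  let f2 := il F.d2
  let f0 := il (-F.ν)
  let B : E3 →ₗ[ℝ] E3 →ₗ[ℝ] ℝ := pl f1 f1 + pl f2 f2 - z1 • (pl f0 f1 + pl f1 f0) - z2 • (pl f0 f2 + pl f2 f0)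
    - (2 * c1) • pl f0 f0
  have hB : ∀ v w, B v w = f1 v * f1 w + f2 v * f2 w - z1 * (f0 v * f1 w + f1 v * f0 w)
      - z2 * (f0 v * f2 w + f2 v * f0 w) - 2 * c1 * (f0 v * f0 w) := fun v w => by
    simp only [B, LinearMap.sub_apply, LinearMap.add_apply, LinearMap.smul_apply, pl_apply, smul_eq_mul]
  let Q0 : Quad := ⟨B, -f0, 0, fun v w => by rw [hB, hB]; ring⟩
  refine ⟨F, hok, e, m, Q0.shift F.c, fun g hg => ?_⟩
  have hzp := m.zpos hok hb g
  refine ⟨1 / F.z (e g), fun v => ?_⟩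
  have hone := m.inner_one hok hb g
  have e0 : ⟪F.nor g (CM.Ψ F e g), v - e g⟫ = g.1 * F.x1 v + g.2 * F.x2 v - CM.Ψ F e g * F.z v - 1 := by
    rw [← Frame.nor_inner, ← hone, ← inner_sub_right]; congr 1; abel
  have k1 : ∀ q, f1 (q - F.c) = F.x1 q := fun q => rfl
  have k2 : ∀ q, f2 (q - F.c) = F.x2 q := fun q => rfl
  have k0 : ∀ q, f0 (q - F.c) = F.z q := fun q => by
    simp only [f0, il_apply, Frame.z]
    rw [inner_neg_left, ← inner_neg_right, neg_sub]
  rw [e0, Quad.shift_q]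
  simp only [Quad.q, Q0, hB, LinearMap.neg_apply, k1, k2, k0]
  obtain ⟨a1, a2⟩ := hz g hg
  have a3 := hc0 g hg
  have a4 : CM.Ψ F e g * F.z (e g) = g.1 * F.x1 (e g) + g.2 * F.x2 (e g) - 1 := by
    rw [CM.Ψ]; field_simp
  rw [CM.P1, div_eq_iff hzp.ne'] at a1
  rw [CM.P2, div_eq_iff hzp.ne'] at a2
  rw [one_div, inv_mul_eq_div, eq_div_iff hzp.ne']
  generalize CM.Ψ F e g = ψ at *
  generalize F.z (e g) = ζ at *
  generalize F.x1 (e g) = X1 at *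
  generalize F.x2 (e g) = X2 at *
  subst a1 a2
  rw [hc1]
  have a5 : ζ * (ψ - (g.1 * (g.1 + z1) + g.2 * (g.2 + z2))) = -1 := by linear_combination a4
  have a6 : ψ = (g.1 ^ 2 + g.2 ^ 2) / 2 + z1 * g.1 + z2 * g.2 + c0 := by linear_combination a3
  rw [a6] at a5 ⊢
  linear_combination (F.z v) * a5

lemma exists_frame {c ν : E3} (hct : Contact L c ν) (hν1 : ‖ν‖ = 1) : ∃ F : Frame, F.Ok L ∧ F.c = c ∧ F.ν = ν := by
  have : Fact (Module.finrank ℝ E3 = 2 + 1) := ⟨by simp⟩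
  have hfr : Module.finrank ℝ (ℝ ∙ ν)ᗮ = 2 := Submodule.finrank_orthogonal_span_singleton hct.2.1
  let b := (stdOrthonormalBasis ℝ (ℝ ∙ ν)ᗮ).reindex (finCongr hfr)
  have ho : ∀ i, ⟪ν, (b i : E3)⟫ = 0 := fun i =>
    Submodule.mem_orthogonal_singleton_iff_inner_right.1 (b i).2
  have hbo : ∀ i j, ⟪(b i : E3), (b j : E3)⟫ = if i = j then 1 else 0 := fun i j => by
    have := orthonormal_iff_ite.1 b.orthonormal i j
    rwa [Submodule.coe_inner] at this
  refine ⟨⟨c, ν, b 0, b 1, b 0, b 1⟩, ?_, rfl, rfl⟩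
  constructor
  · exact hct
  · rw [real_inner_self_eq_norm_sq, hν1, one_pow]
  · exact (hbo 0 0).trans (by simp)
  · exact (hbo 0 1).trans (by simp)
  · exact (hbo 1 0).trans (by simp)
  · exact (hbo 1 1).trans (by simp)
  · exact ho 0
  · exact ho 1
  · rw [real_inner_comm]; exact ho 0
  · rw [real_inner_comm]; exact ho 1
  · intro v
    have hw : v - ⟪ν, v⟫ • ν ∈ (ℝ ∙ ν)ᗮ := by
      rw [Submodule.mem_orthogonal_singleton_iff_inner_right, inner_sub_right, inner_smul_right,
        real_inner_self_eq_norm_sq, hν1]; ring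
    have := congrArg Subtype.val (b.sum_repr' ⟨_, hw⟩)
    simp only [Fin.sum_univ_two, Submodule.coe_add, Submodule.coe_smul, Submodule.coe_inner] at this
    have hk : ∀ i, ⟪(b i : E3), v - ⟪ν, v⟫ • ν⟫ = ⟪(b i : E3), v⟫ := fun i => by
      have := ho i
      rw [real_inner_comm] at this
      rw [inner_sub_right, real_inner_smul_right (b i : E3) ν, this]; ring
    rw [hk, hk] at this
    show v = ⟪(b 0 : E3), v⟫ • (b 0 : E3) + ⟪(b 1 : E3), v⟫ • (b 1 : E3) + ⟪ν, v⟫ • ν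
    conv_lhs => rw [← sub_add_cancel v (⟪ν, v⟫ • ν), ← this]

end

end

section
open scoped RealInnerProductSpace Topology
open Filter

/-- the quadric holds near `c` -/
def PNear (L : Set E3) (Q : Quad) (c : E3) : Prop :=
  ∃ ρ > 0, ∀ e n, Contact L e n → ‖e - c‖ < ρ → Q.Hold e n

section
variable {K L : Set E3} {Δ : E3 → AffineSubspace ℝ E3}

theorem chain_XX (hs : Setup K L Δ) {F : Frame} (h : F.Ok L) {e : ℝ × ℝ → E3} (m : CM F L e) {Q : Quad}
    (hP : PNear L Q F.c) : ∀ g ∈ XX (F.k K), Q.Hold (e g) (F.nor g (CM.Ψ F e g)) := by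
  have hb := hs.body
  obtain ⟨ρ, hρ, H⟩ := hP
  obtain ⟨R, hR0, hR⟩ := m.decay h hb hρ
  obtain ⟨Km, hPD⟩ := CM.toPD hs h m
  obtain ⟨t, ht⟩ := H _ _ h.contact (by rw [sub_self, norm_zero]; exact hρ)
  have ht0 : t ≠ 0 := Quad.Hold.ne h.contact.2.1 ht
  set Q' := Q.shift (-F.c) with hQ'
  have hq : ∀ e v, Q.q e v = Q'.q (e - F.c) (v - F.c) := fun e v => by
    rw [hQ', Quad.shift_q]; simp
  have hl : ∀ w, ⟪F.ν, w⟫ = t * (Q'.l w + Q'.κ) := fun w => by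
    have := ht (F.c + w)
    rw [hq, add_sub_cancel_left, sub_self] at this
    rw [this]; simp [Quad.q]
  have hκ : Q'.κ = 0 := by
    have := hl 0
    rw [inner_zero_right, map_zero, zero_add] at this
    exact (mul_eq_zero.1 this.symm).resolve_left ht0
  simp only [hκ, add_zero] at hl
  set A : E3 → E3 → ℝ := fun v w => t * Q'.B v w with hA
  have hsymA : ∀ v w, A v w = A w v := fun v w => by simp only [hA]; rw [Q'.sym]
  have hqA : ∀ e v, t * Q.q e v = A (e - F.c) (v - F.c) - F.z e - F.z v := fun e v => by
    have e1 : F.z e = - ⟪F.ν, e - F.c⟫ := by rw [Frame.z, ← inner_neg_right, neg_sub]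
    have e2 : F.z v = - ⟪F.ν, v - F.c⟫ := by rw [Frame.z, ← inner_neg_right, neg_sub]
    rw [e1, e2, hl, hl, hq, Quad.q, hκ]; simp only [hA]; ring
  have hexp : ∀ q, q - F.c = F.x1 q • F.b1 + F.x2 q • F.b2 - F.z q • F.ν := fun q => by
    conv_lhs => rw [h.exp (q - F.c)]
    rw [Frame.z, ← neg_sub q F.c, inner_neg_right, neg_smul, sub_neg_eq_add]; rfl
  have hAe : ∀ q w, A (q - F.c) w = F.x1 q * A F.b1 w + F.x2 q * A F.b2 w - F.z q * A F.ν w := fun q w => by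
    rw [hexp q]; simp only [hA, map_sub, map_add, map_smul, LinearMap.sub_apply, LinearMap.add_apply,
      LinearMap.smul_apply, smul_eq_mul]; ring
  have hstar : ∀ g, Q.Hold (e g) (F.nor g (CM.Ψ F e g)) → ∀ w,
      F.z (e g) * ⟪F.nor g (CM.Ψ F e g), w⟫ = A (e g - F.c) w + ⟪F.ν, w⟫ := by
    rintro g ⟨s, hsv⟩ w
    have hone := m.inner_one h hb g
    have e1 := hsv (F.c + w)
    have e0 := hsv F.c
    have q1 := hqA (e g) (F.c + w)
    have q0 := hqA (e g) F.c
    have z1 : F.z (F.c + w) = - ⟪F.ν, w⟫ := by rw [Frame.z, ← inner_neg_right]; congr 1; abel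
    have z0 : A (e g - F.c) 0 = 0 := by simp [hA]
    rw [add_sub_cancel_left, z1] at q1
    rw [sub_self, Frame.z_c, z0] at q0
    have r0 : ⟪F.nor g (CM.Ψ F e g), F.c - e g⟫ = -1 := by
      rw [← hone, ← inner_neg_right, neg_sub]
    have r1 : ⟪F.nor g (CM.Ψ F e g), F.c + w - e g⟫ = ⟪F.nor g (CM.Ψ F e g), w⟫ - 1 := by
      rw [sub_eq_add_neg _ (1:ℝ), ← r0, ← inner_add_right]; congr 1; abel
    rw [r0] at e0
    rw [r1] at e1
    have : t * (F.z (e g) * ⟪F.nor g (CM.Ψ F e g), w⟫) = t * (A (e g - F.c) w + ⟪F.ν, w⟫) := by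
      have hsz : s * F.z (e g) = t := by linear_combination s * q0 + t * e0
      linear_combination (t * F.z (e g)) * e1 + (s * F.z (e g)) * q1 + (A (e g - F.c) w + ⟪F.ν, w⟫ - F.z (e g)) * hsz
    exact mul_left_cancel₀ ht0 this
  have hfar : ∀ g : ℝ × ℝ, R ≤ ‖g‖ → ∀ w,
      F.z (e g) * ⟪F.nor g (CM.Ψ F e g), w⟫ = A (e g - F.c) w + ⟪F.ν, w⟫ := fun g hg =>
    hstar g (H _ _ (m.contact h hb g) (hR g hg))
  have hΨ : ∀ g, F.z (e g) * CM.Ψ F e g = g.1 * F.x1 (e g) + g.2 * F.x2 (e g) - 1 := fun g => by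
    have := (m.zpos h hb g).ne'
    rw [CM.Ψ]; field_simp
  have hAee : ∀ g, A (e g - F.c) (e g - F.c) = F.x1 (e g) ^ 2 * A F.b1 F.b1 + 2 * F.x1 (e g) * F.x2 (e g) * A F.b1 F.b2
      + F.x2 (e g) ^ 2 * A F.b2 F.b2 - 2 * F.z (e g) * (F.x1 (e g) * A F.ν F.b1 + F.x2 (e g) * A F.ν F.b2)
      + F.z (e g) ^ 2 * A F.ν F.ν := fun g => by
    rw [hAe, hsymA F.b1, hsymA F.b2, hsymA F.ν, hAe, hAe, hAe, hsymA F.b2 F.b1, hsymA F.b1 F.ν, hsymA F.b2 F.ν]; ring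
  intro g hg
  have hmain := hPD.chain (B11 := A F.b1 F.b1) (B12 := A F.b1 F.b2) (B22 := A F.b2 F.b2) (β1 := A F.ν F.b1)
    (β2 := A F.ν F.b2) (γ := A F.ν F.ν) (R := R) (by
      intro g hg
      have hz := (m.zpos h hb g).ne'
      have := hfar g hg F.b1
      rw [CM.nor_b1 h, h.nb1, hAe, hsymA F.b2 F.b1] at this
      rw [CM.P1, CM.P2]; field_simp; linear_combination -this) (by
      intro g hg
      have hz := (m.zpos h hb g).ne'
      have := hfar g hg F.b2
      rw [CM.nor_b2 h, h.nb2, hAe] at this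
      rw [CM.P1, CM.P2]; field_simp; linear_combination -this) (by
      intro g hg
      have hz := (m.zpos h hb g).ne'
      have := hfar g hg (e g - F.c)
      have e1 : ⟪F.ν, e g - F.c⟫ = - F.z (e g) := by rw [Frame.z, ← inner_neg_right, neg_sub]
      rw [m.inner_one h hb g, hAee, e1] at this
      have h2 := hΨ g
      rw [CM.P1, CM.P2]; field_simp; linear_combination this - 2 * F.z (e g) * h2) g hg
  obtain ⟨m1, m2, m3⟩ := hmain
  have hz := (m.zpos h hb g).ne'
  have h2 := hΨ g
  rw [CM.P1, CM.P2] at m1 m2 m3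
  have n1 : F.z (e g) * g.1 = A (e g - F.c) F.b1 := by
    rw [hAe, hsymA F.b2 F.b1]; field_simp at m1; linear_combination -m1
  have n2 : F.z (e g) * g.2 = A (e g - F.c) F.b2 := by
    rw [hAe]; field_simp at m2; linear_combination -m2
  have n3 : A (e g - F.c) (e g - F.c) = 2 * F.z (e g) := by
    rw [hAee]
    field_simp at m3
    linear_combination -m3 - 2 * F.z (e g) * h2
  have n4 : F.z (e g) * CM.Ψ F e g = A (e g - F.c) F.ν + 1 := by
    have e1 := hAe (e g) (e g - F.c)
    rw [hsymA F.b1, hsymA F.b2, hsymA F.ν, ← n1, ← n2, n3] at e1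
    have : F.z (e g) * (F.z (e g) * CM.Ψ F e g) = F.z (e g) * (A (e g - F.c) F.ν + 1) := by
      linear_combination F.z (e g) * h2 - e1
    exact mul_left_cancel₀ hz this
  refine ⟨t / F.z (e g), fun v => ?_⟩
  have e0 : ⟪F.nor g (CM.Ψ F e g), v - e g⟫ = g.1 * F.x1 v + g.2 * F.x2 v - CM.Ψ F e g * F.z v - 1 := by
    rw [← Frame.nor_inner, ← m.inner_one h hb g, ← inner_sub_right]; congr 1; abel
  have e2 := hqA (e g) v
  rw [hsymA, hAe, hsymA F.b1, hsymA F.b2, hsymA F.ν, ← n1, ← n2] at e2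
  rw [e0, div_mul_eq_mul_div, e2, eq_div_iff hz]
  linear_combination (-F.z v) * n4

end

end

section
open scoped RealInnerProductSpace Topology
open Filter

section
variable {K L : Set E3} {Δ : E3 → AffineSubspace ℝ E3}

lemma Body.ball_sub (hb : Body L) : ∃ ρ > 0, ∀ e n, Contact L e n → ρ * ‖n‖ ≤ ⟪n, e⟫ := by
  obtain ⟨r, hr, hbb⟩ := Metric.isOpen_iff.1 isOpen_interior _ hb.zero_mem
  refine ⟨r / 2, by positivity, fun e n h => ?_⟩
  have hnn : 0 < ‖n‖ := norm_pos_iff.2 h.2.1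
  have hm : (r / (2 * ‖n‖)) • n ∈ ball (0 : E3) r := by
    rw [mem_ball, dist_zero_right, norm_smul, Real.norm_of_nonneg (by positivity)]
    have : r / (2 * ‖n‖) * ‖n‖ = r / 2 := by field_simp
    rw [this]; linarith
  have := h.2.2 _ (interior_subset (hbb hm))
  rw [inner_smul_right, real_inner_self_eq_norm_sq] at this
  have e1 : r / (2 * ‖n‖) * ‖n‖ ^ 2 = r / 2 * ‖n‖ := by field_simp
  linarith

theorem near_XX (hs : Setup K L Δ) : ∃ r > 0, ∀ F : Frame, F.Ok L → ∀ e n, Contact L e n → ⟪n, e - F.c⟫ = 1 →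
    ‖e - F.c‖ < r → (⟪n, F.b1⟫, ⟪n, F.b2⟫) ∈ XX (F.k K) := by
  have hb := hs.body
  obtain ⟨ρ, hρ, hball⟩ := hb.ball_sub
  obtain ⟨δ, hδ, hth⟩ := hb.comp.exists_thickening_subset_open isOpen_interior hs.sub
  obtain ⟨Rm, hRm⟩ := hb.comp.isBounded.exists_norm_le
  have hRm0 : 0 ≤ Rm := (norm_nonneg _).trans (hRm 0 (interior_subset hb.zero_mem))
  refine ⟨min ρ (δ * ρ / (Rm + 1)), lt_min hρ (by positivity), fun F h e n hc h1 hr => ?_⟩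
  have hr1 := hr.trans_le (min_le_left _ _)
  have hr2 := hr.trans_le (min_le_right _ _)
  have hν : ‖F.ν‖ = 1 := by
    have := h.nu1
    rw [real_inner_self_eq_norm_sq] at this
    exact (pow_eq_one_iff_of_nonneg (norm_nonneg _) two_ne_zero).1 this
  have hνc : ρ ≤ ⟪F.ν, F.c⟫ := by
    have := hball _ _ h.contact
    rwa [hν, mul_one] at this
  have hνc0 : 0 < ⟪F.ν, F.c⟫ := hρ.trans_le hνc
  set s := ⟪F.ν, F.c - e⟫ / ⟪F.ν, F.c⟫ with hsd
  have hs0 : 0 ≤ s := div_nonneg (h.z_nonneg hc.1) hνc0.le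
  have hs1 : s * ρ ≤ ‖e - F.c‖ := by
    have e1 : s * ⟪F.ν, F.c⟫ = ⟪F.ν, F.c - e⟫ := div_mul_cancel₀ _ hνc0.ne'
    have e2 := real_inner_le_norm F.ν (F.c - e)
    rw [hν, one_mul, norm_sub_rev] at e2
    have := mul_le_mul_of_nonneg_left hνc hs0
    linarith
  set τ := e - F.c + s • F.c with hτ
  have hντ : ⟪F.ν, τ⟫ = 0 := by
    have e1 : s * ⟪F.ν, F.c⟫ = ⟪F.ν, F.c - e⟫ := div_mul_cancel₀ _ hνc0.ne'
    rw [hτ, inner_add_right, inner_smul_right, e1, ← inner_add_right]; simp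
  have hnc : 0 ≤ ⟪n, F.c⟫ := by
    have e1 := hball _ _ hc
    have e2 := real_inner_le_norm n (e - F.c)
    have e3 := mul_le_mul_of_nonneg_left hr1.le (norm_nonneg n)
    rw [inner_sub_right] at h1 e2
    nlinarith
  have hnτ : 1 ≤ ⟪n, τ⟫ := by
    rw [hτ, inner_add_right, h1, inner_smul_right]
    have := mul_nonneg hs0 hnc
    linarith
  have hmem : F.c + τ ∈ interior K := by
    apply hth
    rw [Metric.mem_thickening_iff]
    refine ⟨e, hc.1, ?_⟩
    rw [dist_eq_norm]
    have : F.c + τ - e = s • F.c := by rw [hτ]; abel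
    rw [this, norm_smul, Real.norm_of_nonneg hs0]
    rw [lt_div_iff₀ (by positivity)] at hr2
    have e1 := hRm _ h.contact.1
    have e2 : s * ρ * (Rm + 1) ≤ ‖e - F.c‖ * (Rm + 1) := mul_le_mul_of_nonneg_right hs1 (by positivity)
    have e3 : s * (Rm + 1) * ρ < δ * ρ := by linarith
    have e4 := lt_of_mul_lt_mul_right e3 hρ.le
    have e5 : s * ‖F.c‖ ≤ s * (Rm + 1) := mul_le_mul_of_nonneg_left (by linarith) hs0
    linarith
  have hg : gauge (F.Kc K) τ < 1 := by
    rw [gauge_lt_one_iff_mem_interior (Frame.Kc_convex hs.kconv) (F.Kc_nhds (hs.sub h.contact.1)), Frame.Kc_eq,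
      ← Homeomorph.preimage_interior]
    exact hmem
  obtain ⟨a, ha1, ha2⟩ := exists_angle (⟪F.d1, τ⟫, ⟪F.d2, τ⟫)
  simp only at ha1 ha2
  set ρ' := Real.sqrt (⟪F.d1, τ⟫ ^ 2 + ⟪F.d2, τ⟫ ^ 2) with hρ'
  have hρ0 : 0 ≤ ρ' := Real.sqrt_nonneg _
  have hτu : τ = ρ' • F.u a := by
    rw [h.exp τ, hντ, zero_smul, add_zero, ha1, ha2, Frame.u, smul_add, smul_smul, smul_smul]
  have hg2 : ρ' * F.k K a < 1 := by
    rw [hτu, gauge_smul_of_nonneg hρ0, smul_eq_mul] at hg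
    exact hg
  have hn2 : 1 ≤ ρ' * (⟪n, F.b1⟫ * Real.cos a + ⟪n, F.b2⟫ * Real.sin a) := by
    rw [hτu, inner_smul_right, Frame.u, inner_add_right, inner_smul_right, inner_smul_right] at hnτ
    linarith
  exact ⟨a, lt_of_mul_lt_mul_left (hg2.trans_le hn2) hρ0⟩

lemma Body.preconn (hb : Body L) : IsPreconnected (frontier L) := by
  obtain ⟨f, -, -, hf⟩ := exists_homeomorph_image_eq (s := closedBall (0 : E3) 1) (t := L) (convex_closedBall _ _)
    (by rw [interior_closedBall _ one_ne_zero]; exact ⟨0, by simp⟩)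
    ((isCompact_closedBall _ _).isVonNBounded ℝ) hb.str.convex hb.int (hb.comp.isVonNBounded ℝ)
  rw [← hf, frontier_closedBall _ one_ne_zero]
  apply (isPreconnected_sphere _ _ _).image _ f.continuous.continuousOn
  rw [← Module.finrank_eq_rank]
  simp

lemma Contact.frontier {e n : E3} (h : Contact L e n) : e ∈ frontier L :=
  ⟨subset_closure h.1, not_interior_of_max h.2.1 h.2.2⟩

lemma hold_of_XX (hb : Body L) {r : ℝ} (hr : ∀ F : Frame, F.Ok L → ∀ e n, Contact L e n → ⟪n, e - F.c⟫ = 1 →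
    ‖e - F.c‖ < r → (⟪n, F.b1⟫, ⟪n, F.b2⟫) ∈ XX (F.k K)) {F : Frame} (h : F.Ok L) {e : ℝ × ℝ → E3} (m : CM F L e)
    {Q : Quad} (H : ∀ g ∈ XX (F.k K), Q.Hold (e g) (F.nor g (CM.Ψ F e g))) {q n : E3} (hc : Contact L q n)
    (hq : ‖q - F.c‖ < r) (hne : q ≠ F.c) : Q.Hold q n := by
  have hp := hc.pos hb.str h.contact.1 hne.symm
  have hp' : 0 < ⟪n, q - F.c⟫ := by rw [inner_sub_right]; linarith
  set t := ⟪n, q - F.c⟫ with ht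
  have hc' : Contact L q (t⁻¹ • n) := ⟨hc.1, smul_ne_zero (inv_ne_zero hp'.ne') hc.2.1, fun v hv => by
    rw [real_inner_smul_left, real_inner_smul_left]
    exact mul_le_mul_of_nonneg_left (hc.2.2 v hv) (inv_nonneg.2 hp'.le)⟩
  have h1 : ⟪t⁻¹ • n, q - F.c⟫ = 1 := by rw [real_inner_smul_left, ← ht, inv_mul_cancel₀ hp'.ne']
  obtain ⟨e1, e2⟩ := m.eq_of_contact h hb hc' h1
  have := H _ (hr F h q _ hc' h1 hq)
  rw [← e1, ← e2] at this
  have := this.smul t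
  rwa [smul_smul, mul_inv_cancel₀ hp'.ne', one_smul] at this

theorem exists_quad (hs : Setup K L Δ) : ∃ Q : Quad, ∀ e n, Contact L e n → Q.Hold e n := by
  have hb := hs.body
  obtain ⟨r, hr0, hr⟩ := near_XX hs
  obtain ⟨F, h, e, m, Q, HQ⟩ := hs.base
  have hbase : ∀ q n, Contact L q n → ‖q - F.c‖ < r → q ≠ F.c → Q.Hold q n := fun q n hc hq hne =>
    hold_of_XX hb hr h m HQ hc hq hne
  have hstep : ∀ c ∈ frontier L, PNear L Q c → ∀ q n, Contact L q n → ‖q - c‖ < r → Q.Hold q n := by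
    intro c hc hP q n hqn hq
    by_cases hne : q = c
    · obtain ⟨ρ, hρ, H⟩ := hP
      exact H q n hqn (by rw [hne, sub_self, norm_zero]; exact hρ)
    obtain ⟨ν, hν⟩ := hb.exists_contact hc
    have hνp : 0 < ‖ν‖ := norm_pos_iff.2 hν.2.1
    have hν' : Contact L c (‖ν‖⁻¹ • ν) := ⟨hν.1, smul_ne_zero (inv_ne_zero hνp.ne') hν.2.1, fun v hv => by
      rw [real_inner_smul_left, real_inner_smul_left]
      exact mul_le_mul_of_nonneg_left (hν.2.2 v hv) (inv_nonneg.2 hνp.le)⟩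
    obtain ⟨F', h', hFc, -⟩ := exists_frame hν' (by rw [norm_smul, norm_inv, norm_norm, inv_mul_cancel₀ hνp.ne'])
    obtain ⟨e', m'⟩ := h'.exists_CM hb
    subst hFc
    exact hold_of_XX hb hr h' m' (chain_XX hs h' m' hP) hqn hq hne
  have hPn : ∀ c ∈ frontier L, PNear L Q c → ∀ q, ‖q - c‖ < r → PNear L Q q := by
    intro c hc hP q hq
    refine ⟨r - ‖q - c‖, by linarith, fun e n hen he => hstep c hc hP e n hen ?_⟩
    have := norm_add_le (e - q) (q - c)
    rw [sub_add_sub_cancel] at this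
    linarith
  obtain ⟨R, hR0, hR⟩ := m.decay h hb hr0
  have hx0 : ∃ c ∈ frontier L, PNear L Q c := by
    set g : ℝ × ℝ := (R, R) with hg
    have hgR : R ≤ ‖g‖ := by rw [hg, Prod.norm_def]; simp [le_abs_self]
    have hcon := m.contact h hb g
    have hne : e g ≠ F.c := h.rel_ne hb (m.rel g)
    have hd : 0 < ‖e g - F.c‖ := norm_pos_iff.2 (sub_ne_zero.2 hne)
    have hlt := hR g hgR
    refine ⟨e g, hcon.frontier, min ‖e g - F.c‖ (r - ‖e g - F.c‖), lt_min hd (by linarith), fun q n hqn hq => ?_⟩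
    have q1 := hq.trans_le (min_le_left _ _)
    have q2 := hq.trans_le (min_le_right _ _)
    apply hbase q n hqn
    · have := norm_add_le (q - e g) (e g - F.c)
      rw [sub_add_sub_cancel] at this
      linarith
    · rintro rfl
      rw [norm_sub_rev] at q1
      exact lt_irrefl _ q1
  obtain ⟨c0, hc0, hP0⟩ := hx0
  set U : Set E3 := ⋃ c ∈ {c | c ∈ frontier L ∧ PNear L Q c}, ball c (r / 2) with hU
  have hUm : ∀ x, x ∈ U ↔ ∃ c, (c ∈ frontier L ∧ PNear L Q c) ∧ dist x c < r / 2 := by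
    intro x; simp [hU, mem_iUnion]
  have hUo : IsOpen U := isOpen_biUnion fun _ _ => isOpen_ball
  have hsub := hb.preconn.subset_of_closure_inter_subset hUo
    ⟨c0, hc0, (hUm _).2 ⟨c0, ⟨hc0, hP0⟩, by rw [dist_self]; positivity⟩⟩ (by
    rintro x ⟨hx, hxL⟩
    obtain ⟨y, hy, hxy⟩ := Metric.mem_closure_iff.1 hx (r / 2) (by positivity)
    obtain ⟨c, ⟨hc, hP⟩, hyc⟩ := (hUm _).1 hy
    have := dist_triangle x y c
    refine (hUm _).2 ⟨x, ⟨hxL, hPn c hc hP x ?_⟩, by rw [dist_self]; positivity⟩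
    rw [← dist_eq_norm]; linarith)
  refine ⟨Q, fun e n hen => ?_⟩
  obtain ⟨c, ⟨hc, hP⟩, hd⟩ := (hUm _).1 (hsub hen.frontier)
  exact hstep c hc hP e n hen (by rw [← dist_eq_norm]; linarith)

end

end

section
open scoped RealInnerProductSpace Topology
open Filter

section
variable {K L : Set E3} {Δ : E3 → AffineSubspace ℝ E3}

lemma Body.exists_scale (hb : Body L) {v : E3} (hv : v ≠ 0) : ∃ s : ℝ, s > 0 ∧ s • v ∈ frontier L := by
  have hn : L ∈ 𝓝 (0 : E3) := mem_interior_iff_mem_nhds.1 hb.zero_mem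
  have hg : 0 < gauge L v := (gauge_pos (absorbent_nhds_zero hn) (hb.comp.isVonNBounded ℝ)).2 hv
  refine ⟨(gauge L v)⁻¹, inv_pos.2 hg, ?_⟩
  rw [← gauge_eq_one_iff_mem_frontier hb.str.convex hn, gauge_smul_of_nonneg (inv_nonneg.2 hg.le), smul_eq_mul,
    inv_mul_cancel₀ hg.ne']

lemma Body.neg_mem (hb : Body L) {v : E3} (hv : v ∈ L) : -v ∈ L := by
  rw [hb.sym] at hv; exact hv

lemma Contact.neg (hb : Body L) {e n : E3} (h : Contact L e n) : Contact L (-e) (-n) :=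
  ⟨hb.neg_mem h.1, neg_ne_zero.2 h.2.1, fun q hq => by
    have := h.2.2 _ (hb.neg_mem hq)
    rw [inner_neg_right] at this
    rw [inner_neg_left, inner_neg_neg]; exact this⟩

theorem exists_G (hs : Setup K L Δ) : ∃ G : E3 →ₗ[ℝ] E3 →ₗ[ℝ] ℝ, (∀ v w, G v w = G w v) ∧
    (∀ e n, Contact L e n → ∀ v, ⟪n, v⟫ = ⟪n, e⟫ * G e v) ∧ (∀ e, G e e = 1 → e ∈ frontier L) ∧
    (∀ v, v ≠ 0 → 0 < G v v) ∧ (∀ v, v ∉ L → 1 < G v v) := by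
  have hb := hs.body
  obtain ⟨Q, HQ⟩ := exists_quad hs
  obtain ⟨ρ, hρ, hball⟩ := hb.ball_sub
  have hpos : ∀ e n, Contact L e n → 0 < ⟪n, e⟫ := fun e n h =>
    (mul_pos hρ (norm_pos_iff.2 h.2.1)).trans_le (hball e n h)
  have hl1 : ∀ e ∈ frontier L, Q.l e = 0 := by
    intro e he
    obtain ⟨n, hn⟩ := hb.exists_contact he
    have h1 := (HQ _ _ hn).self hn.2.1
    have h2 := (HQ _ _ (hn.neg hb)).self (hn.neg hb).2.1
    simp only [Quad.q, map_neg, LinearMap.neg_apply, neg_neg] at h1 h2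
    linarith
  have hl : ∀ v, Q.l v = 0 := by
    intro v
    by_cases hv : v = 0
    · rw [hv, map_zero]
    obtain ⟨s, hs0, hsv⟩ := hb.exists_scale hv
    have := hl1 _ hsv
    rw [map_smul, smul_eq_mul] at this
    exact (mul_eq_zero.1 this).resolve_left hs0.ne'
  have hH : ∀ e n, Contact L e n → ∃ t, ∀ v, ⟪n, v⟫ - ⟪n, e⟫ = t * (Q.B e v + Q.κ) := by
    intro e n h
    obtain ⟨t, ht⟩ := HQ e n h
    refine ⟨t, fun v => ?_⟩
    rw [← inner_sub_right, ht, Quad.q, hl, hl]; ring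
  have hfr : ∀ v, v ≠ 0 → ∃ s : ℝ, s > 0 ∧ ∃ n, Contact L (s • v) n := by
    intro v hv
    obtain ⟨s, hs0, hsv⟩ := hb.exists_scale hv
    obtain ⟨n, hn⟩ := hb.exists_contact hsv
    exact ⟨s, hs0, n, hn⟩
  have hκ : Q.κ ≠ 0 := by
    intro hκ
    obtain ⟨w, hw⟩ := exists_ne (0 : E3)
    obtain ⟨s, hs0, n, hn⟩ := hfr w hw
    obtain ⟨t, ht⟩ := hH _ _ hn
    have h1 := ht 0
    rw [hκ, map_zero, inner_zero_right] at h1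
    have := hpos _ _ hn
    linarith
  set G : E3 →ₗ[ℝ] E3 →ₗ[ℝ] ℝ := (-(Q.κ)⁻¹) • Q.B with hG
  have hGv : ∀ v w, G v w = -(Q.κ)⁻¹ * Q.B v w := fun v w => rfl
  have hmain : ∀ e n, Contact L e n → ∀ v, ⟪n, v⟫ = ⟪n, e⟫ * G e v := by
    intro e n h v
    obtain ⟨t, ht⟩ := hH _ _ h
    have h0 := ht 0
    rw [map_zero, inner_zero_right, zero_add, zero_sub] at h0
    have h1 := ht v
    rw [hGv]
    have : ⟪n, e⟫ = - (t * Q.κ) := by linarith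
    rw [this] at h1 ⊢
    field_simp
    linarith
  have hee : ∀ e n, Contact L e n → G e e = 1 := by
    intro e n h
    have h1 := hmain e n h e
    have := hpos e n h
    exact mul_left_cancel₀ this.ne' (by linarith)
  have hsc : ∀ v, v ≠ 0 → ∃ s : ℝ, s > 0 ∧ s • v ∈ frontier L ∧ s ^ 2 * G v v = 1 := by
    intro v hv
    obtain ⟨s, hs0, n, hn⟩ := hfr v hv
    refine ⟨s, hs0, hn.frontier, ?_⟩
    have := hee _ _ hn
    rw [map_smul, map_smul, LinearMap.smul_apply, smul_eq_mul, smul_eq_mul] at this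
    linarith
  refine ⟨G, fun v w => by rw [hGv, hGv, Q.sym], hmain, ?_, ?_, ?_⟩
  · intro e he
    have h0 : e ≠ 0 := by rintro rfl; simp at he
    obtain ⟨s, hs0, hf, h1⟩ := hsc e h0
    rw [he, mul_one] at h1
    rw [(pow_eq_one_iff_of_nonneg hs0.le two_ne_zero).1 h1, one_smul] at hf
    exact hf
  · intro v hv
    obtain ⟨s, hs0, hf, h1⟩ := hsc v hv
    have : 0 < s ^ 2 * G v v := by rw [h1]; exact one_pos
    exact pos_of_mul_pos_right this (by positivity)
  · intro v hv
    have h0 : v ≠ 0 := by rintro rfl; exact hv (interior_subset hb.zero_mem)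
    obtain ⟨s, hs0, hf, h1⟩ := hsc v h0
    by_contra hcon
    push Not at hcon
    have hs1 : 1 ≤ s := by
      by_contra hs1
      push Not at hs1
      have e1 : s ^ 2 < 1 := by nlinarith
      have e2 : s ^ 2 * G v v ≤ s ^ 2 * 1 := mul_le_mul_of_nonneg_left hcon (by positivity)
      linarith
    apply hv
    have hm := hb.comp.isClosed.frontier_subset hf
    have := hb.str.convex.smul_mem_of_zero_mem (interior_subset hb.zero_mem) hm
      (t := s⁻¹) ⟨inv_nonneg.2 hs0.le, inv_le_one_of_one_le₀ hs1⟩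
    rwa [smul_smul, inv_mul_cancel₀ hs0.ne', one_smul] at this

lemma closed_cone (hb : Body L) {x : E3} (hx : x ∉ L) : IsClosed (coneGen L x) := by
  apply isClosed_of_closure_subset
  intro p hp
  obtain ⟨δ, hδ, hd⟩ : ∃ δ > 0, ∀ y ∈ L, δ ≤ ‖y - x‖ := by
    obtain ⟨δ, hδ, hd⟩ := Metric.isOpen_iff.1 hb.comp.isClosed.isOpen_compl x hx
    refine ⟨δ, hδ, fun y hy => ?_⟩
    by_contra hcon
    push Not at hcon
    exact hd (by rwa [mem_ball, dist_eq_norm]) hy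
  set M := (‖p - x‖ + 1) / δ with hM
  have hc : IsCompact ((fun a : E3 × ℝ => x + a.2 • (a.1 - x)) '' (L ×ˢ Icc 0 M)) :=
    (hb.comp.prod isCompact_Icc).image (by fun_prop)
  have hsub : ball p 1 ∩ coneGen L x ⊆ (fun a : E3 × ℝ => x + a.2 • (a.1 - x)) '' (L ×ˢ Icc 0 M) := by
    rintro q ⟨hq, y, hy, l, hl, rfl⟩
    refine ⟨(y, l), ⟨hy, hl, ?_⟩, rfl⟩
    rw [mem_ball, dist_eq_norm] at hq
    rw [hM, le_div_iff₀ hδ]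
    have e1 : l * ‖y - x‖ = ‖(x + l • (y - x) - p) + (p - x)‖ := by
      rw [sub_add_sub_cancel, add_sub_cancel_left, norm_smul, Real.norm_of_nonneg hl]
    have e2 := norm_add_le (x + l • (y - x) - p) (p - x)
    have e3 := mul_le_mul_of_nonneg_left (hd y hy) hl
    linarith
  have h1 : p ∈ closure (ball p 1 ∩ coneGen L x) :=
    isOpen_ball.inter_closure ⟨mem_ball_self one_pos, hp⟩
  obtain ⟨⟨y, l⟩, ⟨hy, hl⟩, hyl⟩ := closure_minimal hsub hc.isClosed h1
  exact ⟨y, hy, l, hl.1, hyl.symm⟩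

lemma convex_cone (hb : Body L) (x : E3) : Convex ℝ (coneGen L x) := by
  rintro _ ⟨y, hy, l, hl, rfl⟩ _ ⟨y', hy', l', hl', rfl⟩ a b ha hbb hab
  set s := a * l + b * l' with hs
  have h1 : 0 ≤ a * l := mul_nonneg ha hl
  have h2 : 0 ≤ b * l' := mul_nonneg hbb hl'
  have hx : a • x + b • x = x := by rw [← add_smul, hab, one_smul]
  have key : a • (x + l • (y - x)) + b • (x + l' • (y' - x)) = x + ((a * l) • (y - x) + (b * l') • (y' - x)) := by
    have : b = 1 - a := by linarith
    subst this
    module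
  rw [key]
  rcases (add_nonneg h1 h2).eq_or_lt with h0 | h0
  · have e1 : a * l = 0 := by linarith
    have e2 : b * l' = 0 := by linarith
    exact ⟨y, hy, 0, le_rfl, by rw [e1, e2]; simp⟩
  · refine ⟨(a * l / s) • y + (b * l' / s) • y', hb.str.convex hy hy' (by positivity) (by positivity) ?_, s, h0.le, ?_⟩
    · rw [← add_div]; exact div_self h0.ne'
    · congr 1
      have e1 : s * (a * l / s) = a * l := mul_div_cancel₀ _ h0.ne'
      have e2 : s * (b * l' / s) = b * l' := mul_div_cancel₀ _ h0.ne'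
      rw [smul_sub s, smul_add, smul_smul, smul_smul, e1, e2, hs]
      module

lemma cone_id (hb : Body L) {G : E3 →ₗ[ℝ] E3 →ₗ[ℝ] ℝ} (hsym : ∀ v w, G v w = G w v)
    (hG : ∀ e n, Contact L e n → ∀ v, ⟪n, v⟫ = ⟪n, e⟫ * G e v) {x p : E3} (hx : x ∉ L) (hp : p ∈ suppCone L x) :
    (G x p - 1) ^ 2 = (G x x - 1) * (G p p - 1) := by
  have hcl := closed_cone hb hx
  have hpc : p ∈ coneGen L x := hcl.frontier_subset hp
  have hLc : L ⊆ coneGen L x := fun y hy => ⟨y, hy, 1, zero_le_one, by simp⟩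
  obtain ⟨n, hn, hsup⟩ := exists_support (convex_cone hb x) (hb.int.mono (interior_mono hLc)) hp.2
  obtain ⟨y, hy, l, hl, rfl⟩ := hpc
  rcases hl.eq_or_lt with h0 | h0
  · rw [← h0]; simp only [zero_smul, add_zero]; ring
  have a1 := hsup x ⟨y, hy, 0, le_rfl, by simp⟩
  have a2 := hsup (x + (2 * l) • (y - x)) ⟨y, hy, 2 * l, by positivity, rfl⟩
  simp only [inner_add_right, inner_smul_right] at a1 a2
  have a3 : l * ⟪n, y - x⟫ = 0 := by linarith
  have a4 : ⟪n, y - x⟫ = 0 := (mul_eq_zero.1 a3).resolve_left h0.ne'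
  have a5 : ⟪n, x⟫ = ⟪n, y⟫ := by rw [inner_sub_right] at a4; linarith
  have hc : Contact L y n := ⟨hy, hn, fun q hq => by
    have := hsup q (hLc hq)
    rw [inner_add_right, inner_smul_right, a3, a5] at this
    linarith⟩
  obtain ⟨ρ, hρ, hball⟩ := hb.ball_sub
  have hpos : 0 < ⟪n, y⟫ := (mul_pos hρ (norm_pos_iff.2 hn)).trans_le (hball _ _ hc)
  have g1 : G y x = 1 := by
    have := hG _ _ hc x
    exact mul_left_cancel₀ hpos.ne' (by linarith)
  have g2 : G y y = 1 := by
    have := hG _ _ hc y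
    exact mul_left_cancel₀ hpos.ne' (by linarith)
  have g3 : G x y = 1 := by rw [hsym, g1]
  simp only [map_add, map_sub, map_smul, LinearMap.add_apply, LinearMap.sub_apply, LinearMap.smul_apply, smul_eq_mul,
    g1, g2, g3]
  ring

theorem final (hs : Setup K L Δ) {x : E3} (hx : x ∈ frontier K) : ∃ P : AffineSubspace ℝ E3, IsPlane P ∧
      P.direction = (Δ x).direction ∧ suppCone L x ∩ suppCone L (-x) ⊆ (P : Set E3) := by
  have hb := hs.body
  obtain ⟨G, hsym, hG, hfr, hpos, hout⟩ := exists_G hs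
  obtain ⟨hpl, hgr⟩ := hs.hΔ x hx
  refine ⟨(Δ x).direction.toAffineSubspace, ?_, Submodule.toAffineSubspace_direction _, ?_⟩
  · rw [IsPlane, Submodule.toAffineSubspace_direction]; exact hpl
  have hxL : x ∉ L := fun h => hx.2 (hs.sub h)
  have hxL' : -x ∉ L := fun h => hxL (by simpa using hb.neg_mem h)
  rintro p ⟨hp1, hp2⟩
  have e1 := cone_id hb hsym hG hxL hp1
  have e2 := cone_id hb hsym hG hxL' hp2
  simp only [map_neg, LinearMap.neg_apply, neg_neg] at e2
  have h0 : G x p = 0 := by nlinarith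
  show p ∈ (Δ x).direction
  by_cases hp : p = 0
  · rw [hp]; exact zero_mem _
  have hx1 := hout x hxL
  have hx0 : 0 < G x x := by linarith
  have hp0 := hpos p hp
  have hq0 : 0 < (1 - (G x x)⁻¹) / G p p := div_pos (by
    have := inv_lt_one_of_one_lt₀ hx1
    linarith) hp0
  set s := Real.sqrt ((1 - (G x x)⁻¹) / G p p) with hsd
  have hs0 : 0 < s := Real.sqrt_pos.2 hq0
  have hs2 : s ^ 2 = (1 - (G x x)⁻¹) / G p p := Real.sq_sqrt hq0.le
  have hpx : G p x = 0 := by rw [hsym, h0]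
  have key : ∀ σ : ℝ, σ ^ 2 = s ^ 2 → (G x x)⁻¹ • x + σ • p ∈ Δ x := by
    intro σ hσ
    apply hgr
    have hee : G ((G x x)⁻¹ • x + σ • p) ((G x x)⁻¹ • x + σ • p) = 1 := by
      simp only [map_add, map_smul, LinearMap.add_apply, LinearMap.smul_apply, smul_eq_mul, h0, hpx]
      have : σ * (σ * G p p) = 1 - (G x x)⁻¹ := by
        rw [← mul_assoc, ← pow_two, hσ, hs2]; field_simp
      simp only [mul_zero, add_zero, zero_add]
      rw [this]; field_simp; ring
    obtain ⟨n, hn⟩ := hb.exists_contact (hfr _ hee)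
    apply hn.graze
    rw [hG _ _ hn x]
    have : G ((G x x)⁻¹ • x + σ • p) x = 1 := by
      simp only [map_add, map_smul, LinearMap.add_apply, LinearMap.smul_apply, smul_eq_mul, hpx]
      field_simp; ring
    rw [this, mul_one]
  have hd := AffineSubspace.vsub_mem_direction (key s rfl) (key (-s) (by ring))
  have e3 : ((G x x)⁻¹ • x + s • p) -ᵥ ((G x x)⁻¹ • x + (-s) • p) = (2 * s) • p := by
    rw [vsub_eq_sub]; module
  rw [e3] at hd
  exact (Submodule.smul_mem_iff _ (by positivity)).1 hd

end

end

theorem statement3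
    (K L : Set E3)
    (hKcomp : IsCompact K) (hKconv : Convex ℝ K) (hKint : (interior K).Nonempty)
    (hKsym : K = -K)
    (hLcomp : IsCompact L) (hLconv : Convex ℝ L) (hLint : (interior L).Nonempty)
    (hLsym : L = -L) (hLstrict : StrictConvex ℝ L)
    (hLK : L ⊆ interior K)
    (Δ : E3 → AffineSubspace ℝ E3)
    (hΔ : ∀ z ∈ frontier K, IsPlane (Δ z) ∧ graze L z ⊆ (Δ z : Set E3))
    (hAF : AlmostFree K L Δ) :
    ∀ x ∈ frontier K, ∃ P : AffineSubspace ℝ E3, IsPlane P ∧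
      P.direction = (Δ x).direction ∧
      suppCone L x ∩ suppCone L (-x) ⊆ (P : Set E3) := by
  exact fun x hx => final ⟨⟨hLcomp, hLstrict, hLsym, hLint⟩, hKcomp, hKconv, hLK, hΔ⟩ hx

end
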